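/- Let n ≥ 3, m ≥ 2 and ζ > n. Let f : ℝⁿ → ℝ be continuous, C^m outside some compact set, with finite limit f(∞) and limsup_{|x|→∞} |x|^{ζ+k} |D^k(f(x) − f(∞))| < ∞ for every k = 0,1,…,m, and let u ∈ C²(ℝⁿ) satisfy −√2 Σᵢ 1/(1+λᵢ(D²u(x))) = f(x) on ℝⁿ with u(x) ≤ C(1+|x|²) and D²u + I everywhere positive definite; let A (symmetric, A + I positive definite, −√2 Σᵢ 1/(1+λᵢ(A)) = f(∞)), b ∈ ℝⁿ, c ∈ ℝ be such that Q(x) = ½xᵀAx + b·x + c satisfies u − Q = O_{m+1}(|x|^{2−n}) (as provided by the first-order asymptotic theorem). Set B = 2^{−1/2}(I+A)² and N = n−1 if ζ ≥ 2n, N = n − 1 − ⌊2n−ζ⌋ if n < ζ < 2n. Then there exist c₀ ∈ ℝ and, for each 1 ≤ k ≤ N, a polynomial P_k on ℝⁿ homogeneous of degree k with Σᵢ ∂²P_k/∂xᵢ² ≡ 0, such that u(x) − Q(x) − c₀ (xᵀBx)^{(2−n)/2} − Σ_{k=1}^{N} P_k(θ(x)) (xᵀBx)^{(2−n−k)/2}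 = O_m(|x|^{2−min{2n,ζ}}) as |x| → ∞ if min{2n,ζ} − n is not an integer, and = O_m(|x|^{2−min{2n,ζ}} ln|x|) if min{2n,ζ} − n is an integer, where θ(x) = B^{1/2}x / (xᵀBx)^{1/2} and B^{1/2} is the positive definite symmetric square root of B. -/

import Mathlib

open Filter

/-- The Hessian matrix `(∂ᵢ∂ⱼ u(x))` of a function on Euclidean space. -/
noncomputable def hess {n : ℕ} (u : EuclideanSpace ℝ (Fin n) → ℝ)
    (x : EuclideanSpace ℝ (Fin n)) : Matrix (Fin n) (Fin n) ℝ :=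
  Matrix.of fun i j =>
    iteratedFDeriv ℝ 2 u x ![EuclideanSpace.single i 1, EuclideanSpace.single j 1]


section partA0

open Filter

abbrev EE (n : ℕ) := EuclideanSpace ℝ (Fin n)

noncomputable def ee {n : ℕ} (i : Fin n) : EE n := EuclideanSpace.single i (1:ℝ)

noncomputable def pd {n : ℕ} (i : Fin n) (f : EE n → ℝ) : EE n → ℝ :=
  fun x => fderiv ℝ f x (ee i)

noncomputable def lap {n : ℕ} (f : EE n → ℝ) : EE n → ℝ := fun x => ∑ i, pd i (pd i f) x

section basics
variable {n : ℕ}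

lemma norm_ee (i : Fin n) : ‖(ee i : EE n)‖ = 1 := by simp [ee]

lemma pd_congr {f g : EE n → ℝ} {x : EE n} (i : Fin n) (h : f =ᶠ[nhds x] g) :
    pd i f =ᶠ[nhds x] pd i g := by
  filter_upwards [h.fderiv (𝕜 := ℝ)] with y hy
  simp [pd, hy]

lemma lap_congr {f g : EE n → ℝ} {x : EE n} (h : f =ᶠ[nhds x] g) : lap f x = lap g x := by
  unfold lap
  refine Finset.sum_congr rfl fun i _ => ?_
  exact (pd_congr i (pd_congr i h)).eq_of_nhds

lemma pd_contDiffAt {f : EE n → ℝ} {x : EE n} {k : ℕ} (i : Fin n)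
    (h : ContDiffAt ℝ (k+1 : ℕ) f x) : ContDiffAt ℝ k (pd i f) x := by
  have := h.fderiv_right (m := k) (by norm_cast)
  exact this.clm_apply contDiffAt_const

lemma pd_contDiff {f : EE n → ℝ} {k : ℕ} (i : Fin n)
    (h : ContDiff ℝ (k+1 : ℕ) f) : ContDiff ℝ k (pd i f) :=
  contDiff_iff_contDiffAt.2 fun _ => pd_contDiffAt i h.contDiffAt

lemma lap_contDiffAt {f : EE n → ℝ} {x : EE n} {k : ℕ}
    (h : ContDiffAt ℝ (k+2 : ℕ) f x) : ContDiffAt ℝ k (lap f) x := by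
  unfold lap
  exact ContDiffAt.sum fun i _ => pd_contDiffAt i (pd_contDiffAt i h)

lemma pd_add {f g : EE n → ℝ} {x : EE n} (i : Fin n) (hf : DifferentiableAt ℝ f x)
    (hg : DifferentiableAt ℝ g x) : pd i (fun y => f y + g y) x = pd i f x + pd i g x := by
  simp [pd, fderiv_fun_add hf hg]

lemma pd_mul {f g : EE n → ℝ} {x : EE n} (i : Fin n) (hf : DifferentiableAt ℝ f x)
    (hg : DifferentiableAt ℝ g x) :
    pd i (fun y => f y * g y) x = f x * pd i g x + pd i f x * g x := by
  simp [pd, fderiv_fun_mul hf hg]; ring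

lemma pd_const_mul {g : EE n → ℝ} {x : EE n} (i : Fin n) (c : ℝ)
    (hg : DifferentiableAt ℝ g x) : pd i (fun y => c * g y) x = c * pd i g x := by
  simp [pd, fderiv_const_mul hg]

lemma ev_contDiffAt {f : EE n → ℝ} {x : EE n} {k : ℕ} (hf : ContDiffAt ℝ k f x) :
    ∀ᶠ y in nhds x, ContDiffAt ℝ k f y := hf.eventually (by simp)

lemma ev_diff {f : EE n → ℝ} {x : EE n} (hf : ContDiffAt ℝ 2 f x) :
    ∀ᶠ y in nhds x, DifferentiableAt ℝ f y := by
  filter_upwards [hf.eventually (by simp)] with y hy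
  exact hy.differentiableAt (by simp)

lemma pd_diff {f : EE n → ℝ} {x : EE n} (i : Fin n) (hf : ContDiffAt ℝ 2 f x) :
    DifferentiableAt ℝ (pd i f) x :=
  (pd_contDiffAt (k := 1) i hf).differentiableAt (by simp)

lemma lap_add {f g : EE n → ℝ} {x : EE n} (hf : ContDiffAt ℝ 2 f x) (hg : ContDiffAt ℝ 2 g x) :
    lap (fun y => f y + g y) x = lap f x + lap g x := by
  unfold lap
  rw [← Finset.sum_add_distrib]
  refine Finset.sum_congr rfl fun i _ => ?_
  have : pd i (fun y => f y + g y) =ᶠ[nhds x] fun y => pd i f y + pd i g y := by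
    filter_upwards [ev_diff hf, ev_diff hg] with y h1 h2 using pd_add i h1 h2
  rw [(pd_congr i this).eq_of_nhds, pd_add i (pd_diff i hf) (pd_diff i hg)]

lemma lap_const_mul {g : EE n → ℝ} {x : EE n} (c : ℝ) (hg : ContDiffAt ℝ 2 g x) :
    lap (fun y => c * g y) x = c * lap g x := by
  unfold lap
  rw [Finset.mul_sum]
  refine Finset.sum_congr rfl fun i _ => ?_
  have : pd i (fun y => c * g y) =ᶠ[nhds x] fun y => c * pd i g y := by
    filter_upwards [ev_diff hg] with y h2 using pd_const_mul i c h2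
  rw [(pd_congr i this).eq_of_nhds, pd_const_mul i c (pd_diff i hg)]

lemma lap_mul {f g : EE n → ℝ} {x : EE n} (hf : ContDiffAt ℝ 2 f x) (hg : ContDiffAt ℝ 2 g x) :
    lap (fun y => f y * g y) x = f x * lap g x + 2 * ∑ i, pd i f x * pd i g x + lap f x * g x := by
  unfold lap
  rw [Finset.mul_sum, Finset.mul_sum, Finset.sum_mul, ← Finset.sum_add_distrib,
    ← Finset.sum_add_distrib]
  refine Finset.sum_congr rfl fun i _ => ?_
  have : pd i (fun y => f y * g y) =ᶠ[nhds x] fun y => f y * pd i g y + pd i f y * g y := by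
    filter_upwards [ev_diff hf, ev_diff hg] with y h1 h2 using pd_mul i h1 h2
  have d1 := hf.differentiableAt (by simp)
  have d2 := hg.differentiableAt (by simp)
  rw [(pd_congr i this).eq_of_nhds, pd_add i (d1.fun_mul (pd_diff i hg)) ((pd_diff i hf).fun_mul d2),
    pd_mul i d1 (pd_diff i hg), pd_mul i (pd_diff i hf) d2]
  ring

lemma fderiv_eq_sum_pd {f : EE n → ℝ} (x : EE n) (v : EE n) :
    fderiv ℝ f x v = ∑ i, v i * pd i f x := by
  have : v = ∑ i, v i • (ee i : EE n) := by
    ext j; simp [ee, Finset.sum_apply, Pi.single_apply]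
  conv_lhs => rw [this]
  simp [pd]

lemma pd_abs_le {f : EE n → ℝ} (x : EE n) (i : Fin n) : |pd i f x| ≤ ‖fderiv ℝ f x‖ := by
  have := (fderiv ℝ f x).le_opNorm (ee i)
  rwa [norm_ee, mul_one] at this

lemma pd_comm {f : EE n → ℝ} {x : EE n} (i j : Fin n) (hf : ContDiffAt ℝ 2 f x) :
    pd i (pd j f) x = pd j (pd i f) x := by
  have h := hf.isSymmSndFDerivAt (by simp)
  have hd : DifferentiableAt ℝ (fderiv ℝ f) x :=
    (hf.fderiv_right (m := 1) (by norm_num)).differentiableAt (by simp)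
  have key : ∀ a b : Fin n, pd a (pd b f) x = fderiv ℝ (fderiv ℝ f) x (ee a) (ee b) := by
    intro a b
    unfold pd
    rw [fderiv_clm_apply hd (differentiableAt_const _)]
    simp
  rw [key, key]; exact h _ _

end basics

end partA0


section partA1
open Filter

section harm
open MvPolynomial
variable {n : ℕ}

noncomputable def rsq (n : ℕ) : MvPolynomial (Fin n) ℝ := ∑ j, X j ^ 2

noncomputable def plap (P : MvPolynomial (Fin n) ℝ) : MvPolynomial (Fin n) ℝ :=
  ∑ i, pderiv i (pderiv i P)

noncomputable def KP : (k : ℕ) → (Fin k → Fin n) → MvPolynomial (Fin n) ℝ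
  | 0, _ => 1
  | k+1, w => rsq n * pderiv (w 0) (KP k (Fin.tail w))
      - C ((n:ℝ) - 2 + 2 * k) * (X (w 0) * KP k (Fin.tail w))

lemma rsq_hom : (rsq n).IsHomogeneous 2 := by
  unfold rsq
  exact IsHomogeneous.sum _ _ _ fun i _ => isHomogeneous_X_pow i 2

lemma pderiv_rsq (i : Fin n) : pderiv i (rsq n) = 2 * X i := by
  unfold rsq
  simp only [map_sum, Derivation.leibniz_pow, pderiv_X, Pi.single_apply]
  rw [Finset.sum_eq_single i]
  · simp
  · intro b _ hb; simp [hb.symm, hb]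
  · simp

lemma pderiv_comm' (i j : Fin n) (P : MvPolynomial (Fin n) ℝ) :
    pderiv i (pderiv j P) = pderiv j (pderiv i P) := by
  induction P using MvPolynomial.induction_on with
  | C a => simp
  | add p q hp hq => simp [hp, hq]
  | mul_X p k hp =>
    simp only [pderiv_mul, map_add, hp, pderiv_X, Pi.single_apply]
    split_ifs <;> simp <;> ring

lemma plap_add (P Q : MvPolynomial (Fin n) ℝ) : plap (P + Q) = plap P + plap Q := by
  simp [plap, Finset.sum_add_distrib]

lemma plap_sub (P Q : MvPolynomial (Fin n) ℝ) : plap (P - Q) = plap P - plap Q := by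
  simp [plap, Finset.sum_sub_distrib]

lemma plap_C_mul (a : ℝ) (P : MvPolynomial (Fin n) ℝ) : plap (C a * P) = C a * plap P := by
  simp [plap, pderiv_C_mul, Finset.mul_sum, smul_eq_C_mul]

lemma plap_mul (P Q : MvPolynomial (Fin n) ℝ) :
    plap (P * Q) = plap P * Q + 2 * (∑ i, pderiv i P * pderiv i Q) + P * plap Q := by
  unfold plap
  rw [Finset.sum_mul, Finset.mul_sum, Finset.mul_sum, ← Finset.sum_add_distrib,
    ← Finset.sum_add_distrib]
  refine Finset.sum_congr rfl fun i _ => ?_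
  simp only [pderiv_mul, map_add]; ring

lemma plap_rsq : plap (rsq n) = C (2 * n : ℝ) := by
  unfold plap
  simp only [pderiv_rsq]
  have : ∀ i : Fin n, pderiv i ((2 : MvPolynomial (Fin n) ℝ) * X i) = 2 := by
    intro i
    have h2 : (2 : MvPolynomial (Fin n) ℝ) = C 2 := (map_ofNat C 2).symm
    rw [h2, pderiv_C_mul]; simp [smul_eq_C_mul]
  simp only [this]
  have h2 : (2 : MvPolynomial (Fin n) ℝ) = C 2 := (map_ofNat C 2).symm
  rw [h2]
  simp [mul_comm]

lemma plap_X (i : Fin n) : plap (X i : MvPolynomial (Fin n) ℝ) = 0 := by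
  unfold plap
  refine Finset.sum_eq_zero fun j _ => ?_
  rw [pderiv_X, Pi.single_apply]; split_ifs <;> simp

lemma plap_pderiv (i : Fin n) (P : MvPolynomial (Fin n) ℝ) :
    plap (pderiv i P) = pderiv i (plap P) := by
  unfold plap
  rw [map_sum]
  refine Finset.sum_congr rfl fun j _ => ?_
  rw [pderiv_comm' j i P, pderiv_comm' j i]

lemma KP_hom : ∀ (k : ℕ) (w : Fin k → Fin n), (KP k w).IsHomogeneous k
  | 0, _ => by simpa [KP] using isHomogeneous_one (Fin n) ℝ
  | k+1, w => by
    have ih := KP_hom k (Fin.tail w)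
    rw [KP]
    refine IsHomogeneous.sub ?_ ?_
    · rcases k with _ | k
      · simp [KP, isHomogeneous_zero]
      · have := rsq_hom.mul (ih.pderiv (i := w 0))
        rw [show 2 + (k + 1 - 1) = k + 1 + 1 by omega] at this; exact this
    · have := (isHomogeneous_C (Fin n) ((n:ℝ) - 2 + 2 * k)).mul ((isHomogeneous_X ℝ (w 0)).mul ih)
      rw [show 0 + (1 + k) = k + 1 by omega] at this; exact this

lemma KP_harm : ∀ (k : ℕ) (w : Fin k → Fin n), plap (KP k w) = 0
  | 0, _ => by simp [KP, plap]
  | k+1, w => by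
    have ih := KP_harm k (Fin.tail w)
    have hh := KP_hom k (Fin.tail w)
    rw [KP, plap_sub, plap_C_mul, plap_mul, plap_mul, plap_pderiv, ih, plap_rsq, plap_X]
    set Q := pderiv (w 0) (KP k (Fin.tail w)) with hQ
    have e1 : ∑ i, pderiv i (X (w 0) : MvPolynomial (Fin n) ℝ) * pderiv i (KP k (Fin.tail w)) = Q := by
      rw [Finset.sum_eq_single (w 0)]
      · simp [hQ]
      · intro b _ hb; simp [pderiv_X, Pi.single_apply, hb.symm]
      · simp
    have e2 : ∑ i, pderiv i (rsq n) * pderiv i Q = C (2 * ((k:ℝ) - 1)) * Q := by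
      simp only [pderiv_rsq]
      rcases k with _ | k
      · have : Q = 0 := by simp [hQ, KP]
        simp [this]
      · have := (hh.pderiv (i := w 0)).sum_X_mul_pderiv
        rw [← hQ] at this
        simp only [mul_assoc, ← Finset.mul_sum, this]
        have h2 : (2 : MvPolynomial (Fin n) ℝ) = C 2 := (map_ofNat C 2).symm
        rw [h2]; simp [nsmul_eq_mul]
        ring
    rw [e1, e2]
    simp only [map_zero, mul_zero, add_zero, zero_mul, zero_add]
    have h2 : (2 : MvPolynomial (Fin n) ℝ) = C 2 := (map_ofNat C 2).symm
    rw [h2]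
    simp only [map_mul, map_add, map_sub]
    simp
    ring

noncomputable def evP (P : MvPolynomial (Fin n) ℝ) : EE n → ℝ := fun x => eval (fun i => x i) P

lemma evP_contDiff (P : MvPolynomial (Fin n) ℝ) {k : WithTop ℕ∞} : ContDiff ℝ k (evP P) := by
  unfold evP
  induction P using MvPolynomial.induction_on with
  | C a => simpa using contDiff_const
  | add p q hp hq => simpa using hp.add hq
  | mul_X p j hp =>
    simp only [map_mul, eval_X]
    exact hp.mul (by fun_prop)

lemma pd_evP (P : MvPolynomial (Fin n) ℝ) (i : Fin n) (x : EE n) :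
    pd i (evP P) x = evP (pderiv i P) x := by
  induction P using MvPolynomial.induction_on with
  | C a =>
    have : evP (C a : MvPolynomial (Fin n) ℝ) = fun _ => a := by ext y; simp [evP]
    rw [this]; simp [evP, pd]
  | add p q hp hq =>
    have : evP (p + q) = fun y => evP p y + evP q y := by ext y; simp [evP]
    rw [this, pd_add i ((evP_contDiff p (k := 1)).differentiable (by simp) x)
      ((evP_contDiff q (k := 1)).differentiable (by simp) x), hp, hq]
    simp [evP]
  | mul_X p j hp =>
    have : evP (p * X j) = fun y => evP p y * y j := by ext y; simp [evP]
    rw [this, pd_mul i ((evP_contDiff p (k := 1)).differentiable (by simp) x) (by fun_prop), hp]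
    have : pd i (fun y : EE n => y j) x = if i = j then 1 else 0 := by
      have h : HasFDerivAt (fun y : EE n => y j) (EuclideanSpace.proj j : EE n →L[ℝ] ℝ) x :=
        (EuclideanSpace.proj j : EE n →L[ℝ] ℝ).hasFDerivAt
      simp [pd, h.fderiv, ee, Pi.single_apply, eq_comm]
    rw [this]
    simp [evP, pderiv_X, Pi.single_apply, eq_comm]
    split_ifs <;> simp <;> ring

lemma evP_smul {P : MvPolynomial (Fin n) ℝ} {k : ℕ} (h : P.IsHomogeneous k) (t : ℝ) (x : EE n) :
    evP P (t • x) = t ^ k * evP P x := by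
  unfold evP
  rw [eval_eq, eval_eq, Finset.mul_sum]
  refine Finset.sum_congr rfl fun d hd => ?_
  have hdeg : ∑ i, d i = k := by
    have := h (mem_support_iff.1 hd)
    rw [Finsupp.weight_apply, Finsupp.sum_fintype _ _ (by simp)] at this
    simpa using this
  simp only [PiLp.smul_apply, smul_eq_mul, mul_pow]
  have : ∏ i ∈ d.support, t ^ d i = t ^ k := by
    rw [Finset.prod_pow_eq_pow_sum, ← hdeg]
    congr 1
    exact Finset.sum_subset (Finset.subset_univ _) (by simp)
  rw [Finset.prod_mul_distrib, this]; ring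

end harm

end partA1


section partA2
open Filter

section ker
variable {n : ℕ}

lemma hasFDerivAt_norm_rpow' {x : EE n} (hx : x ≠ 0) (p : ℝ) :
    HasFDerivAt (fun y : EE n => ‖y‖ ^ p) ((p * ‖x‖ ^ (p - 2)) • innerSL ℝ x) x := by
  have hpos : 0 < ‖x‖ := norm_pos_iff.2 hx
  have h1 : HasFDerivAt (fun y : EE n => ‖y‖ ^ 2) (2 • (innerSL ℝ x)) x := by
    simpa using (hasFDerivAt_id x).norm_sq
  have h2 := h1.rpow_const (p := p / 2) (Or.inl (by positivity))
  have e : (fun y : EE n => ‖y‖ ^ p) = fun y => (‖y‖ ^ 2) ^ (p / 2) := by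
    ext y
    rw [← Real.rpow_natCast, ← Real.rpow_mul (norm_nonneg _)]
    congr 1; push_cast; ring
  rw [e]
  refine h2.congr_fderiv ?_
  have : (‖x‖ ^ 2) ^ (p / 2 - 1) = ‖x‖ ^ (p - 2) := by
    rw [← Real.rpow_natCast, ← Real.rpow_mul (norm_nonneg _)]
    congr 1; push_cast; ring
  rw [this]
  ext v
  simp
  ring

lemma pd_norm_rpow {x : EE n} (hx : x ≠ 0) (p : ℝ) (i : Fin n) :
    pd i (fun y : EE n => ‖y‖ ^ p) x = p * ‖x‖ ^ (p - 2) * x i := by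
  simp [pd, (hasFDerivAt_norm_rpow' hx p).fderiv, ee, EuclideanSpace.inner_single_right]

lemma contDiffAt_norm_rpow {x : EE n} (hx : x ≠ 0) (p : ℝ) {k : WithTop ℕ∞} :
    ContDiffAt ℝ k (fun y : EE n => ‖y‖ ^ p) x := by
  exact ContDiffAt.rpow_const_of_ne (contDiffAt_norm ℝ hx) (norm_ne_zero_iff.2 hx)

noncomputable def KF (k : ℕ) (w : Fin k → Fin n) (x : EE n) : ℝ :=
  evP (KP k w) x * ‖x‖ ^ ((2:ℝ) - n - 2 * k)

lemma KF_contDiffAt {k : ℕ} (w : Fin k → Fin n) {x : EE n} (hx : x ≠ 0) {m : WithTop ℕ∞} :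
    ContDiffAt ℝ m (KF k w) x :=
  (evP_contDiff _).contDiffAt.mul (contDiffAt_norm_rpow hx _)

lemma norm_sq_sum (x : EE n) : ‖x‖ ^ 2 = ∑ i, x i ^ 2 := by
  simp [EuclideanSpace.norm_sq_eq]

lemma evP_rsq (x : EE n) : evP (rsq n) x = ‖x‖ ^ 2 := by
  simp [norm_sq_sum, evP, rsq]

lemma pd_KF {k : ℕ} (w : Fin k → Fin n) {x : EE n} (hx : x ≠ 0) (i : Fin n) :
    pd i (KF k w) x = KF (k+1) (Fin.cons i w) x := by
  have hpos : 0 < ‖x‖ := norm_pos_iff.2 hx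
  have h1 := pd_mul (f := evP (KP k w)) (g := fun y => ‖y‖ ^ ((2:ℝ) - n - 2 * k)) (x := x) i
    ((evP_contDiff _ (k := 1)).differentiable (by simp) x)
    ((hasFDerivAt_norm_rpow' hx _).differentiableAt)
  have h2 : KF k w = fun y => evP (KP k w) y * ‖y‖ ^ ((2:ℝ) - n - 2 * k) := rfl
  rw [h2, h1, pd_norm_rpow hx, pd_evP]
  unfold KF
  rw [KP]
  have : ∀ P : MvPolynomial (Fin n) ℝ, evP (rsq n * MvPolynomial.pderiv i P
      - MvPolynomial.C ((n:ℝ) - 2 + 2 * k) * (MvPolynomial.X i * P)) x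
      = ‖x‖ ^ 2 * evP (MvPolynomial.pderiv i P) x - ((n:ℝ) - 2 + 2 * k) * (x i * evP P x) := by
    intro P
    rw [← evP_rsq]
    simp [evP]
  rw [Fin.cons_zero, Fin.tail_cons, this]
  have e : ‖x‖ ^ ((2:ℝ) - n - 2 * k) = ‖x‖ ^ 2 * ‖x‖ ^ ((2:ℝ) - n - 2 * (k+1:ℕ)) := by
    rw [← Real.rpow_natCast ‖x‖ 2, ← Real.rpow_add hpos]; congr 1; push_cast; ring
  have e2 : ‖x‖ ^ ((2:ℝ) - n - 2 * k - 2) = ‖x‖ ^ ((2:ℝ) - n - 2 * (k+1:ℕ)) := by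
    congr 1; push_cast; ring
  rw [e, e2]; ring

noncomputable def TT (k : ℕ) (x y : EE n) : ℝ :=
  ∑ w : Fin k → Fin n, (∏ j, y (w j)) * KF k w x

lemma TT_deriv (k : ℕ) (x y : EE n) (t : ℝ) (h : x - t • y ≠ 0) :
    HasDerivAt (fun s : ℝ => TT k (x - s • y) y) (-(TT (k+1) (x - t • y) y)) t := by
  unfold TT
  have hline : HasDerivAt (fun s : ℝ => x - s • y) (-y) t := by
    simpa using ((hasDerivAt_id t).smul_const y).const_sub x
  have h1 : ∀ w : Fin k → Fin n, HasDerivAt (fun s : ℝ => (∏ j, y (w j)) * KF k w (x - s • y))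
      ((∏ j, y (w j)) * (- ∑ i, y i * KF (k+1) (Fin.cons i w) (x - t • y))) t := by
    intro w
    have hd : HasFDerivAt (KF k w) (fderiv ℝ (KF k w) (x - t • y)) (x - t • y) :=
      ((KF_contDiffAt w h (m := 1)).differentiableAt (by simp)).hasFDerivAt
    have := (hd.comp_hasDerivAt t hline).const_mul (∏ j, y (w j))
    rw [fderiv_eq_sum_pd] at this
    simp only [pd_KF w h] at this
    refine this.congr_deriv ?_
    simp
  have := HasDerivAt.fun_sum (u := Finset.univ) fun w _ => h1 w
  refine this.congr_deriv ?_
  rw [← (Fin.consEquiv (fun _ : Fin (k+1) => Fin n)).sum_comp, Fintype.sum_prod_type, Finset.sum_comm,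
    ← Finset.sum_neg_distrib]
  refine Finset.sum_congr rfl fun w _ => ?_
  rw [mul_neg, Finset.mul_sum]
  congr 1
  refine Finset.sum_congr rfl fun i _ => ?_
  simp [Fin.consEquiv, Fin.prod_univ_succ]
  ring

lemma evP_bound {P : MvPolynomial (Fin n) ℝ} {k : ℕ} (h : P.IsHomogeneous k) :
    ∃ C, 0 < C ∧ ∀ x : EE n, |evP P x| ≤ C * ‖x‖ ^ k := by
  obtain ⟨C, hC⟩ := (isCompact_closedBall (0 : EE n) 1).exists_bound_of_continuousOn
    (evP_contDiff P (k := 0)).continuous.continuousOn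
  refine ⟨|C| + 1, by positivity, fun x => ?_⟩
  by_cases hx : x = 0
  · have h0 := evP_smul h 0 x
    rw [hx] at h0 ⊢
    rw [smul_zero] at h0
    have : |evP P (0 : EE n)| ≤ C := by simpa using hC 0 (by simp)
    rcases Nat.eq_zero_or_pos k with hk | hk
    · subst hk; simp; linarith [le_abs_self C]
    · rw [zero_pow hk.ne', zero_mul] at h0; rw [h0]; simp; positivity
  · have hpos : 0 < ‖x‖ := norm_pos_iff.2 hx
    have h1 := evP_smul h ‖x‖ (‖x‖⁻¹ • x)
    rw [smul_inv_smul₀ hpos.ne'] at h1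
    have h2 := hC (‖x‖⁻¹ • x) (by simp [norm_smul, hpos.ne'])
    rw [h1, abs_mul, abs_of_nonneg (by positivity), mul_comm]
    gcongr
    rw [Real.norm_eq_abs] at h2
    linarith [le_abs_self C]

lemma KF_bound {k : ℕ} (w : Fin k → Fin n) :
    ∃ C, 0 < C ∧ ∀ x : EE n, x ≠ 0 → |KF k w x| ≤ C * ‖x‖ ^ ((2:ℝ) - n - k) := by
  obtain ⟨C, hC, h⟩ := evP_bound (KP_hom k w)
  refine ⟨C, hC, fun x hx => ?_⟩
  have hpos : 0 < ‖x‖ := norm_pos_iff.2 hx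
  unfold KF
  rw [abs_mul, abs_of_nonneg (a := ‖x‖ ^ _) (by positivity)]
  have e : ‖x‖ ^ ((2:ℝ) - n - k) = ‖x‖ ^ k * ‖x‖ ^ ((2:ℝ) - n - 2 * k) := by
    rw [← Real.rpow_natCast ‖x‖ k, ← Real.rpow_add hpos]; congr 1; ring
  rw [e, ← mul_assoc]
  gcongr
  exact h x

lemma prod_bound {k : ℕ} (w : Fin k → Fin n) (y : EE n) : |∏ j, y (w j)| ≤ ‖y‖ ^ k := by
  rw [Finset.abs_prod]
  calc ∏ j, |y (w j)| ≤ ∏ j : Fin k, ‖y‖ :=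
        Finset.prod_le_prod (fun _ _ => abs_nonneg _) fun j _ => PiLp.norm_apply_le y (w j)
    _ = _ := by simp

lemma TT_bound (k : ℕ) : ∃ C, 0 < C ∧ ∀ x y : EE n, x ≠ 0 →
    |TT k x y| ≤ C * ‖y‖ ^ k * ‖x‖ ^ ((2:ℝ) - n - k) := by
  choose C hC h using fun w : Fin k → Fin n => KF_bound w
  refine ⟨∑ w, C w + 1, add_pos_of_nonneg_of_pos (Finset.sum_nonneg fun w _ => (hC w).le) one_pos,
    fun x y hx => ?_⟩
  have hpos : 0 < ‖x‖ := norm_pos_iff.2 hx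
  have : |TT k x y| ≤ (∑ w, C w) * (‖y‖ ^ k * ‖x‖ ^ ((2:ℝ) - n - k)) := by
    unfold TT
    refine (Finset.abs_sum_le_sum_abs _ _).trans ?_
    rw [Finset.sum_mul]
    refine Finset.sum_le_sum fun w _ => ?_
    rw [abs_mul]
    calc _ ≤ ‖y‖ ^ k * (C w * ‖x‖ ^ ((2:ℝ) - n - k)) :=
          mul_le_mul (prod_bound w y) (h w x hx) (abs_nonneg _) (by positivity)
      _ = _ := by ring
  have h2 : 0 ≤ ‖y‖ ^ k * ‖x‖ ^ ((2:ℝ) - n - k) := by positivity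
  nlinarith

lemma taylor_seq (M : ℕ) : ∀ (F : ℕ → ℝ → ℝ) (C : ℝ), 
    (∀ k, k < M → ∀ t ∈ Set.Icc (0:ℝ) 1, HasDerivAt (F k) (F (k+1) t) t) →
    (∀ t ∈ Set.Icc (0:ℝ) 1, |F M t| ≤ C) →
    ∀ t ∈ Set.Icc (0:ℝ) 1, |F 0 t - ∑ k ∈ Finset.range M, F k 0 * t ^ k / k.factorial| ≤ C := by
  induction M with
  | zero => intro F C _ h t ht; simpa using h t ht
  | succ M ih =>
    intro F C hF hC t ht
    have ih' := ih (fun k => F (k+1)) C (fun k hk => hF (k+1) (by omega)) hC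
    set G : ℝ → ℝ := fun t => F 0 t - ∑ k ∈ Finset.range (M+1), F k 0 * t ^ k / k.factorial with hG
    have hG' : ∀ s ∈ Set.Icc (0:ℝ) 1, HasDerivWithinAt G
        (F 1 s - ∑ k ∈ Finset.range M, F (k+1) 0 * s ^ k / k.factorial) (Set.Icc 0 1) s := by
      intro s hs
      refine HasDerivAt.hasDerivWithinAt ?_
      refine (hF 0 (by omega) s hs).fun_sub ?_
      have : ∀ k : ℕ, HasDerivAt (fun s : ℝ => F k 0 * s ^ k / k.factorial)
          (F k 0 * (k * s ^ (k-1)) / k.factorial) s := fun k =>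
        ((hasDerivAt_pow k s).const_mul _).div_const _
      refine (HasDerivAt.fun_sum (u := Finset.range (M+1)) fun k _ => this k).congr_deriv ?_
      rw [Finset.sum_range_succ']
      simp only [Nat.cast_zero, zero_mul, mul_zero, zero_div, add_zero]
      refine Finset.sum_congr rfl fun k _ => ?_
      rw [Nat.factorial_succ]
      push_cast
      have : (k.factorial : ℝ) ≠ 0 := by positivity
      have : (k : ℝ) + 1 ≠ 0 := by positivity
      field_simp
    have hb := Convex.norm_image_sub_le_of_norm_hasDerivWithin_le hG' (C := C)
      (fun s hs => ih' s hs) (convex_Icc 0 1) (Set.left_mem_Icc.2 zero_le_one) ht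
    have hG0 : G 0 = 0 := by
      simp [hG, Finset.sum_range_succ']
    have hC0 : 0 ≤ C := (abs_nonneg _).trans (hC 0 (by simp))
    rw [hG0, sub_zero, sub_zero, Real.norm_eq_abs, Real.norm_eq_abs, abs_of_nonneg ht.1] at hb
    refine hb.trans ?_
    nlinarith [ht.2]

lemma TT_zero (x y : EE n) : TT 0 x y = ‖x‖ ^ ((2:ℝ) - n) := by
  simp [TT, KF, KP, evP]

lemma newton_expand (M : ℕ) (hn : 2 ≤ n) : ∃ C, 0 < C ∧ ∀ x y : EE n, x ≠ 0 → ‖y‖ ≤ ‖x‖ / 2 →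
    |‖x - y‖ ^ ((2:ℝ) - n) - ∑ k ∈ Finset.range M, (-1) ^ k / k.factorial * TT k x y|
      ≤ C * ‖y‖ ^ M * ‖x‖ ^ ((2:ℝ) - n - M) := by
  obtain ⟨C, hC, hb⟩ := TT_bound (n := n) M
  refine ⟨C * (1/2 : ℝ) ^ ((2:ℝ) - n - M), by positivity, fun x y hx hy => ?_⟩
  have hpos : 0 < ‖x‖ := norm_pos_iff.2 hx
  have hlow : ∀ t ∈ Set.Icc (0:ℝ) 1, ‖x‖ / 2 ≤ ‖x - t • y‖ := by
    intro t ht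
    have := norm_sub_norm_le x (t • y)
    rw [norm_smul, Real.norm_eq_abs, abs_of_nonneg ht.1] at this
    nlinarith [ht.2, norm_nonneg y]
  have hne : ∀ t ∈ Set.Icc (0:ℝ) 1, x - t • y ≠ 0 := fun t ht =>
    norm_pos_iff.1 (lt_of_lt_of_le (by positivity) (hlow t ht))
  have := taylor_seq M (fun k t => (-1) ^ k * TT k (x - t • y) y)
    (C * ‖y‖ ^ M * (‖x‖ / 2) ^ ((2:ℝ) - n - M)) ?_ ?_ 1 (by simp)
  · simp only [zero_smul, sub_zero, one_smul, pow_zero, one_mul, one_pow, mul_one, TT_zero] at this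
    refine (le_of_eq ?_).trans (this.trans (le_of_eq ?_))
    · congr 2
      refine Finset.sum_congr rfl fun k _ => by ring
    · rw [show ‖x‖ / 2 = 1/2 * ‖x‖ by ring, Real.mul_rpow (by norm_num) hpos.le]; ring
  · intro k _ t ht
    refine ((TT_deriv k x y t (hne t ht)).const_mul ((-1) ^ k)).congr_deriv ?_
    ring
  · intro t ht
    rw [abs_mul, abs_pow, abs_neg, abs_one, one_pow, one_mul]
    refine (hb _ y (hne t ht)).trans ?_
    gcongr C * ‖y‖ ^ M * ?_
    refine Real.rpow_le_rpow_of_nonpos (by positivity) (hlow t ht) ?_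
    have : (2:ℝ) ≤ n := by exact_mod_cast hn
    have : (0:ℝ) ≤ M := by positivity
    linarith

end ker

end partA2


section partB0
open Filter MeasureTheory Set
open scoped Pointwise

section radial
variable {n : ℕ}

lemma finrank_EE : Module.finrank ℝ (EE n) = n := by simp

lemma nontriv_EE (hn : 1 ≤ n) : Nontrivial (EE n) := by
  haveI : Nonempty (Fin n) := ⟨⟨0, hn⟩⟩
  infer_instance

lemma pow_smul_rpow (hn : 1 ≤ n) {y p : ℝ} (hy : 0 < y) :
    y ^ (n - 1) • y ^ p = y ^ ((n:ℝ) - 1 + p) := by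
  rw [smul_eq_mul, ← Real.rpow_natCast, ← Real.rpow_add hy]
  congr 1
  push_cast [Nat.cast_sub hn]; ring

lemma integrableOn_ball_rpow (hn : 1 ≤ n) {p : ℝ} (hp : -(n:ℝ) < p) (r : ℝ) :
    IntegrableOn (fun y : EE n => ‖y‖ ^ p) (Metric.ball 0 r) := by
  haveI := nontriv_EE hn
  rw [integrableOn_fun_norm_addHaar volume (f := fun y : ℝ => y ^ p), finrank_EE]
  have : IntegrableOn (fun y : ℝ => y ^ ((n:ℝ) - 1 + p)) (Ioo 0 r) := by
    rcases le_or_gt r 0 with h | h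
    · rw [Ioo_eq_empty (by linarith)]; simp
    · have := (intervalIntegral.intervalIntegrable_rpow' (a := 0) (b := r) (r := (n:ℝ) - 1 + p) (by linarith))
      rw [intervalIntegrable_iff_integrableOn_Ioo_of_le h.le] at this
      exact this
  exact this.congr_fun (fun y hy => (pow_smul_rpow hn hy.1).symm) measurableSet_Ioo

lemma integral_ball_rpow (p : ℝ) {r : ℝ} (hr : 0 < r) :
    ∫ y in Metric.ball (0 : EE n) r, ‖y‖ ^ p =
      r ^ ((n:ℝ) + p) * ∫ y in Metric.ball (0 : EE n) 1, ‖y‖ ^ p := by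
  have h := Measure.setIntegral_comp_smul_of_pos (volume : Measure (EE n))
    (fun y : EE n => ‖y‖ ^ p) (Metric.ball 0 1) hr
  rw [smul_ball hr.ne', smul_zero, finrank_EE] at h
  simp only [norm_smul, Real.norm_eq_abs, abs_of_pos hr, mul_one, 
    Real.mul_rpow hr.le (norm_nonneg _), smul_eq_mul] at h
  rw [integral_const_mul] at h
  rw [Real.rpow_add hr, mul_assoc, h, Real.rpow_natCast]
  field_simp

lemma integrableOn_ext_rpow (hn : 1 ≤ n) {p : ℝ} (hp : p < -(n:ℝ)) {r : ℝ} (hr : 0 < r) :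
    IntegrableOn (fun y : EE n => ‖y‖ ^ p) {y | r ≤ ‖y‖} := by
  haveI := nontriv_EE hn
  have hm : MeasurableSet {y : EE n | r ≤ ‖y‖} := measurableSet_le measurable_const measurable_norm
  rw [← integrable_indicator_iff hm]
  have e : ({y : EE n | r ≤ ‖y‖}.indicator fun y : EE n => ‖y‖ ^ p) =
      fun y => ((Ici r).indicator (fun t : ℝ => t ^ p)) ‖y‖ := by
    ext y; simp [indicator]
  rw [e, integrable_fun_norm_addHaar volume, finrank_EE]
  have : IntegrableOn (fun y : ℝ => (Ici r).indicator (fun y => y ^ ((n:ℝ) - 1 + p)) y) (Ioi 0) := by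
    refine Integrable.integrableOn ?_
    rw [integrable_indicator_iff measurableSet_Ici, integrableOn_Ici_iff_integrableOn_Ioi]
    exact integrableOn_Ioi_rpow_of_lt (by linarith) hr
  refine this.congr_fun (fun y hy => ?_) measurableSet_Ioi
  by_cases h : r ≤ y
  · simp only [indicator, mem_Ici, h, if_true]; exact (pow_smul_rpow hn hy).symm
  · simp [indicator, h]

lemma integral_ext_rpow (p : ℝ) {r : ℝ} (hr : 0 < r) :
    ∫ y in {y : EE n | r ≤ ‖y‖}, ‖y‖ ^ p =
      r ^ ((n:ℝ) + p) * ∫ y in {y : EE n | 1 ≤ ‖y‖}, ‖y‖ ^ p := by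
  have h := Measure.setIntegral_comp_smul_of_pos (volume : Measure (EE n))
    (fun y : EE n => ‖y‖ ^ p) {y : EE n | 1 ≤ ‖y‖} hr
  have hs : r • {y : EE n | 1 ≤ ‖y‖} = {y : EE n | r ≤ ‖y‖} := by
    ext y
    rw [mem_smul_set_iff_inv_smul_mem₀ hr.ne']
    simp only [mem_setOf_eq, norm_smul, norm_inv, Real.norm_eq_abs, abs_of_pos hr]
    rw [inv_mul_eq_div, le_div_iff₀ hr, one_mul]
  rw [hs, finrank_EE] at h
  simp only [norm_smul, Real.norm_eq_abs, abs_of_pos hr, 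
    Real.mul_rpow hr.le (norm_nonneg _), smul_eq_mul] at h
  rw [integral_const_mul] at h
  rw [Real.rpow_add hr, mul_assoc, h, Real.rpow_natCast]
  field_simp

lemma integral_annulus_log (hn : 1 ≤ n) : ∃ C : ℝ, 0 ≤ C ∧ ∀ r : ℝ, 1 ≤ r →
    ∫ y in {y : EE n | 1 ≤ ‖y‖ ∧ ‖y‖ ≤ r}, ‖y‖ ^ (-(n:ℝ)) = C * Real.log r := by
  haveI := nontriv_EE hn
  refine ⟨n * volume.real (Metric.ball (0 : EE n) 1), by positivity, fun r hr => ?_⟩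
  have hm : MeasurableSet {y : EE n | 1 ≤ ‖y‖ ∧ ‖y‖ ≤ r} :=
    (measurableSet_le measurable_const measurable_norm).inter
      (measurableSet_le measurable_norm measurable_const)
  rw [← integral_indicator hm]
  have e : ({y : EE n | 1 ≤ ‖y‖ ∧ ‖y‖ ≤ r}.indicator fun y : EE n => ‖y‖ ^ (-(n:ℝ))) =
      fun y => ((Icc 1 r).indicator (fun t : ℝ => t ^ (-(n:ℝ)))) ‖y‖ := by
    ext y; simp [indicator]
  rw [e, integral_fun_norm_addHaar volume, finrank_EE]
  have h1 : ∫ y in Ioi (0:ℝ), y ^ (n - 1) • (Icc 1 r).indicator (fun t : ℝ => t ^ (-(n:ℝ))) y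
      = ∫ y in Ioi (0:ℝ), (Icc 1 r).indicator (fun t : ℝ => t⁻¹) y := by
    refine setIntegral_congr_fun measurableSet_Ioi fun y hy => ?_
    by_cases h : y ∈ Icc 1 r
    · simp only [indicator, h, if_true]
      rw [pow_smul_rpow hn hy, ← Real.rpow_neg_one]; congr 1; ring
    · simp only [indicator, h, if_false]; simp
  rw [h1, setIntegral_indicator measurableSet_Icc]
  have h2 : Ioi (0:ℝ) ∩ Icc 1 r = Icc 1 r := by
    ext y; simp only [mem_inter_iff, mem_Ioi, mem_Icc]; constructor
    · exact fun h => h.2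
    · exact fun h => ⟨by linarith [h.1], h⟩
  rw [h2, integral_Icc_eq_integral_Ioc, ← intervalIntegral.integral_of_le hr,
    integral_inv_of_pos one_pos (by linarith)]
  simp [mul_assoc]

end radial

end partB0


section partC0
open Filter MeasureTheory Set
open scoped Pointwise

section green
variable {n : ℕ}

lemma pd_cont {f : EE n → ℝ} (hf : ContDiff ℝ 1 f) (i : Fin n) : Continuous (pd i f) :=
  (pd_contDiff (k := 0) i (by simpa using hf)).continuous

lemma pd_supp {f : EE n → ℝ} (hf : HasCompactSupport f) (i : Fin n) : HasCompactSupport (pd i f) :=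
  hf.fderiv_apply ℝ (ee i)

lemma ibp {f g : EE n → ℝ} (hf : ContDiff ℝ 1 f) (hg : ContDiff ℝ 1 g) (hs : HasCompactSupport g)
    (i : Fin n) : ∫ y, f y * pd i g y = - ∫ y, pd i f y * g y := by
  refine integral_mul_fderiv_eq_neg_fderiv_mul_of_integrable ?_ ?_ ?_ ?_ ?_
  · exact ((pd_cont hf i).mul hg.continuous).integrable_of_hasCompactSupport hs.mul_left
  · exact (hf.continuous.mul (pd_cont hg i)).integrable_of_hasCompactSupport (pd_supp hs i).mul_left
  · exact (hf.continuous.mul hg.continuous).integrable_of_hasCompactSupport hs.mul_left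
  · exact fun x _ => (hf.differentiable (by simp)) x
  · exact fun x _ => (hg.differentiable (by simp)) x

lemma lap_cont {f : EE n → ℝ} (hf : ContDiff ℝ 2 f) : Continuous (lap f) := by
  unfold lap
  exact continuous_finsetSum _ fun i _ => pd_cont (pd_contDiff (k := 1) i hf) i

lemma lap_supp {f : EE n → ℝ} (hf : HasCompactSupport f) : HasCompactSupport (lap f) := by
  have : ∀ s : Finset (Fin n), HasCompactSupport (fun x => ∑ i ∈ s, pd i (pd i f) x) := by
    intro s
    induction s using Finset.induction_on with
    | empty => simp only [Finset.sum_empty]; exact HasCompactSupport.zero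
    | insert a s ha ih =>
      simp_rw [Finset.sum_insert ha]
      exact (pd_supp (pd_supp hf a) a).add ih
  exact this _

lemma green {f g : EE n → ℝ} (hf : ContDiff ℝ 2 f) (hg : ContDiff ℝ 2 g)
    (hs : HasCompactSupport g) : ∫ y, f y * lap g y = ∫ y, lap f y * g y := by
  unfold lap
  simp_rw [Finset.mul_sum, Finset.sum_mul]
  have hf1 : ContDiff ℝ 1 f := hf.of_le (by norm_num)
  have hg1 : ContDiff ℝ 1 g := hg.of_le (by norm_num)
  rw [integral_finsetSum, integral_finsetSum]
  · refine Finset.sum_congr rfl fun i _ => ?_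
    rw [ibp hf1 (pd_contDiff (k := 1) i hg) (pd_supp hs i) i,
      ibp (pd_contDiff (k := 1) i hf) hg1 hs i]
    simp
  · exact fun i _ => ((pd_cont (pd_contDiff (k := 1) i hf) i).mul hg.continuous).integrable_of_hasCompactSupport hs.mul_left
  · exact fun i _ => (hf.continuous.mul (pd_cont (pd_contDiff (k := 1) i hg) i)).integrable_of_hasCompactSupport
      (pd_supp (pd_supp hs i) i).mul_left

lemma hasFDerivAt_q (e : ℝ) (p : ℝ) (he : 0 < e) (x : EE n) :
    HasFDerivAt (fun y : EE n => (‖y‖^2 + e) ^ p) ((p * (‖x‖^2 + e) ^ (p-1) * 2) • innerSL ℝ x) x := by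
  have h1 : HasFDerivAt (fun y : EE n => ‖y‖^2 + e) ((2:ℝ) • innerSL ℝ x) x := by
    have := ((hasStrictFDerivAt_norm_sq x).hasFDerivAt).add_const e
    refine this.congr_fderiv ?_
    ext v; simp
  have h2 := h1.rpow_const (p := p) (Or.inl (by positivity))
  refine h2.congr_fderiv ?_
  ext v; simp; ring

lemma pd_q (e : ℝ) (p : ℝ) (he : 0 < e) (x : EE n) (i : Fin n) :
    pd i (fun y : EE n => (‖y‖^2 + e) ^ p) x = 2 * p * (‖x‖^2 + e) ^ (p-1) * x i := by
  unfold pd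
  rw [(hasFDerivAt_q e p he x).fderiv]
  simp only [ee, ContinuousLinearMap.smul_apply, innerSL_apply_apply, smul_eq_mul, EuclideanSpace.inner_single_right]
  simp; ring_nf; simp

lemma pd_coord (i j : Fin n) (x : EE n) : pd i (fun y : EE n => y j) x = if i = j then 1 else 0 := by
  unfold pd
  have : (fun y : EE n => y j) = fun y => EuclideanSpace.proj (𝕜 := ℝ) j y := rfl
  rw [this, ContinuousLinearMap.fderiv]
  simp [ee, Pi.single_apply, eq_comm]

lemma q_contDiff (e : ℝ) (p : ℝ) (he : 0 < e) {k : WithTop ℕ∞} :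
    ContDiff ℝ k (fun y : EE n => (‖y‖^2 + e) ^ p) := by
  refine ContDiff.rpow_const_of_ne ((contDiff_norm_sq ℝ).add contDiff_const) fun x => by positivity

lemma lap_q (e : ℝ) (he : 0 < e) (x : EE n) :
    lap (fun y : EE n => (‖y‖^2 + e) ^ (((2:ℝ) - n)/2)) x =
      ((2:ℝ) - n) * n * e * (‖x‖^2 + e) ^ (-(n+2:ℝ)/2) := by
  unfold lap
  have h1 : ∀ i : Fin n, pd i (pd i (fun y : EE n => (‖y‖^2 + e) ^ (((2:ℝ) - n)/2))) x =
      ((2:ℝ) - n) * (‖x‖^2 + e) ^ (-(n:ℝ)/2) - ((2:ℝ)-n) * n * (‖x‖^2 + e) ^ (-(n+2:ℝ)/2) * (x i)^2 := by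
    intro i
    have e1 : pd i (fun y : EE n => (‖y‖^2 + e) ^ (((2:ℝ) - n)/2)) =
        fun x => ((2:ℝ) - n) * ((‖x‖^2 + e) ^ (-(n:ℝ)/2) * x i) := by
      funext x; rw [pd_q _ _ he]
      have : ((2:ℝ) - n)/2 - 1 = -(n:ℝ)/2 := by ring
      rw [this]; ring
    have dq : DifferentiableAt ℝ (fun y : EE n => (‖y‖^2 + e) ^ (-(n:ℝ)/2)) x :=
      (hasFDerivAt_q e _ he x).differentiableAt
    have dc : DifferentiableAt ℝ (fun y : EE n => y i) x := by fun_prop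
    rw [e1, pd_const_mul i _ (dq.fun_mul dc), pd_mul i dq dc, pd_q _ _ he, pd_coord]
    have : -(n:ℝ)/2 - 1 = -(n+2:ℝ)/2 := by ring
    rw [this]; simp; ring
  simp_rw [h1]
  rw [Finset.sum_sub_distrib, ← Finset.mul_sum, ← Finset.mul_sum, ← norm_sq_sum]
  simp
  have hq : (0:ℝ) < ‖x‖^2 + e := by positivity
  have : (‖x‖^2 + e) ^ (-(n:ℝ)/2) = (‖x‖^2 + e) * (‖x‖^2 + e) ^ (-(n+2:ℝ)/2) := by
    nth_rewrite 2 [← Real.rpow_one (‖x‖^2+e)]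
    rw [← Real.rpow_add hq]; congr 1; ring
  rw [this]; 
  have e2 : (-2 + -(n:ℝ)) / 2 = -(n+2:ℝ)/2 := by ring
  try rw [e2]
  ring

end green

end partC0


section partC1
open Filter MeasureTheory Set
open scoped Pointwise

section fund
variable {n : ℕ}

noncomputable def cN (n : ℕ) : ℝ := (n - 2 : ℝ) * n * ∫ z : EE n, ((1:ℝ) + ‖z‖^2) ^ (-(n+2:ℝ)/2)

lemma int_jap : Integrable (fun z : EE n => ((1:ℝ) + ‖z‖^2) ^ (-(n+2:ℝ)/2)) := by
  apply integrable_rpow_neg_one_add_norm_sq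
  rw [finrank_EE]; linarith

lemma cN_pos (hn : 3 ≤ n) : 0 < cN n := by
  unfold cN
  have h3 : (3:ℝ) ≤ n := by exact_mod_cast hn
  refine mul_pos (by nlinarith) ?_
  refine integral_pos_of_integrable_nonneg_nonzero (x := 0) ?_ int_jap (fun z => by positivity) (by simp)
  refine Continuous.rpow_const (by fun_prop) fun x => Or.inl (by positivity)

lemma locint_rpow (hn : 1 ≤ n) {p : ℝ} (hp : -(n:ℝ) < p) :
    LocallyIntegrable (fun y : EE n => ‖y‖ ^ p) := by
  intro x
  refine ⟨Metric.ball 0 (‖x‖+1), Metric.isOpen_ball.mem_nhds (by simp), integrableOn_ball_rpow hn hp _⟩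

lemma fund0 (hn : 3 ≤ n) {ψ : EE n → ℝ} (hψ : ContDiff ℝ 2 ψ) (hs : HasCompactSupport ψ) :
    ∫ y, ‖y‖ ^ ((2:ℝ) - n) * lap ψ y = - cN n * ψ 0 := by
  have hn3 : (3:ℝ) ≤ n := by exact_mod_cast hn
  have hint : Integrable (fun y : EE n => ‖y‖ ^ ((2:ℝ) - n) * lap ψ y) := by
    have := (locint_rpow (n := n) (by omega) (p := 2 - n) (by linarith)).integrable_smul_right_of_hasCompactSupport
      (lap_cont hψ) (lap_supp hs)
    simpa using this
  have L : Tendsto (fun e : ℝ => ∫ y : EE n, (‖y‖^2 + e^2) ^ (((2:ℝ) - n)/2) * lap ψ y) (nhdsWithin 0 (Ioi 0))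
      (nhds (∫ y, ‖y‖ ^ ((2:ℝ) - n) * lap ψ y)) := by
    refine tendsto_integral_filter_of_dominated_convergence (fun y => |‖y‖ ^ ((2:ℝ) - n) * lap ψ y|) ?_ ?_ hint.abs ?_
    · filter_upwards [self_mem_nhdsWithin] with e he
      have he : 0 < e := he
      exact ((q_contDiff (e^2) _ (by positivity) (k := 0)).continuous.mul (lap_cont hψ)).aestronglyMeasurable
    · filter_upwards [self_mem_nhdsWithin] with e he
      have he : 0 < e := he
      have : ∀ᵐ y : EE n, y ≠ 0 := by
        haveI := nontriv_EE (n := n) (by omega)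
        exact ae_iff.2 (by simp)
      filter_upwards [this] with y hy
      rw [Real.norm_eq_abs, abs_mul, abs_mul]
      refine mul_le_mul_of_nonneg_right ?_ (abs_nonneg _)
      have hy' : 0 < ‖y‖ := norm_pos_iff.2 hy
      rw [abs_of_nonneg (by positivity), abs_of_nonneg (by positivity)]
      have : ‖y‖ ^ ((2:ℝ) - n) = (‖y‖^2) ^ (((2:ℝ)-n)/2) := by
        rw [← Real.rpow_natCast, ← Real.rpow_mul hy'.le]; congr 1; push_cast; ring
      rw [this]
      exact Real.rpow_le_rpow_of_nonpos (by positivity) (by nlinarith) (by linarith)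
    · have : ∀ᵐ y : EE n, y ≠ 0 := by
        haveI := nontriv_EE (n := n) (by omega)
        exact ae_iff.2 (by simp)
      filter_upwards [this] with y hy
      have hy' : 0 < ‖y‖ := norm_pos_iff.2 hy
      have : ‖y‖ ^ ((2:ℝ) - n) = (‖y‖^2 + 0^2) ^ (((2:ℝ)-n)/2) := by
        rw [zero_pow two_ne_zero, add_zero, ← Real.rpow_natCast, ← Real.rpow_mul hy'.le]; congr 1; push_cast; ring
      rw [this]
      refine Tendsto.mul_const _ ?_
      have hc : ContinuousAt (fun e : ℝ => (‖y‖^2 + e^2) ^ (((2:ℝ)-n)/2)) 0 := by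
        refine ContinuousAt.rpow_const (by fun_prop) (Or.inl (by positivity))
      exact hc.tendsto.mono_left nhdsWithin_le_nhds
  have R : Tendsto (fun e : ℝ => ∫ y : EE n, (‖y‖^2 + e^2) ^ (((2:ℝ) - n)/2) * lap ψ y) (nhdsWithin 0 (Ioi 0))
      (nhds (- cN n * ψ 0)) := by
    have hb : ∃ C, ∀ x, ‖ψ x‖ ≤ C := hs.exists_bound_of_continuous hψ.continuous
    obtain ⟨C, hC⟩ := hb
    have key : ∀ e : ℝ, 0 < e → ∫ y : EE n, (‖y‖^2 + e^2) ^ (((2:ℝ) - n)/2) * lap ψ y =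
        ((2:ℝ) - n) * n * ∫ z : EE n, ((1:ℝ) + ‖z‖^2) ^ (-(n+2:ℝ)/2) * ψ (e • z) := by
      intro e he
      rw [green (q_contDiff (e^2) _ (by positivity)) hψ hs]
      simp_rw [lap_q (e^2) (by positivity : (0:ℝ) < e^2)]
      have h := Measure.integral_comp_smul (volume : Measure (EE n))
        (fun y => (‖y‖^2 + e^2) ^ (-(n+2:ℝ)/2) * ψ y) e
      rw [finrank_EE] at h
      have e1 : ∀ z : EE n, (‖e • z‖^2 + e^2) ^ (-(n+2:ℝ)/2) * ψ (e • z) =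
          e ^ (-(n+2:ℝ)) * (((1:ℝ) + ‖z‖^2) ^ (-(n+2:ℝ)/2) * ψ (e • z)) := by
        intro z
        have : ‖e • z‖^2 + e^2 = e^2 * (1 + ‖z‖^2) := by
          rw [norm_smul, Real.norm_eq_abs, abs_of_pos he]; ring
        rw [this, Real.mul_rpow (by positivity) (by positivity), mul_assoc]
        congr 1
        rw [← Real.rpow_natCast, ← Real.rpow_mul he.le]; congr 1; push_cast; ring
      simp_rw [e1] at h
      rw [integral_const_mul] at h
      have e2 : ∀ y : EE n, ((2:ℝ) - n) * n * e^2 * (‖y‖^2 + e^2) ^ (-(n+2:ℝ)/2) * ψ y =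
        ((2:ℝ) - n) * n * e^2 * ((‖y‖^2 + e^2) ^ (-(n+2:ℝ)/2) * ψ y) := fun y => by ring
      simp_rw [e2]
      rw [integral_const_mul]
      have hh : ∫ y : EE n, (‖y‖^2 + e^2) ^ (-(n+2:ℝ)/2) * ψ y = e^n * (e ^ (-(n+2:ℝ)) * ∫ z : EE n, ((1:ℝ) + ‖z‖^2) ^ (-(n+2:ℝ)/2) * ψ (e • z)) := by
        rw [h, abs_of_pos (by positivity), smul_eq_mul]; field_simp
      rw [hh]
      have h3 : e^2 * (e^n * e ^ (-(n+2:ℝ))) = 1 := by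
        rw [← Real.rpow_natCast, ← Real.rpow_natCast, ← Real.rpow_add he, ← Real.rpow_add he]
        have : (((2:ℕ):ℝ) + ((n:ℝ) + -(n+2:ℝ))) = 0 := by push_cast; ring
        rw [this, Real.rpow_zero]
      linear_combination (((2:ℝ) - n) * n * ∫ z : EE n, ((1:ℝ) + ‖z‖^2) ^ (-(n+2:ℝ)/2) * ψ (e • z)) * h3
    have L2 : Tendsto (fun e : ℝ => ∫ z : EE n, ((1:ℝ) + ‖z‖^2) ^ (-(n+2:ℝ)/2) * ψ (e • z)) (nhdsWithin 0 (Ioi 0))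
        (nhds (∫ z : EE n, ((1:ℝ) + ‖z‖^2) ^ (-(n+2:ℝ)/2) * ψ 0)) := by
      have hcj : Continuous (fun z : EE n => ((1:ℝ) + ‖z‖^2) ^ (-(n+2:ℝ)/2)) :=
        Continuous.rpow_const (by fun_prop) fun x => Or.inl (by positivity)
      have hcψ := hψ.continuous
      refine tendsto_integral_filter_of_dominated_convergence (fun z : EE n => ((1:ℝ) + ‖z‖^2) ^ (-(n+2:ℝ)/2) * C) ?_ ?_ (int_jap.mul_const C) ?_
      · refine Eventually.of_forall fun e => Continuous.aestronglyMeasurable ?_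
        exact hcj.mul (by fun_prop)
      · refine Eventually.of_forall fun e => Eventually.of_forall fun z => ?_
        rw [norm_mul, Real.norm_eq_abs, abs_of_nonneg (by positivity)]
        exact mul_le_mul_of_nonneg_left (hC _) (by positivity)
      · refine Eventually.of_forall fun z => Tendsto.const_mul _ ?_
        have : ContinuousAt (fun e : ℝ => ψ (e • z)) 0 := by fun_prop
        have h := this.tendsto
        simp only [zero_smul] at h
        exact h.mono_left nhdsWithin_le_nhds
    rw [integral_mul_const] at L2
    have := (L2.const_mul (((2:ℝ) - n) * n))
    have e3 : ((2:ℝ) - n) * n * ((∫ z : EE n, ((1:ℝ) + ‖z‖^2) ^ (-(n+2:ℝ)/2)) * ψ 0) = - cN n * ψ 0 := by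
      unfold cN; ring
    rw [e3] at this
    refine this.congr' ?_
    filter_upwards [self_mem_nhdsWithin] with e he using (key e he).symm
  exact tendsto_nhds_unique L R

lemma pd_comp_sub (f : EE n → ℝ) (x y : EE n) (i : Fin n) :
    pd i (fun y => f (x - y)) y = - pd i f (x - y) := by
  have h := fderiv_comp_smul (𝕜 := ℝ) (f := fun z => f (x + z)) (x := y) (-1)
  simp only [fderiv_comp_add_left] at h
  have e : (fun y => f (x - y)) = fun y => f (x + (-1:ℝ) • y) := by funext y; simp [sub_eq_add_neg]
  unfold pd
  rw [e, h]
  simp [sub_eq_add_neg]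

lemma lap_comp_sub (f : EE n → ℝ) (x y : EE n) : lap (fun y => f (x - y)) y = lap f (x - y) := by
  unfold lap
  refine Finset.sum_congr rfl fun i _ => ?_
  have : pd i (fun y => f (x - y)) = fun y => (fun z => - pd i f z) (x - y) := by
    funext y; exact pd_comp_sub f x y i
  rw [this]
  refine (pd_comp_sub (fun z => - pd i f z) x y i).trans ?_
  unfold pd; simp

theorem fund (hn : 3 ≤ n) {ψ : EE n → ℝ} (hψ : ContDiff ℝ 2 ψ) (hs : HasCompactSupport ψ) (x : EE n) :
    ∫ y, ‖x - y‖ ^ ((2:ℝ) - n) * lap ψ y = - cN n * ψ x := by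
  have h := fund0 hn (ψ := fun y => ψ (x - y)) (by fun_prop)
    (hs.comp_homeomorph (Homeomorph.subLeft x))
  simp only [lap_comp_sub, sub_zero] at h
  rw [← h, ← integral_sub_left_eq_self _ volume x]
  simp

end fund

end partC1


section partD0
open Filter MeasureTheory Set
open scoped Pointwise

section rep
variable {n : ℕ}

lemma meas_ext (r : ℝ) : MeasurableSet {y : EE n | r ≤ ‖y‖} := measurableSet_le measurable_const measurable_norm

lemma pd_const (i : Fin n) (c : ℝ) : pd i (fun _ : EE n => c) = fun _ => 0 := by
  funext x; simp [pd]

lemma lap_const (c : ℝ) (x : EE n) : lap (fun _ : EE n => c) x = 0 := by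
  simp [lap, pd_const]

lemma half_norm {x y : EE n} (h : 2 * ‖x‖ ≤ ‖y‖) : ‖y‖ / 2 ≤ ‖x - y‖ := by
  have := norm_sub_norm_le y x
  rw [norm_sub_rev] at this; linarith

/-- integrability of Newtonian kernel against decaying function -/
lemma int_newton (hn : 3 ≤ n) (x : EE n) {h : EE n → ℝ} (hm : AEStronglyMeasurable h) {C s : ℝ} (hs : 2 < s) (hC : 0 ≤ C)
    (hb : ∀ y, |h y| ≤ C * ‖y‖ ^ (-s)) (h0 : ∀ y, ‖y‖ < 1 → h y = 0) :
    Integrable (fun y => ‖x - y‖ ^ ((2:ℝ) - n) * h y) := by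
  have hn3 : (3:ℝ) ≤ n := by exact_mod_cast hn
  set r := 2 * ‖x‖ + 1 with hr
  have hrpos : 0 < r := by positivity
  have hmN : Measurable (fun y : EE n => ‖x - y‖ ^ ((2:ℝ) - n)) := by fun_prop
  have hbd : ∀ y, |h y| ≤ C := by
    intro y
    rcases lt_or_ge ‖y‖ 1 with h1 | h1
    · rw [h0 y h1]; simpa
    · refine (hb y).trans ?_
      have := Real.rpow_le_one_of_one_le_of_nonpos h1 (by linarith : -s ≤ 0)
      nlinarith
  have I1 : IntegrableOn (fun y => ‖x - y‖ ^ ((2:ℝ) - n) * h y) {y | r ≤ ‖y‖}ᶜ := by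
    have li : IntegrableOn (fun y : EE n => ‖x - y‖ ^ ((2:ℝ) - n)) (Metric.ball x (‖x‖ + r)) := by
      have hb := integrableOn_ball_rpow (n := n) (by omega) (p := 2 - n) (by linarith) (‖x‖ + r)
      rw [← integrable_indicator_iff Metric.isOpen_ball.measurableSet] at hb ⊢
      have := hb.comp_sub_left x
      refine this.congr (Eventually.of_forall fun y => ?_)
      simp [indicator, dist_eq_norm, norm_sub_rev]
    have li2 : IntegrableOn (fun y : EE n => ‖x - y‖ ^ ((2:ℝ) - n)) {y | r ≤ ‖y‖}ᶜ := by
      refine li.mono_set fun y hy => ?_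
      simp only [mem_compl_iff, mem_setOf_eq, not_le] at hy
      rw [Metric.mem_ball, dist_eq_norm]
      linarith [norm_sub_le y x]
    refine Integrable.mono' (li2.mul_const C) (hmN.aestronglyMeasurable.mul hm).restrict (Eventually.of_forall fun y => ?_)
    rw [norm_mul, Real.norm_eq_abs, Real.norm_eq_abs, abs_of_nonneg (by positivity)]
    exact mul_le_mul_of_nonneg_left (hbd y) (by positivity)
  have I2 : IntegrableOn (fun y => ‖x - y‖ ^ ((2:ℝ) - n) * h y) {y | r ≤ ‖y‖} := by
    have e := (integrableOn_ext_rpow (n := n) (by omega) (p := 2 - n - s) (by linarith) hrpos).const_mul ((1/2) ^ ((2:ℝ) - n) * C)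
    refine Integrable.mono' e (hmN.aestronglyMeasurable.mul hm).restrict ?_
    rw [ae_restrict_iff' (meas_ext r)]
    refine Eventually.of_forall fun y hy => ?_
    have hy : r ≤ ‖y‖ := hy
    have hyp : 0 < ‖y‖ := by linarith
    have h1 := half_norm (x := x) (y := y) (by linarith)
    rw [norm_mul, Real.norm_eq_abs, Real.norm_eq_abs, abs_of_nonneg (by positivity)]
    have h2 : ‖x - y‖ ^ ((2:ℝ) - n) ≤ (1/2 * ‖y‖) ^ ((2:ℝ) - n) :=
      Real.rpow_le_rpow_of_nonpos (by positivity) (by linarith) (by linarith)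
    rw [Real.mul_rpow (by positivity) (by positivity)] at h2
    calc _ ≤ ((1/2) ^ ((2:ℝ) - n) * ‖y‖ ^ ((2:ℝ) - n)) * (C * ‖y‖ ^ (-s)) := by gcongr; exact hb y
      _ = _ := by
        rw [show (2:ℝ) - n - s = (2 - n) + (-s) by ring, Real.rpow_add hyp]; ring
  have := I1.union I2
  rwa [compl_union_self, integrableOn_univ] at this

lemma pd_comp_smul (f : EE n → ℝ) (a : ℝ) (y : EE n) (i : Fin n) :
    pd i (fun y => f (a • y)) y = a * pd i f (a • y) := by
  unfold pd; rw [fderiv_comp_smul]; simp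

theorem newton_rep (hn : 3 ≤ n) {φ : EE n → ℝ} (hφ : ContDiff ℝ 2 φ) {C β : ℝ} (hβ : (n:ℝ) ≤ β) (hC : 0 ≤ C)
    (h0 : ∀ y, ‖y‖ < 1 → φ y = 0)
    (b0 : ∀ y, |φ y| ≤ C * ‖y‖ ^ ((2:ℝ) - n)) (b1 : ∀ i y, |pd i φ y| ≤ C * ‖y‖ ^ ((1:ℝ) - n))
    (b2 : ∀ y, |lap φ y| ≤ C * ‖y‖ ^ (-β)) (x : EE n) :
    ∫ y, ‖x - y‖ ^ ((2:ℝ) - n) * lap φ y = - cN n * φ x := by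
  have hn3 : (3:ℝ) ≤ n := by exact_mod_cast hn
  let bmp : ContDiffBump (0 : EE n) := ⟨1, 2, one_pos, one_lt_two⟩
  set χ : EE n → ℝ := fun y => bmp y with hχ
  have χs : ContDiff ℝ 2 χ := bmp.contDiff
  have χc : HasCompactSupport χ := bmp.hasCompactSupport
  have χle : ∀ y, |χ y| ≤ 1 := fun y => by rw [abs_of_nonneg bmp.nonneg]; exact bmp.le_one
  have χone : ∀ y, ‖y‖ < 1 → χ =ᶠ[nhds y] fun _ => 1 := fun y hy => by
    filter_upwards [Metric.isOpen_ball.mem_nhds (show y ∈ Metric.ball 0 1 by simpa using hy)] with z hz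
    exact bmp.one_of_mem_closedBall (Metric.ball_subset_closedBall hz)
  have χzero : ∀ y, 2 < ‖y‖ → χ =ᶠ[nhds y] fun _ => 0 := fun y hy => by
    have : IsOpen {z : EE n | 2 < ‖z‖} := isOpen_lt continuous_const continuous_norm
    filter_upwards [this.mem_nhds hy] with z hz
    exact bmp.zero_of_le_dist (by simpa using (le_of_lt hz))
  obtain ⟨D, hD⟩ : ∃ D, 0 ≤ D ∧ (∀ i y, |pd i χ y| ≤ D) ∧ (∀ y, |lap χ y| ≤ D) := by
    have h1 : ∀ i, ∃ D, ∀ y, |pd i χ y| ≤ D := fun i =>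
      (pd_supp χc i).exists_bound_of_continuous (pd_cont (χs.of_le (by norm_num)) i)
    choose D1 hD1 using h1
    obtain ⟨D2, hD2⟩ := (lap_supp χc).exists_bound_of_continuous (lap_cont χs)
    refine ⟨∑ i, |D1 i| + |D2|, by positivity, fun i y => (hD1 i y).trans ?_, fun y => (hD2 y).trans ?_⟩
    · have := Finset.single_le_sum (f := fun i => |D1 i|) (fun i _ => abs_nonneg _) (Finset.mem_univ i)
      have h3 := le_abs_self (D1 i)
      have h4 := abs_nonneg D2
      linarith
    · have := le_abs_self D2
      have h5 : 0 ≤ ∑ i, |D1 i| := by positivity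
      linarith
  obtain ⟨hD0, hD1, hD2⟩ := hD
  let χR : ℕ → EE n → ℝ := fun R y => χ ((R+1:ℝ)⁻¹ • y)
  have cR : ∀ R, ContDiff ℝ 2 (χR R) := fun R => χs.comp (contDiff_const_smul _)
  have sR : ∀ R, HasCompactSupport (χR R) := fun R =>
    χc.comp_homeomorph (Homeomorph.smulOfNeZero ((R+1:ℝ)⁻¹) (by positivity))
  have pR : ∀ R i, pd i (χR R) = fun y => (R+1:ℝ)⁻¹ * pd i χ ((R+1:ℝ)⁻¹ • y) := fun R i => by
    funext y; exact pd_comp_smul χ _ y i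
  have lR : ∀ R y, lap (χR R) y = ((R+1:ℝ)⁻¹)^2 * lap χ ((R+1:ℝ)⁻¹ • y) := fun R y => by
    unfold lap; rw [Finset.mul_sum]
    refine Finset.sum_congr rfl fun i _ => ?_
    rw [pR R i]
    have hd : DifferentiableAt ℝ (fun y => pd i χ ((R+1:ℝ)⁻¹ • y)) y :=
      DifferentiableAt.comp (g := pd i χ) y ((pd_contDiff (k := 1) i χs).differentiable (by simp) _) (by fun_prop)
    rw [pd_const_mul i _ hd, pd_comp_smul]; ring
  have invb : ∀ (R : ℕ) (y : EE n), ‖y‖ ≤ 2 * (R+1:ℝ) → 0 < ‖y‖ → (R+1:ℝ)⁻¹ ≤ 2 * ‖y‖⁻¹ := by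
    intro R y h h'
    rw [inv_le_iff_one_le_mul₀ (by positivity)]
    rw [show 2 * ‖y‖⁻¹ * (R+1:ℝ) = (2 * (R+1)) / ‖y‖ by field_simp]
    rwa [one_le_div h']
  have nsm : ∀ (R : ℕ) (y : EE n), ‖(R+1:ℝ)⁻¹ • y‖ = ‖y‖ / (R+1) := fun R y => by
    rw [norm_smul, norm_inv, Real.norm_eq_abs, abs_of_pos (by positivity)]; field_simp
  have pRb : ∀ R i y, 1 ≤ ‖y‖ → |pd i (χR R) y| ≤ 2 * D * ‖y‖⁻¹ := by
    intro R i y hy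
    rw [pR R i, abs_mul, abs_of_nonneg (by positivity)]
    rcases le_or_gt ‖y‖ (2 * (R+1:ℝ)) with h | h
    · calc _ ≤ (2 * ‖y‖⁻¹) * D := mul_le_mul (invb R y h (by linarith)) (hD1 _ _) (abs_nonneg _) (by positivity)
        _ = _ := by ring
    · have hz := χzero ((R+1:ℝ)⁻¹ • y) (by rw [nsm, lt_div_iff₀ (by positivity)]; exact h)
      have : pd i χ ((R+1:ℝ)⁻¹ • y) = 0 := by rw [(pd_congr i hz).eq_of_nhds]; simp [pd]
      rw [this]; simp; positivity
  have lRb : ∀ R y, 1 ≤ ‖y‖ → |lap (χR R) y| ≤ 4 * D * (‖y‖⁻¹)^2 := by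
    intro R y hy
    rw [lR R, abs_mul, abs_of_nonneg (by positivity)]
    rcases le_or_gt ‖y‖ (2 * (R+1:ℝ)) with h | h
    · calc _ ≤ (2 * ‖y‖⁻¹)^2 * D := by
            refine mul_le_mul ?_ (hD2 _) (abs_nonneg _) (by positivity)
            gcongr; exact (invb R y h (by linarith))
        _ = _ := by ring
    · have hz := χzero ((R+1:ℝ)⁻¹ • y) (by rw [nsm, lt_div_iff₀ (by positivity)]; exact h)
      have : lap χ ((R+1:ℝ)⁻¹ • y) = 0 := by rw [lap_congr hz]; simp [lap_const]
      rw [this]; simp; positivity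
  have lm : ∀ R y, lap (fun y => χR R y * φ y) y = χR R y * lap φ y + 2 * ∑ i, pd i (χR R) y * pd i φ y + lap (χR R) y * φ y :=
    fun R y => lap_mul (cR R).contDiffAt hφ.contDiffAt
  have z0 : ∀ R y, ‖y‖ < 1 → lap (fun y => χR R y * φ y) y = 0 := fun R y hy => by
    have : (fun y => χR R y * φ y) =ᶠ[nhds y] fun _ => 0 := by
      filter_upwards [Metric.isOpen_ball.mem_nhds (show y ∈ Metric.ball 0 1 by simpa using hy)] with z hz
      rw [h0 z (by simpa using hz), mul_zero]
    rw [lap_congr this]; simp [lap_const]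
  set K := C + 2 * (n * (2 * D * C)) + 4 * D * C with hK
  have hK0 : 0 ≤ K := by positivity
  have lb : ∀ R y, |lap (fun y => χR R y * φ y) y| ≤ K * ‖y‖ ^ (-(n:ℝ)) := by
    intro R y
    rcases lt_or_ge ‖y‖ 1 with hy | hy
    · rw [z0 R y hy]; simp; positivity
    have hyp : 0 < ‖y‖ := by linarith
    rw [lm]
    have t1 : |χR R y * lap φ y| ≤ C * ‖y‖ ^ (-(n:ℝ)) := by
      rw [abs_mul]
      calc _ ≤ 1 * (C * ‖y‖ ^ (-β)) := mul_le_mul (χle _) (b2 y) (abs_nonneg _) zero_le_one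
        _ ≤ _ := by
          rw [one_mul]
          exact mul_le_mul_of_nonneg_left (Real.rpow_le_rpow_of_exponent_le hy (by linarith)) hC
    have t2 : |∑ i, pd i (χR R) y * pd i φ y| ≤ n * (2 * D * C) * ‖y‖ ^ (-(n:ℝ)) := by
      refine (Finset.abs_sum_le_sum_abs _ _).trans ?_
      have : ∀ i ∈ Finset.univ, |pd i (χR R) y * pd i φ y| ≤ 2 * D * C * ‖y‖ ^ (-(n:ℝ)) := fun i _ => by
        rw [abs_mul]
        calc _ ≤ (2 * D * ‖y‖⁻¹) * (C * ‖y‖ ^ ((1:ℝ) - n)) := mul_le_mul (pRb R i y hy) (b1 i y) (abs_nonneg _) (by positivity)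
          _ = _ := by
            rw [show (1:ℝ) - n = 1 + -(n:ℝ) by ring, Real.rpow_add hyp, Real.rpow_one]; field_simp
      refine (Finset.sum_le_sum this).trans ?_
      simp; linarith
    have t3 : |lap (χR R) y * φ y| ≤ 4 * D * C * ‖y‖ ^ (-(n:ℝ)) := by
      rw [abs_mul]
      calc _ ≤ (4 * D * (‖y‖⁻¹)^2) * (C * ‖y‖ ^ ((2:ℝ) - n)) := mul_le_mul (lRb R y hy) (b0 y) (abs_nonneg _) (by positivity)
        _ = _ := by
          rw [show (2:ℝ) - n = (2:ℕ) + -(n:ℝ) by push_cast; ring, Real.rpow_add hyp, Real.rpow_natCast]; field_simp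
    refine (abs_add_three _ _ _).trans ?_
    rw [abs_mul (2:ℝ), abs_two, hK]
    linarith
  have L : Tendsto (fun R : ℕ => ∫ y, ‖x - y‖ ^ ((2:ℝ) - n) * lap (fun y => χR R y * φ y) y) atTop
      (nhds (∫ y, ‖x - y‖ ^ ((2:ℝ) - n) * lap φ y)) := by
    have hmN : Measurable (fun y : EE n => ‖x - y‖ ^ ((2:ℝ) - n)) := by fun_prop
    let hh : EE n → ℝ := {y : EE n | 1 ≤ ‖y‖}.indicator fun y => K * ‖y‖ ^ (-(n:ℝ))
    have hhI : Integrable (fun y => ‖x - y‖ ^ ((2:ℝ) - n) * hh y) := by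
      refine int_newton hn x ?_ (C := K) (s := n) (by linarith) hK0 ?_ ?_
      · exact ((by fun_prop : Measurable fun y : EE n => K * ‖y‖ ^ (-(n:ℝ))).indicator (meas_ext 1)).aestronglyMeasurable
      · intro y
        by_cases h : 1 ≤ ‖y‖
        · simp only [hh, indicator, mem_setOf_eq, h, if_true]; rw [abs_of_nonneg (by positivity)]
        · simp only [hh, indicator, mem_setOf_eq, h, if_false]; simp; positivity
      · intro y hy; simp [hh, indicator, hy]
    refine tendsto_integral_of_dominated_convergence _ (fun R => ?_) hhI (fun R => ?_) ?_
    · exact hmN.aestronglyMeasurable.mul (lap_cont ((cR R).mul hφ)).aestronglyMeasurable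
    · refine Eventually.of_forall fun y => ?_
      rw [norm_mul, Real.norm_eq_abs, abs_of_nonneg (by positivity)]
      refine mul_le_mul_of_nonneg_left ?_ (by positivity)
      by_cases h : 1 ≤ ‖y‖
      · simp only [hh, indicator, mem_setOf_eq, h, if_true]; exact lb R y
      · simp only [hh, indicator, mem_setOf_eq, h, if_false]; rw [z0 R y (not_le.1 h)]; simp
    · refine Eventually.of_forall fun y => Tendsto.const_mul _ ?_
      refine tendsto_const_nhds.congr' ?_
      obtain ⟨R0, hR0⟩ := exists_nat_gt ‖y‖
      filter_upwards [eventually_ge_atTop R0] with R hR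
      symm
      apply lap_congr
      have hRR : ‖y‖ < R + 1 := by
        have : (R0:ℝ) ≤ R := by exact_mod_cast hR
        linarith
      filter_upwards [Metric.isOpen_ball.mem_nhds (show y ∈ Metric.ball 0 (R+1:ℝ) by simpa using hRR)] with z hz
      have : χR R z = 1 := by
        refine (χone ((R+1:ℝ)⁻¹ • z) ?_).eq_of_nhds
        rw [nsm, div_lt_one (by positivity)]; simpa using hz
      rw [this, one_mul]
  have Rr : Tendsto (fun R : ℕ => ∫ y, ‖x - y‖ ^ ((2:ℝ) - n) * lap (fun y => χR R y * φ y) y) atTop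
      (nhds (- cN n * φ x)) := by
    refine tendsto_const_nhds.congr' ?_
    obtain ⟨R0, hR0⟩ := exists_nat_gt ‖x‖
    filter_upwards [eventually_ge_atTop R0] with R hR
    rw [fund hn ((cR R).mul hφ) ((sR R).mul_right)]
    have hRR : ‖x‖ < R + 1 := by
      have : (R0:ℝ) ≤ R := by exact_mod_cast hR
      linarith
    have : χR R x = 1 := by
      refine (χone ((R+1:ℝ)⁻¹ • x) ?_).eq_of_nhds
      rw [nsm, div_lt_one (by positivity)]; simpa using hRR
    rw [this, one_mul]
  exact tendsto_nhds_unique L Rr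

end rep

end partD0


section partD1
open Filter MeasureTheory Set
open scoped Pointwise

section far
variable {n : ℕ}

/-- integrable with integral bound -/
def IB (h : EE n → ℝ) (b : ℝ) : Prop := Integrable h ∧ ∫ y, h y ≤ b

lemma IB.add {h k : EE n → ℝ} {b c : ℝ} (H : IB h b) (K : IB k c) : IB (fun y => h y + k y) (b + c) :=
  ⟨H.1.add K.1, by rw [integral_add H.1 K.1]; exact add_le_add H.2 K.2⟩

lemma IB.cmul {h : EE n → ℝ} {b : ℝ} (H : IB h b) {a : ℝ} (ha : 0 ≤ a) : IB (fun y => a * h y) (a * b) :=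
  ⟨H.1.const_mul a, by rw [integral_const_mul]; exact mul_le_mul_of_nonneg_left H.2 ha⟩

lemma IB.sum {ι : Type*} (s : Finset ι) {h : ι → EE n → ℝ} {b : ι → ℝ} (H : ∀ i ∈ s, IB (h i) (b i)) :
    IB (fun y => ∑ i ∈ s, h i y) (∑ i ∈ s, b i) :=
  ⟨integrable_finsetSum _ fun i hi => (H i hi).1, by
    rw [integral_finsetSum _ fun i hi => (H i hi).1]; exact Finset.sum_le_sum fun i hi => (H i hi).2⟩

lemma IB_ext (hn : 1 ≤ n) {p : ℝ} (hp : p < -(n:ℝ)) : ∃ C, 0 ≤ C ∧ ∀ r : ℝ, 0 < r →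
    IB ({y : EE n | r ≤ ‖y‖}.indicator fun y => ‖y‖ ^ p) (C * r ^ ((n:ℝ) + p)) := by
  refine ⟨∫ y in {y : EE n | 1 ≤ ‖y‖}, ‖y‖ ^ p, integral_nonneg fun y => by positivity, fun r hr => ⟨?_, ?_⟩⟩
  · rw [integrable_indicator_iff (meas_ext r)]; exact integrableOn_ext_rpow hn hp hr
  · rw [integral_indicator (meas_ext r), integral_ext_rpow p hr, mul_comm]

lemma IB_ball (hn : 1 ≤ n) {p : ℝ} (hp : -(n:ℝ) < p) : ∃ C, 0 ≤ C ∧ ∀ r : ℝ, 0 < r →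
    IB ((Metric.ball (0 : EE n) r).indicator fun y => ‖y‖ ^ p) (C * r ^ ((n:ℝ) + p)) := by
  refine ⟨∫ y in Metric.ball (0 : EE n) 1, ‖y‖ ^ p, integral_nonneg fun y => by positivity, fun r hr => ⟨?_, ?_⟩⟩
  · rw [integrable_indicator_iff Metric.isOpen_ball.measurableSet]; exact integrableOn_ball_rpow hn hp r
  · rw [integral_indicator Metric.isOpen_ball.measurableSet, integral_ball_rpow p hr, mul_comm]

lemma IB_ball' (hn : 1 ≤ n) {p : ℝ} (hp : -(n:ℝ) < p) : ∃ C, 0 ≤ C ∧ ∀ (x : EE n) (r : ℝ), 0 < r →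
    IB ((Metric.ball (x : EE n) r).indicator fun y => ‖x - y‖ ^ p) (C * r ^ ((n:ℝ) + p)) := by
  obtain ⟨C, hC, h⟩ := IB_ball hn hp
  refine ⟨C, hC, fun x r hr => ?_⟩
  have e : ((Metric.ball (x : EE n) r).indicator fun y => ‖x - y‖ ^ p) =
      fun y => ((Metric.ball (0 : EE n) r).indicator fun y => ‖y‖ ^ p) (x - y) := by
    funext y; simp [indicator, dist_eq_norm, norm_sub_rev]
  rw [e]
  refine ⟨(h r hr).1.comp_sub_left x, ?_⟩
  rw [integral_sub_left_eq_self (fun y => ((Metric.ball (0 : EE n) r).indicator fun y => ‖y‖ ^ p) y) volume x]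
  exact (h r hr).2

lemma meas_ann (r : ℝ) : MeasurableSet {y : EE n | 1 ≤ ‖y‖ ∧ ‖y‖ ≤ r} :=
  (measurableSet_le measurable_const measurable_norm).inter (measurableSet_le measurable_norm measurable_const)

lemma IB_ann (hn : 1 ≤ n) {p : ℝ} (hp : -(n:ℝ) ≤ p) : ∃ C, 0 ≤ C ∧ ∀ r : ℝ, 1 ≤ r →
    IB ({y : EE n | 1 ≤ ‖y‖ ∧ ‖y‖ ≤ r}.indicator fun y => ‖y‖ ^ p)
      (C * r ^ ((n:ℝ) + p) * (if p = -(n:ℝ) then Real.log r else 1)) := by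
  have hint : ∀ r : ℝ, Integrable ({y : EE n | 1 ≤ ‖y‖ ∧ ‖y‖ ≤ r}.indicator fun y => ‖y‖ ^ p) := by
    intro r
    rw [integrable_indicator_iff (meas_ann r)]
    have hc : IsCompact {y : EE n | 1 ≤ ‖y‖ ∧ ‖y‖ ≤ r} := by
      refine (isCompact_closedBall (0 : EE n) r).of_isClosed_subset ?_ fun y hy => by simpa using hy.2
      exact (isClosed_le continuous_const continuous_norm).inter (isClosed_le continuous_norm continuous_const)
    refine ContinuousOn.integrableOn_compact hc fun y hy => ?_
    refine ContinuousWithinAt.rpow_const continuous_norm.continuousWithinAt (Or.inl ?_)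
    have := hy.1; positivity
  rcases eq_or_lt_of_le hp with h | h
  · obtain ⟨C, hC, hh⟩ := integral_annulus_log (n := n) hn
    refine ⟨C, hC, fun r hr => ⟨hint r, ?_⟩⟩
    subst h
    rw [integral_indicator (meas_ann r), hh r hr]; simp
  · obtain ⟨C, hC, hh⟩ := IB_ball (n := n) hn h
    refine ⟨C * 2 ^ ((n:ℝ) + p), by positivity, fun r hr => ⟨hint r, ?_⟩⟩
    rw [if_neg (by linarith [h.ne']), mul_one]
    have := (hh (2 * r) (by linarith)).2
    rw [Real.mul_rpow (by norm_num) (by linarith)] at this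
    refine (integral_mono (hint r) (hh (2*r) (by linarith)).1 fun y => ?_).trans (this.trans (by linarith))
    by_cases hy : y ∈ {y : EE n | 1 ≤ ‖y‖ ∧ ‖y‖ ≤ r}
    · have : y ∈ Metric.ball (0 : EE n) (2*r) := by simp; linarith [hy.2]
      rw [indicator_of_mem hy, indicator_of_mem this]
    · rw [indicator_of_notMem hy]; exact indicator_nonneg (fun y _ => by positivity) y

theorem far_expand (hn : 3 ≤ n) {φ : EE n → ℝ} (hφ : ContDiff ℝ 2 φ) {C β : ℝ} (hβ : (n:ℝ) < β) (hC : 0 ≤ C)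
    (h0 : ∀ y, ‖y‖ < 1 → φ y = 0)
    (b0 : ∀ y, |φ y| ≤ C * ‖y‖ ^ ((2:ℝ) - n)) (b1 : ∀ i y, |pd i φ y| ≤ C * ‖y‖ ^ ((1:ℝ) - n))
    (b2 : ∀ y, |lap φ y| ≤ C * ‖y‖ ^ (-β)) (N : ℕ) (hN : (N:ℝ) < β - n) (hN' : β - n ≤ N + 1) :
    ∃ a : (k : ℕ) → (Fin k → Fin n) → ℝ, ∃ C', 0 ≤ C' ∧ ∀ x : EE n, 2 ≤ ‖x‖ →
      |φ x - ∑ k ∈ Finset.range (N+1), ∑ w, a k w * KF k w x| ≤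
        C' * ‖x‖ ^ ((2:ℝ) - β) * (if β - n = N + 1 then Real.log ‖x‖ else 1) := by
  have hn3 : (3:ℝ) ≤ n := by exact_mod_cast hn
  have hn1 : 1 ≤ n := by omega
  set g := lap φ with hg
  have gc : Continuous g := lap_cont hφ
  have g0 : ∀ y, ‖y‖ < 1 → g y = 0 := fun y hy => by
    have : φ =ᶠ[nhds y] fun _ => 0 := by
      filter_upwards [Metric.isOpen_ball.mem_nhds (show y ∈ Metric.ball 0 1 by simpa using hy)] with z hz
      exact h0 z (by simpa using hz)
    rw [hg, lap_congr this, lap_const]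
  have cpos := cN_pos hn
  have rep := newton_rep hn hφ hβ.le hC h0 b0 b1 b2
  -- moments integrable
  have mom : ∀ k ∈ Finset.range (N+1), ∀ w : Fin k → Fin n, Integrable (fun y : EE n => (∏ j, y (w j)) * g y) := by
    intro k hk w
    have hk' : (k:ℝ) ≤ N := by exact_mod_cast Nat.lt_succ_iff.1 (Finset.mem_range.1 hk)
    obtain ⟨D, hD, hI⟩ := IB_ext (n := n) hn1 (p := k - β) (by linarith)
    refine Integrable.mono' ((hI 1 one_pos).1.const_mul C) ?_ (Eventually.of_forall fun y => ?_)
    · refine Continuous.aestronglyMeasurable ?_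
      refine Continuous.mul (continuous_finsetProd _ fun j _ => by fun_prop) gc
    · rw [norm_mul, Real.norm_eq_abs, Real.norm_eq_abs]
      by_cases hy : 1 ≤ ‖y‖
      · rw [indicator_of_mem (show y ∈ {y : EE n | 1 ≤ ‖y‖} from hy)]
        calc _ ≤ ‖y‖ ^ k * (C * ‖y‖ ^ (-β)) := mul_le_mul (prod_bound w y) (b2 y) (abs_nonneg _) (by positivity)
          _ = _ := by
            rw [sub_eq_add_neg, Real.rpow_add (by linarith), Real.rpow_natCast]; ring
      · rw [g0 y (not_le.1 hy)]; simp
        exact mul_nonneg hC (indicator_nonneg (fun y _ => by positivity) y)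
  refine ⟨fun k w => -(cN n)⁻¹ * ((-1) ^ k / k.factorial * ∫ y : EE n, (∏ j, y (w j)) * g y), ?_⟩
  obtain ⟨CE, hCE, hE⟩ := newton_expand (n := n) (N+1) (by omega)
  choose CT hCT hT using fun k => TT_bound (n := n) k
  obtain ⟨Ca, hCa, hIa⟩ := IB_ann (n := n) hn1 (p := ((N+1:ℕ):ℝ) - β) (by push_cast; linarith)
  have hext : ∀ k : ℕ, ∃ D, 0 ≤ D ∧ ((k:ℝ) < β - n → ∀ r : ℝ, 0 < r →
    IB ({y : EE n | r ≤ ‖y‖}.indicator fun y => ‖y‖ ^ ((k:ℝ) - β)) (D * r ^ ((n:ℝ) + (k - β)))) := by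
    intro k
    by_cases hk : (k:ℝ) < β - n
    · obtain ⟨D, hD, h⟩ := IB_ext (n := n) hn1 (p := k - β) (by linarith)
      exact ⟨D, hD, fun _ => h⟩
    · exact ⟨0, le_rfl, fun h => absurd h hk⟩
  choose Ce hCe hIe using hext
  obtain ⟨Cb, hCb, hIb⟩ := IB_ball' (n := n) hn1 (p := 2 - n) (by linarith)
  let lg : ℝ → ℝ := fun r => if β - n = N + 1 then Real.log r else 1
  have hlg : ∀ r : ℝ, 2 ≤ r → 1/2 ≤ lg r := by
    intro r hr
    by_cases h : β - n = N+1
    · simp only [lg, h, if_true]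
      have := Real.log_le_log two_pos hr
      linarith [Real.log_two_gt_d9]
    · simp only [lg, h, if_false]; norm_num
  let K2 := ∑ k ∈ Finset.range (N+1), CT k * C * Ce k * (1/2) ^ ((n:ℝ) + (k - β))
  let K3 := Ce 0 * C * (1/2) ^ ((n:ℝ) + ((0:ℕ) - β))
  let K4 := C * (1/2) ^ (-β) * Cb
  have hK : 0 ≤ CE * C * Ca * (1/2)^((n:ℝ)+((N+1:ℕ)-β)) ∧ 0 ≤ K2 ∧ 0 ≤ K3 ∧ 0 ≤ K4 := by
    refine ⟨by positivity, Finset.sum_nonneg fun k _ => ?_, ?_, by positivity⟩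
    · have := hCe k; have := hCT k; positivity
    · have := hCe 0; positivity
  refine ⟨(cN n)⁻¹ * (CE * C * Ca * (1/2)^((n:ℝ)+((N+1:ℕ)-β)) + 2 * (K2 + K3 + K4)), by
    obtain ⟨h1, h2, h3, h4⟩ := hK; positivity, fun x hx => ?_⟩
  have hx0 : 0 < ‖x‖ := by linarith
  have hxne : x ≠ 0 := norm_pos_iff.1 hx0
  -- the difference as an integral
  have sumint : ∀ y, ∑ k ∈ Finset.range (N+1), (-1:ℝ) ^ k / k.factorial * TT k x y * g y =
      ∑ k ∈ Finset.range (N+1), ∑ w : Fin k → Fin n, ((-1:ℝ) ^ k / k.factorial * KF k w x) * ((∏ j, y (w j)) * g y) := by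
    intro y
    refine Finset.sum_congr rfl fun k _ => ?_
    unfold TT
    rw [Finset.mul_sum, Finset.sum_mul]
    exact Finset.sum_congr rfl fun w _ => by ring
  have iS : Integrable (fun y => ∑ k ∈ Finset.range (N+1), (-1:ℝ) ^ k / k.factorial * TT k x y * g y) := by
    simp_rw [sumint]
    exact integrable_finsetSum _ fun k hk => integrable_finsetSum _ fun w _ => (mom k hk w).const_mul _
  have iSv : ∫ y, ∑ k ∈ Finset.range (N+1), (-1:ℝ) ^ k / k.factorial * TT k x y * g y =
      ∑ k ∈ Finset.range (N+1), ∑ w : Fin k → Fin n, ((-1:ℝ) ^ k / k.factorial * KF k w x) * ∫ y : EE n, (∏ j, y (w j)) * g y := by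
    simp_rw [sumint]
    rw [integral_finsetSum _ fun k hk => integrable_finsetSum _ fun w _ => (mom k hk w).const_mul _]
    refine Finset.sum_congr rfl fun k hk => ?_
    rw [integral_finsetSum _ fun w _ => (mom k hk w).const_mul _]
    exact Finset.sum_congr rfl fun w _ => integral_const_mul _ _
  have iN : Integrable (fun y => ‖x - y‖ ^ ((2:ℝ) - n) * g y) :=
    int_newton hn x gc.aestronglyMeasurable (by linarith) hC b2 g0
  have diff : φ x - ∑ k ∈ Finset.range (N+1), ∑ w, (-(cN n)⁻¹ * ((-1) ^ k / k.factorial * ∫ y : EE n, (∏ j, y (w j)) * g y)) * KF k w x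
      = -(cN n)⁻¹ * ∫ y, (‖x - y‖ ^ ((2:ℝ) - n) - ∑ k ∈ Finset.range (N+1), (-1:ℝ) ^ k / k.factorial * TT k x y) * g y := by
    have e : ∀ y, (‖x - y‖ ^ ((2:ℝ) - n) - ∑ k ∈ Finset.range (N+1), (-1:ℝ) ^ k / k.factorial * TT k x y) * g y
      = ‖x - y‖ ^ ((2:ℝ) - n) * g y - ∑ k ∈ Finset.range (N+1), (-1:ℝ) ^ k / k.factorial * TT k x y * g y := by
      intro y; rw [sub_mul, Finset.sum_mul]
    simp_rw [e]
    rw [integral_sub iN iS, rep x, iSv, mul_sub, Finset.mul_sum]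
    congr 1
    · field_simp
    · refine Finset.sum_congr rfl fun k _ => ?_
      rw [Finset.mul_sum]
      exact Finset.sum_congr rfl fun w _ => by ring
  rw [diff, abs_mul, abs_neg, abs_of_pos (inv_pos.2 cpos), mul_assoc, mul_assoc]
  refine mul_le_mul_of_nonneg_left ?_ (inv_pos.2 cpos).le
  -- bound function
  set r := ‖x‖ / 2 with hr
  have hr1 : 1 ≤ r := by linarith
  have hr0 : 0 < r := by linarith
  have B1 := (hIa r hr1).cmul (a := CE * C * ‖x‖ ^ ((2:ℝ) - n - (N+1:ℕ))) (by positivity)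
  have B2 := IB.sum (Finset.range (N+1)) (fun k hk =>
    ((hIe k (by
      have hk' : (k:ℝ) ≤ N := by exact_mod_cast Nat.lt_succ_iff.1 (Finset.mem_range.1 hk)
      linarith)) r hr0).cmul
      (a := CT k * C * ‖x‖ ^ ((2:ℝ) - n - k)) (by have := hCT k; positivity))
  have B3 := ((hIe 0 (by push_cast; linarith)) r hr0).cmul (a := C * ‖x‖ ^ ((2:ℝ) - n)) (by positivity)
  have B4 := (hIb x ‖x‖ hx0).cmul (a := C * r ^ (-β)) (by positivity)
  have BB := ((B1.add B2).add B3).add B4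
  rw [← Real.norm_eq_abs]
  refine (norm_integral_le_of_norm_le BB.1 (Eventually.of_forall fun y => ?_)).trans (BB.2.trans ?_)
  · have n1 : 0 ≤ CE * C * ‖x‖ ^ ((2:ℝ) - n - (N+1:ℕ)) * ({y : EE n | 1 ≤ ‖y‖ ∧ ‖y‖ ≤ r}.indicator (fun y => ‖y‖ ^ (((N+1:ℕ):ℝ) - β)) y) :=
      mul_nonneg (by positivity) (indicator_nonneg (fun y _ => by positivity) y)
    have n2 : 0 ≤ ∑ k ∈ Finset.range (N+1), CT k * C * ‖x‖ ^ ((2:ℝ) - n - k) * ({y : EE n | r ≤ ‖y‖}.indicator (fun y => ‖y‖ ^ ((k:ℝ) - β)) y) :=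
      Finset.sum_nonneg fun k _ => mul_nonneg (by have := hCT k; positivity) (indicator_nonneg (fun y _ => by positivity) y)
    have n3 : 0 ≤ C * ‖x‖ ^ ((2:ℝ) - n) * ({y : EE n | r ≤ ‖y‖}.indicator (fun y => ‖y‖ ^ (((0:ℕ):ℝ) - β)) y) :=
      mul_nonneg (by positivity) (indicator_nonneg (fun y _ => by positivity) y)
    have n4 : 0 ≤ C * r ^ (-β) * ((Metric.ball x ‖x‖).indicator (fun y => ‖x - y‖ ^ ((2:ℝ) - n)) y) :=
      mul_nonneg (by positivity) (indicator_nonneg (fun y _ => by positivity) y)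
    rw [norm_mul, Real.norm_eq_abs, Real.norm_eq_abs]
    beta_reduce
    rcases lt_or_ge ‖y‖ 1 with hy | hy
    · rw [g0 y hy, abs_zero, mul_zero]; linarith
    have hyp : 0 < ‖y‖ := by linarith
    rcases le_or_gt ‖y‖ r with hyr | hyr
    · have m1 : |‖x - y‖ ^ ((2:ℝ) - n) - ∑ k ∈ Finset.range (N+1), (-1:ℝ) ^ k / k.factorial * TT k x y| * |g y|
          ≤ CE * C * ‖x‖ ^ ((2:ℝ) - n - (N+1:ℕ)) * ({y : EE n | 1 ≤ ‖y‖ ∧ ‖y‖ ≤ r}.indicator (fun y => ‖y‖ ^ (((N+1:ℕ):ℝ) - β)) y) := by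
        rw [indicator_of_mem (show y ∈ {y : EE n | 1 ≤ ‖y‖ ∧ ‖y‖ ≤ r} from ⟨hy, hyr⟩)]
        refine (mul_le_mul (hE x y hxne hyr) (b2 y) (abs_nonneg _) (by positivity)).trans (le_of_eq ?_)
        rw [sub_eq_add_neg ((N+1:ℕ):ℝ) β, Real.rpow_add hyp, Real.rpow_natCast]; ring
      exact le_add_of_le_of_nonneg (le_add_of_le_of_nonneg (le_add_of_le_of_nonneg m1 n2) n3) n4
    · have tri : |‖x - y‖ ^ ((2:ℝ) - n) - ∑ k ∈ Finset.range (N+1), (-1:ℝ) ^ k / k.factorial * TT k x y| ≤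
          ‖x - y‖ ^ ((2:ℝ) - n) + ∑ k ∈ Finset.range (N+1), CT k * ‖y‖ ^ k * ‖x‖ ^ ((2:ℝ) - n - k) := by
        refine (abs_sub _ _).trans ?_
        rw [abs_of_nonneg (by positivity : 0 ≤ ‖x - y‖ ^ ((2:ℝ) - n))]
        refine add_le_add le_rfl ((Finset.abs_sum_le_sum_abs _ _).trans (Finset.sum_le_sum fun k _ => ?_))
        rw [abs_mul, abs_div, abs_pow, abs_neg, abs_one, one_pow]
        have f1 : (1:ℝ) / |(k.factorial : ℝ)| ≤ 1 := by
          rw [abs_of_nonneg (by positivity)]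
          have : (1:ℝ) ≤ k.factorial := by exact_mod_cast k.factorial_pos
          rw [div_le_one (by positivity)]; exact this
        calc _ ≤ 1 * |TT k x y| := mul_le_mul_of_nonneg_right f1 (abs_nonneg _)
          _ ≤ _ := by rw [one_mul]; exact hT k x y hxne
      have hmem : y ∈ {y : EE n | r ≤ ‖y‖} := hyr.le
      have gb : |g y| ≤ C * ‖y‖ ^ (-β) := b2 y
      have m2 : (∑ k ∈ Finset.range (N+1), CT k * ‖y‖ ^ k * ‖x‖ ^ ((2:ℝ) - n - k)) * |g y| ≤
          ∑ k ∈ Finset.range (N+1), CT k * C * ‖x‖ ^ ((2:ℝ) - n - k) * ({y : EE n | r ≤ ‖y‖}.indicator (fun y => ‖y‖ ^ ((k:ℝ) - β)) y) := by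
        rw [Finset.sum_mul]
        refine Finset.sum_le_sum fun k _ => ?_
        rw [indicator_of_mem hmem]
        have := hCT k
        calc _ ≤ CT k * ‖y‖ ^ k * ‖x‖ ^ ((2:ℝ) - n - k) * (C * ‖y‖ ^ (-β)) := mul_le_mul_of_nonneg_left gb (by positivity)
          _ = _ := by rw [sub_eq_add_neg (k:ℝ) β, Real.rpow_add hyp, Real.rpow_natCast]; ring
      have m3 : ‖x - y‖ ^ ((2:ℝ) - n) * |g y| ≤ C * ‖x‖ ^ ((2:ℝ) - n) * ({y : EE n | r ≤ ‖y‖}.indicator (fun y => ‖y‖ ^ (((0:ℕ):ℝ) - β)) y)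
          + C * r ^ (-β) * ((Metric.ball x ‖x‖).indicator (fun y => ‖x - y‖ ^ ((2:ℝ) - n)) y) := by
        by_cases hb : y ∈ Metric.ball x ‖x‖
        · rw [indicator_of_mem hb]
          have : ‖x - y‖ ^ ((2:ℝ) - n) * |g y| ≤ C * r ^ (-β) * ‖x - y‖ ^ ((2:ℝ) - n) := by
            rw [mul_comm]
            refine mul_le_mul_of_nonneg_right (gb.trans ?_) (by positivity)
            exact mul_le_mul_of_nonneg_left (Real.rpow_le_rpow_of_nonpos hr0 hyr.le (by linarith)) hC
          linarith
        · rw [indicator_of_mem hmem]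
          have hd : ‖x‖ ≤ ‖x - y‖ := by
            rw [Metric.mem_ball, dist_eq_norm, norm_sub_rev, not_lt] at hb; exact hb
          have : ‖x - y‖ ^ ((2:ℝ) - n) * |g y| ≤ C * ‖x‖ ^ ((2:ℝ) - n) * ‖y‖ ^ (((0:ℕ):ℝ) - β) := by
            rw [Nat.cast_zero, zero_sub]
            calc _ ≤ ‖x‖ ^ ((2:ℝ) - n) * (C * ‖y‖ ^ (-β)) :=
                  mul_le_mul (Real.rpow_le_rpow_of_nonpos hx0 hd (by linarith)) gb (abs_nonneg _) (by positivity)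
              _ = _ := by ring
          linarith
      have m4 := mul_le_mul_of_nonneg_right tri (abs_nonneg (g y))
      rw [add_mul] at m4
      generalize (∑ k ∈ Finset.range (N+1), CT k * C * ‖x‖ ^ ((2:ℝ) - n - k) * ({y : EE n | r ≤ ‖y‖}.indicator (fun y => ‖y‖ ^ ((k:ℝ) - β)) y)) = a2 at m2 ⊢
      generalize CE * C * ‖x‖ ^ ((2:ℝ) - n - (N+1:ℕ)) * ({y : EE n | 1 ≤ ‖y‖ ∧ ‖y‖ ≤ r}.indicator (fun y => ‖y‖ ^ (((N+1:ℕ):ℝ) - β)) y) = a1 at n1 ⊢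
      refine m4.trans ?_
      refine (add_le_add m3 m2).trans ?_
      generalize C * ‖x‖ ^ ((2:ℝ) - n) * ({y : EE n | r ≤ ‖y‖}.indicator (fun y => ‖y‖ ^ (((0:ℕ):ℝ) - β)) y) = a3
      linarith
  · have ex : r = 1/2 * ‖x‖ := by rw [hr]; ring
    have pw : ∀ p : ℝ, r ^ p = (1/2) ^ p * ‖x‖ ^ p := fun p => by
      rw [ex, Real.mul_rpow (by norm_num) hx0.le]
    have lgx := hlg ‖x‖ hx
    have hP : 0 < ‖x‖ ^ ((2:ℝ) - β) := by positivity
    have lgr : (if ((N+1:ℕ):ℝ) - β = -(n:ℝ) then Real.log r else 1) ≤ lg ‖x‖ := by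
      by_cases h : β - n = N + 1
      · have h' : ((N+1:ℕ):ℝ) - β = -(n:ℝ) := by push_cast; linarith
        simp only [lg, h, h', if_true]
        exact Real.log_le_log hr0 (by linarith)
      · have h' : ¬ ((N+1:ℕ):ℝ) - β = -(n:ℝ) := fun h'' => h (by push_cast at h''; linarith)
        simp only [lg, h, h', if_false]; exact le_rfl
    have q1 : CE * C * ‖x‖ ^ ((2:ℝ) - n - (N+1:ℕ)) * (Ca * r ^ ((n:ℝ) + ((N+1:ℕ) - β)) * (if ((N+1:ℕ):ℝ) - β = -(n:ℝ) then Real.log r else 1))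
        ≤ CE * C * Ca * (1/2)^((n:ℝ)+((N+1:ℕ)-β)) * (‖x‖ ^ ((2:ℝ) - β) * lg ‖x‖) := by
      have e : ‖x‖ ^ ((2:ℝ) - β) = ‖x‖ ^ ((2:ℝ) - n - (N+1:ℕ)) * ‖x‖ ^ ((n:ℝ) + ((N+1:ℕ) - β)) := by
        rw [← Real.rpow_add hx0]; congr 1; ring
      calc _ ≤ CE * C * ‖x‖ ^ ((2:ℝ) - n - (N+1:ℕ)) * (Ca * r ^ ((n:ℝ) + ((N+1:ℕ) - β)) * lg ‖x‖) := by gcongr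
        _ = _ := by rw [pw, e]; ring
    have q2 : ∑ k ∈ Finset.range (N+1), CT k * C * ‖x‖ ^ ((2:ℝ) - n - k) * (Ce k * r ^ ((n:ℝ) + (k - β))) = K2 * ‖x‖ ^ ((2:ℝ) - β) := by
      simp only [K2]; rw [Finset.sum_mul]
      refine Finset.sum_congr rfl fun k _ => ?_
      have e : ‖x‖ ^ ((2:ℝ) - β) = ‖x‖ ^ ((2:ℝ) - n - k) * ‖x‖ ^ ((n:ℝ) + (k - β)) := by
        rw [← Real.rpow_add hx0]; congr 1; ring
      rw [pw, e]; ring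
    have q3 : C * ‖x‖ ^ ((2:ℝ) - n) * (Ce 0 * r ^ ((n:ℝ) + ((0:ℕ) - β))) = K3 * ‖x‖ ^ ((2:ℝ) - β) := by
      have e : ‖x‖ ^ ((2:ℝ) - β) = ‖x‖ ^ ((2:ℝ) - n) * ‖x‖ ^ ((n:ℝ) + ((0:ℕ) - β)) := by
        rw [← Real.rpow_add hx0]; congr 1; push_cast; ring
      simp only [K3]; rw [pw, e]; ring
    have q4 : C * r ^ (-β) * (Cb * ‖x‖ ^ ((n:ℝ) + (2 - n))) = K4 * ‖x‖ ^ ((2:ℝ) - β) := by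
      have e : ‖x‖ ^ ((2:ℝ) - β) = ‖x‖ ^ (-β) * ‖x‖ ^ ((n:ℝ) + (2 - n)) := by
        rw [← Real.rpow_add hx0]; congr 1; ring
      simp only [K4]; rw [pw, e]; ring
    rw [q2, q3, q4]
    obtain ⟨-, h2, h3, h4⟩ := hK
    have hs : 0 ≤ (K2 + K3 + K4) * ‖x‖ ^ ((2:ℝ) - β) := by positivity
    have : (K2 + K3 + K4) * ‖x‖ ^ ((2:ℝ) - β) ≤ 2 * (K2 + K3 + K4) * (‖x‖ ^ ((2:ℝ) - β) * lg ‖x‖) := by nlinarith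
    have fin : (CE * C * Ca * (1/2)^((n:ℝ)+((N+1:ℕ)-β)) + 2 * (K2 + K3 + K4)) * (‖x‖ ^ ((2:ℝ) - β) * lg ‖x‖) =
      CE * C * Ca * (1/2)^((n:ℝ)+((N+1:ℕ)-β)) * (‖x‖ ^ ((2:ℝ) - β) * lg ‖x‖) + 2 * (K2 + K3 + K4) * (‖x‖ ^ ((2:ℝ) - β) * lg ‖x‖) := by ring
    show _ ≤ (CE * C * Ca * (1/2)^((n:ℝ)+((N+1:ℕ)-β)) + 2 * (K2 + K3 + K4)) * (‖x‖ ^ ((2:ℝ) - β) * lg ‖x‖)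
    rw [fin]
    linarith

end far

end partD1


section partP0
open Filter MeasureTheory Set
open scoped Pointwise

section kern
variable {n : ℕ}

lemma lap_norm_rpow {x : EE n} (hx : x ≠ 0) (p : ℝ) :
    lap (fun y : EE n => ‖y‖ ^ p) x = p * (p + n - 2) * ‖x‖ ^ (p - 2) := by
  have h0 : 0 < ‖x‖ := norm_pos_iff.2 hx
  have h1 : ∀ i, pd i (pd i (fun y : EE n => ‖y‖ ^ p)) x = p * ((p-2) * ‖x‖ ^ (p-4)) * x i ^ 2 + p * ‖x‖ ^ (p-2) := by
    intro i
    have e : pd i (fun y : EE n => ‖y‖ ^ p) =ᶠ[nhds x] fun y => (p * ‖y‖ ^ (p - 2)) * y i := by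
      filter_upwards [isOpen_ne.mem_nhds hx] with y hy
      exact pd_norm_rpow hy p i
    rw [(pd_congr i e).eq_of_nhds]
    have d1 : DifferentiableAt ℝ (fun y : EE n => ‖y‖ ^ (p-2)) x := (hasFDerivAt_norm_rpow' hx (p-2)).differentiableAt
    rw [pd_mul i (d1.const_mul p) (by fun_prop), pd_const_mul i p d1, pd_norm_rpow hx, pd_coord, if_pos rfl]
    rw [show p - 2 - 2 = p - 4 by ring]; ring
  unfold lap
  simp_rw [h1]
  rw [Finset.sum_add_distrib, ← Finset.mul_sum, ← norm_sq_sum]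
  have : ‖x‖ ^ (p-2) = ‖x‖ ^ (p-4) * ‖x‖ ^ 2 := by
    rw [← Real.rpow_natCast, ← Real.rpow_add h0]; congr 1; push_cast; ring
  simp; rw [this]; ring

lemma PF_harm {P : MvPolynomial (Fin n) ℝ} {k : ℕ} (hP : P.IsHomogeneous k) (hh : plap P = 0) {x : EE n} (hx : x ≠ 0) :
    lap (fun y => evP P y * ‖y‖ ^ ((2:ℝ) - n - 2 * k)) x = 0 := by
  rw [lap_mul (evP_contDiff P).contDiffAt (contDiffAt_norm_rpow hx _), lap_norm_rpow hx]
  have l0 : lap (evP P) x = 0 := by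
    have : ∀ i, pd i (pd i (evP P)) x = evP (MvPolynomial.pderiv i (MvPolynomial.pderiv i P)) x := by
      intro i
      rw [show pd i (evP P) = evP (MvPolynomial.pderiv i P) from funext fun y => pd_evP P i y, pd_evP]
    unfold lap; simp_rw [this]
    have h2 := congrArg (fun Q => evP Q x) hh
    simpa [plap, evP] using h2
  rw [l0]
  have eu := congrArg (fun Q => evP Q x) hP.sum_X_mul_pderiv
  simp only [evP, map_sum, map_mul, MvPolynomial.eval_X, nsmul_eq_mul, map_natCast] at eu
  simp_rw [pd_norm_rpow hx, pd_evP]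
  have : ∑ i, evP (MvPolynomial.pderiv i P) x * (((2:ℝ) - n - 2 * k) * ‖x‖ ^ ((2:ℝ) - n - 2 * k - 2) * x i) =
     ((2:ℝ) - n - 2 * k) * ‖x‖ ^ ((2:ℝ) - n - 2 * k - 2) * (k * evP P x) := by
    unfold evP; rw [← eu, Finset.mul_sum]
    exact Finset.sum_congr rfl fun i _ => by ring
  rw [this]; ring

lemma KF_harm {k : ℕ} (w : Fin k → Fin n) {x : EE n} (hx : x ≠ 0) : lap (KF k w) x = 0 :=
  PF_harm (KP_hom k w) (KP_harm k w) hx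

lemma newt_harm {x : EE n} (hx : x ≠ 0) : lap (fun y : EE n => ‖y‖ ^ ((2:ℝ) - n)) x = 0 := by
  rw [lap_norm_rpow hx]; ring

lemma lap_comp_smul (f : EE n → ℝ) (a : ℝ) (x : EE n) : lap (fun y => f (a • y)) x = a ^ 2 * lap f (a • x) := by
  unfold lap
  rw [Finset.mul_sum]
  refine Finset.sum_congr rfl fun i _ => ?_
  rw [show pd i (fun y => f (a • y)) = fun y => a * pd i f (a • y) from funext fun y => pd_comp_smul f a y i]
  by_cases ha : a = 0
  · subst ha; simp [pd]
  have : pd i (fun y => a * pd i f (a • y)) x = a * pd i (fun y => pd i f (a • y)) x := by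
    by_cases hd : DifferentiableAt ℝ (fun y => pd i f (a • y)) x
    · exact pd_const_mul i a hd
    · have hd' : ¬ DifferentiableAt ℝ (fun y => a * pd i f (a • y)) x := fun h => hd (by
        have := h.const_mul a⁻¹
        refine this.congr_of_eventuallyEq (Eventually.of_forall fun y => ?_)
        field_simp)
      show fderiv ℝ _ x (ee i) = a * fderiv ℝ _ x (ee i)
      rw [fderiv_zero_of_not_differentiableAt hd, fderiv_zero_of_not_differentiableAt hd']; simp
  rw [this, pd_comp_smul]; ring

def TK (K : EE n → ℝ) : Prop := (∀ k : ℕ, ContDiff ℝ k K) ∧ ∀ z, 1 < ‖z‖ → K z = 0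

lemma TK.hs {K : EE n → ℝ} (h : TK K) : HasCompactSupport K :=
  HasCompactSupport.intro (isCompact_closedBall (0 : EE n) 1) fun z hz => h.2 z (by simpa using hz)

lemma zero_pd {K : EE n → ℝ} (h : ∀ z, 1 < ‖z‖ → K z = 0) (i : Fin n) : ∀ z, 1 < ‖z‖ → pd i K z = 0 := by
  intro z hz
  have : K =ᶠ[nhds z] fun _ => 0 := by
    filter_upwards [(isOpen_lt continuous_const continuous_norm).mem_nhds hz] with y hy
    exact h y hy
  rw [(pd_congr i this).eq_of_nhds, pd_const]

lemma TK.pd {K : EE n → ℝ} (h : TK K) (i : Fin n) : TK (pd i K) :=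
  ⟨fun k => pd_contDiff i (h.1 (k+1)), zero_pd h.2 i⟩

lemma TK.lap {K : EE n → ℝ} (h : TK K) : TK (lap K) :=
  ⟨fun k => by unfold _root_.lap; exact ContDiff.sum fun i _ => ((h.pd i).pd i).1 k,
   fun z hz => by unfold _root_.lap; exact Finset.sum_eq_zero fun i _ => ((h.pd i).pd i).2 z hz⟩

theorem exists_kernel (hn : 3 ≤ n) : ∃ ρ Ψ : EE n → ℝ, TK ρ ∧ TK Ψ ∧ ∫ z, ρ z = 1 ∧
    ∀ z, lap Ψ z = 2 ^ n * ρ ((2:ℝ) • z) - ρ z := by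
  have hn3 : (3:ℝ) ≤ n := by exact_mod_cast hn
  have cpos := cN_pos hn
  let η : ContDiffBump (0 : EE n) := ⟨1/4, 1/2, by norm_num, by norm_num⟩
  let θ : ContDiffBump (0 : EE n) := ⟨2, 3, by norm_num, by norm_num⟩
  let U : EE n → ℝ := fun y => ‖y‖ ^ ((2:ℝ) - n) * (1 - η y)
  have Usm : ∀ k : ℕ, ContDiff ℝ k U := by
    intro k
    refine contDiff_iff_contDiffAt.2 fun x => ?_
    by_cases hx : x = 0
    · subst hx
      have : U =ᶠ[nhds 0] fun _ => 0 := by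
        filter_upwards [η.eventuallyEq_one] with y hy
        simp only [U]; rw [hy]; simp
      exact contDiffAt_const.congr_of_eventuallyEq this
    · exact (contDiffAt_norm_rpow hx _).mul (contDiffAt_const.sub η.contDiffAt)
  have Uout : ∀ y, 1/2 ≤ ‖y‖ → U y = ‖y‖ ^ ((2:ℝ) - n) := by
    intro y hy
    simp only [U]; rw [η.zero_of_le_dist (by simpa [η] using hy)]; ring
  have lapU : ∀ y, 1/2 < ‖y‖ → lap U y = 0 := by
    intro y hy
    have : U =ᶠ[nhds y] fun y => ‖y‖ ^ ((2:ℝ) - n) := by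
      filter_upwards [(isOpen_lt continuous_const continuous_norm).mem_nhds hy] with z hz
      exact Uout z (le_of_lt hz)
    rw [lap_congr this, newt_harm (norm_pos_iff.1 (by linarith))]
  have Usm2 : ContDiff ℝ 2 U := Usm 2
  have lapUsm : ∀ k : ℕ, ContDiff ℝ k (lap U) := fun k => contDiff_iff_contDiffAt.2 fun x => lap_contDiffAt (Usm (k+2)).contDiffAt
  refine ⟨fun y => -(cN n)⁻¹ * lap U y, fun y => (cN n)⁻¹ * (U y + (-2 ^ (n-2)) * U ((2:ℝ) • y)), ⟨fun k => ?_, fun z hz => ?_⟩, ⟨fun k => ?_, fun z hz => ?_⟩, ?_, fun z => ?_⟩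
  · exact contDiff_const.mul (lapUsm k)
  · beta_reduce; rw [lapU z (by linarith), mul_zero]
  · exact contDiff_const.mul ((Usm k).add (contDiff_const.mul ((Usm k).comp (contDiff_const_smul _))))
  · beta_reduce
    rw [Uout z (by linarith), Uout _ (by rw [norm_smul]; norm_num; linarith), norm_smul, Real.mul_rpow (by norm_num) (by norm_num)]
    have : ((2:ℝ)) ^ (n-2) * ‖(2:ℝ)‖ ^ ((2:ℝ) - n) = 1 := by
      rw [← Real.rpow_natCast, Nat.cast_sub (by omega)]; norm_num
      rw [← Real.rpow_add two_pos]; norm_num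
    linear_combination -(cN n)⁻¹ * ‖z‖ ^ ((2:ℝ) - n) * this
  · rw [integral_const_mul]
    have e1 : ∫ z, lap U z = ∫ z, lap U z * θ z := by
      congr 1; funext z
      by_cases hz : 1/2 < ‖z‖
      · rw [lapU z hz, zero_mul]
      · rw [θ.one_of_mem_closedBall (by simp [θ]; linarith), mul_one]
    have e2 : ∫ z, lap U z * θ z = ∫ z, U z * lap (fun y => θ y) z := (green Usm2 (θ.contDiff (n := 2)) θ.hasCompactSupport).symm
    have e3 : ∫ z, U z * lap (fun y => θ y) z = ∫ z, ‖z‖ ^ ((2:ℝ) - n) * lap (fun y => θ y) z := by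
      congr 1; funext z
      by_cases hz : 1/2 ≤ ‖z‖
      · rw [Uout z hz]
      · have : (fun y => θ y) =ᶠ[nhds z] fun _ => 1 := by
          filter_upwards [Metric.isOpen_ball.mem_nhds (show z ∈ Metric.ball 0 2 by simp; linarith)] with y hy
          exact θ.one_of_mem_closedBall (Metric.ball_subset_closedBall hy)
        rw [lap_congr this, lap_const]; ring
    rw [e1, e2, e3, fund0 hn θ.contDiff θ.hasCompactSupport, θ.one_of_mem_closedBall (by simp [θ])]
    field_simp
  · have c2 : ∀ x, ContDiffAt ℝ 2 U x := fun x => Usm2.contDiffAt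
    have c3 : ContDiffAt ℝ 2 (fun y => U ((2:ℝ) • y)) z := (Usm2.comp (contDiff_const_smul (2:ℝ))).contDiffAt
    rw [lap_const_mul _ ((c2 z).add (contDiffAt_const.mul c3)), lap_add (c2 z) (contDiffAt_const.mul c3), lap_const_mul _ c3, lap_comp_smul]
    have : (2:ℝ) ^ n = 2 ^ (n-2) * 2 ^ 2 := by rw [← pow_add]; congr 1; omega
    rw [this]; ring

end kern

end partP0


section partP1
open Filter MeasureTheory Set
open scoped Pointwise

section dvs
variable {n : ℕ}

noncomputable def dv (ε : ℝ) (K V : EE n → ℝ) (x : EE n) : ℝ := ∫ z, K z * V (x - ε • z)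

lemma TK.cont {K : EE n → ℝ} (h : TK K) : Continuous K := (h.1 0).continuous
lemma TK.c1 {K : EE n → ℝ} (h : TK K) : ContDiff ℝ 1 K := h.1 1
lemma TK.c2 {K : EE n → ℝ} (h : TK K) : ContDiff ℝ 2 K := h.1 2
lemma TK.int {K : EE n → ℝ} (h : TK K) : Integrable K := h.cont.integrable_of_hasCompactSupport h.hs

lemma cont_shift {V : EE n → ℝ} (hV : Continuous V) (x : EE n) (ε : ℝ) : Continuous fun z : EE n => V (x - ε • z) :=
  hV.comp (by fun_prop)

lemma dv_int {K V : EE n → ℝ} (hK : TK K) (hV : Continuous V) (ε : ℝ) (x : EE n) :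
    Integrable fun z => K z * V (x - ε • z) :=
  (hK.cont.mul (cont_shift hV x ε)).integrable_of_hasCompactSupport hK.hs.mul_right

noncomputable def l1 (K : EE n → ℝ) : ℝ := ∫ z, |K z|

lemma l1_nonneg (K : EE n → ℝ) : 0 ≤ l1 K := integral_nonneg fun _ => abs_nonneg _

lemma dv_bound {K V : EE n → ℝ} (hK : TK K) {ε M : ℝ} (hε : 0 ≤ ε) {x : EE n}
    (hM : ∀ y, ‖y - x‖ ≤ ε → |V y| ≤ M) : |dv ε K V x| ≤ l1 K * M := by
  unfold dv l1
  rw [← integral_mul_const, ← Real.norm_eq_abs]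
  refine norm_integral_le_of_norm_le (hK.int.abs.mul_const M) (Eventually.of_forall fun z => ?_)
  rw [norm_mul, Real.norm_eq_abs, Real.norm_eq_abs]
  by_cases hz : 1 < ‖z‖
  · rw [hK.2 z hz]; simp
  · refine mul_le_mul_of_nonneg_left (hM _ ?_) (abs_nonneg _)
    rw [sub_sub_cancel_left, norm_neg, norm_smul, Real.norm_of_nonneg hε]
    nlinarith [norm_nonneg z]

lemma dv_osc {K V : EE n → ℝ} (hK : TK K) (h0 : ∫ z, K z = 0) (hV : Continuous V) {ε M : ℝ} (hε : 0 ≤ ε) {x : EE n}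
    (hM : ∀ y, ‖y - x‖ ≤ ε → |V y - V x| ≤ M) : |dv ε K V x| ≤ l1 K * M := by
  have : dv ε K V x = dv ε K (fun y => V y - V x) x := by
    unfold dv
    simp_rw [mul_sub]
    rw [integral_sub (dv_int hK hV ε x) (hK.int.mul_const _), integral_mul_const, h0]; ring
  rw [this]
  exact dv_bound hK hε hM

lemma pd_shift (V : EE n → ℝ) (x : EE n) (ε : ℝ) (z : EE n) (i : Fin n) :
    pd i (fun z => V (x - ε • z)) z = -ε * pd i V (x - ε • z) := by
  have := pd_comp_smul (fun w => V (x - w)) ε z i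
  rw [this, pd_comp_sub]; ring

lemma dv_ibp {K V : EE n → ℝ} (hK : TK K) (hV : ContDiff ℝ 1 V) {ε : ℝ} (hε : ε ≠ 0) (x : EE n) (i : Fin n) :
    dv ε (pd i K) V x = ε * dv ε K (pd i V) x := by
  have hs : ContDiff ℝ 1 (fun z : EE n => V (x - ε • z)) := hV.comp (by fun_prop)
  have := ibp hs hK.c1 hK.hs i
  unfold dv
  calc _ = ∫ z, V (x - ε • z) * pd i K z := by congr 1; funext z; ring
    _ = _ := by
      rw [this, ← integral_neg, ← integral_const_mul]
      congr 1; funext z; rw [pd_shift]; ring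

lemma dv_sum {ι : Type*} (s : Finset ι) {K : EE n → ℝ} {V : ι → EE n → ℝ} (hK : TK K) (hV : ∀ i, Continuous (V i)) (ε : ℝ) (x : EE n) :
    dv ε K (fun y => ∑ i ∈ s, V i y) x = ∑ i ∈ s, dv ε K (V i) x := by
  unfold dv
  simp_rw [Finset.mul_sum]
  exact integral_finsetSum _ fun i _ => dv_int hK (hV i) ε x

lemma dv_lap {K V : EE n → ℝ} (hK : TK K) (hV : ContDiff ℝ 2 V) {ε : ℝ} (hε : ε ≠ 0) (x : EE n) :
    dv ε (lap K) V x = ε ^ 2 * dv ε K (lap V) x := by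
  have e1 : dv ε (lap K) V x = ∑ i, dv ε (pd i (pd i K)) V x := by
    unfold dv lap
    simp_rw [Finset.sum_mul]
    exact integral_finsetSum _ fun i _ => dv_int ((hK.pd i).pd i) hV.continuous ε x
  have hc : ∀ i, ContDiff ℝ 1 (pd i V) := fun i => pd_contDiff (k := 1) i hV
  have e2 : dv ε K (lap V) x = ∑ i, dv ε K (pd i (pd i V)) x := dv_sum _ hK (fun i => pd_cont (hc i) i) ε x
  rw [e1, e2, Finset.mul_sum]
  refine Finset.sum_congr rfl fun i _ => ?_
  rw [dv_ibp (hK.pd i) (hV.of_le (by norm_num)) hε, dv_ibp hK (hc i) hε]; ring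

lemma bdd_of_cs {V : EE n → ℝ} (hV : Continuous V) (hs : HasCompactSupport V) : ∃ M, 0 ≤ M ∧ ∀ x, |V x| ≤ M := by
  obtain ⟨M, hM⟩ := hs.exists_bound_of_continuous hV
  exact ⟨M, (norm_nonneg _).trans (hM 0), hM⟩

lemma dv_cont {K V : EE n → ℝ} (hK : TK K) (hV : Continuous V) (hs : HasCompactSupport V) (ε : ℝ) : Continuous (dv ε K V) := by
  obtain ⟨M, hM0, hM⟩ := bdd_of_cs hV hs
  unfold dv
  refine continuous_of_dominated (bound := fun z => |K z| * M) (fun x => (dv_int hK hV ε x).aestronglyMeasurable) (fun x => Eventually.of_forall fun z => ?_) (hK.int.abs.mul_const M) (Eventually.of_forall fun z => ?_)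
  · rw [norm_mul]; exact mul_le_mul_of_nonneg_left (hM _) (norm_nonneg _)
  · exact continuous_const.mul (hV.comp (by fun_prop))

lemma dv_hasFDeriv {K V : EE n → ℝ} (hK : TK K) (hV : ContDiff ℝ 1 V) (hs : HasCompactSupport V) (ε : ℝ) (x : EE n) :
    HasFDerivAt (dv ε K V) (∫ z, K z • fderiv ℝ V (x - ε • z)) x ∧ ∀ i, pd i (dv ε K V) x = dv ε K (pd i V) x := by
  have cf : Continuous (fderiv ℝ V) := hV.continuous_fderiv (by norm_num)
  obtain ⟨M, hM⟩ := (hs.fderiv ℝ).exists_bound_of_continuous cf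
  have ci : ∀ x, Integrable fun z => K z • fderiv ℝ V (x - ε • z) := fun x =>
    (hK.cont.smul (cf.comp (by fun_prop))).integrable_of_hasCompactSupport hK.hs.smul_right
  have h : HasFDerivAt (dv ε K V) (∫ z, K z • fderiv ℝ V (x - ε • z)) x := by
    unfold dv
    refine hasFDerivAt_integral_of_dominated_of_fderiv_le (F' := fun x z => K z • fderiv ℝ V (x - ε • z)) (bound := fun z => |K z| * M) (s := univ) univ_mem
      (Eventually.of_forall fun x => (dv_int hK hV.continuous ε x).aestronglyMeasurable) (dv_int hK hV.continuous ε x)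
      (ci x).aestronglyMeasurable (Eventually.of_forall fun z y _ => ?_) (hK.int.abs.mul_const M) (Eventually.of_forall fun z y _ => ?_)
    · rw [norm_smul]; exact mul_le_mul_of_nonneg_left (hM _) (norm_nonneg _)
    · have := ((hV.differentiable (by norm_num)) (y - ε • z)).hasFDerivAt.comp y ((hasFDerivAt_id y).sub_const (ε • z))
      exact (this.const_mul (K z)).congr_fderiv (by ext; simp)
  refine ⟨h, fun i => ?_⟩
  unfold pd
  rw [h.fderiv, ContinuousLinearMap.integral_apply (ci x)]
  rfl

lemma contDiff_one_of_pd {f : EE n → ℝ} (hd : Differentiable ℝ f) (hc : ∀ i, Continuous (pd i f)) : ContDiff ℝ 1 f := by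
  rw [contDiff_one_iff_fderiv]
  refine ⟨hd, ?_⟩
  have : fderiv ℝ f = fun x => ∑ i, pd i f x • (EuclideanSpace.proj i : EE n →L[ℝ] ℝ) := by
    funext x; ext v
    rw [fderiv_eq_sum_pd]; simp [mul_comm]
  rw [this]
  exact continuous_finsetSum _ fun i _ => (hc i).smul continuous_const

lemma dv_c1 {K V : EE n → ℝ} (hK : TK K) (hV : ContDiff ℝ 1 V) (hs : HasCompactSupport V) (ε : ℝ) : ContDiff ℝ 1 (dv ε K V) := by
  refine contDiff_one_of_pd (fun x => (dv_hasFDeriv hK hV hs ε x).1.differentiableAt) fun i => ?_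
  rw [funext fun x => (dv_hasFDeriv hK hV hs ε x).2 i]
  exact dv_cont hK (pd_cont hV i) (pd_supp hs i) ε

lemma dv_tele {ρ Ψ V : EE n → ℝ} (hρ : TK ρ) (hΨ : ∀ z, lap Ψ z = 2 ^ n * ρ ((2:ℝ) • z) - ρ z)
    (hV : Continuous V) (ε : ℝ) (x : EE n) :
    dv (ε/2) ρ V x - dv ε ρ V x = dv ε (lap Ψ) V x := by
  have e1 : dv (ε/2) ρ V x = ∫ z, 2 ^ n * ρ ((2:ℝ) • z) * V (x - ε • z) := by
    have := Measure.integral_comp_smul (volume : Measure (EE n)) (fun z => ρ z * V (x - (ε/2) • z)) 2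
    rw [finrank_EE, smul_eq_mul, abs_of_pos (by positivity)] at this
    unfold dv
    simp_rw [mul_assoc]
    rw [integral_const_mul]
    have e : ∀ z : EE n, (ε/2) • (2:ℝ) • z = ε • z := fun z => by rw [smul_smul]; congr 1; ring
    simp_rw [e] at this
    rw [this]; field_simp
  have i2 : Integrable fun z : EE n => 2 ^ n * ρ ((2:ℝ) • z) * V (x - ε • z) := by
    have h2 : HasCompactSupport fun z : EE n => ρ ((2:ℝ) • z) := hρ.hs.comp_homeomorph (Homeomorph.smulOfNeZero (2:ℝ) two_ne_zero)
    have : HasCompactSupport fun z : EE n => 2 ^ n * ρ ((2:ℝ) • z) * V (x - ε • z) := (h2.mul_left).mul_right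
    exact ((continuous_const.mul (hρ.cont.comp (by fun_prop))).mul (cont_shift hV x ε)).integrable_of_hasCompactSupport this
  rw [e1]
  unfold dv
  rw [← integral_sub i2 (dv_int hρ hV ε x)]
  congr 1; funext z; rw [hΨ]; ring

lemma dv_lim {ρ V : EE n → ℝ} (hρ : TK ρ) (h1 : ∫ z, ρ z = 1) (hV : Continuous V) (hs : HasCompactSupport V) (x : EE n) :
    Tendsto (fun k : ℕ => dv ((1/2) ^ k) ρ V x) atTop (nhds (V x)) := by
  obtain ⟨M, hM0, hM⟩ := bdd_of_cs hV hs
  have : V x = ∫ z, ρ z * V x := by rw [integral_mul_const, h1, one_mul]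
  rw [this]
  unfold dv
  refine tendsto_integral_of_dominated_convergence (fun z => |ρ z| * M) (fun k => (dv_int hρ hV _ x).aestronglyMeasurable)
    (hρ.int.abs.mul_const M) (fun k => Eventually.of_forall fun z => ?_) (Eventually.of_forall fun z => ?_)
  · rw [norm_mul]; exact mul_le_mul_of_nonneg_left (hM _) (norm_nonneg _)
  · refine Tendsto.const_mul _ ?_
    have h : Tendsto (fun k : ℕ => x - ((1/2:ℝ)^k) • z) atTop (nhds (x - (0:ℝ) • z)) :=
      tendsto_const_nhds.sub ((tendsto_pow_atTop_nhds_zero_of_lt_one (by norm_num) (by norm_num)).smul_const z)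
    rw [zero_smul, sub_zero] at h
    exact (hV.tendsto x).comp h

/-- telescoped representation -/
lemma dv_rep {ρ Ψ V : EE n → ℝ} (hρ : TK ρ) (h1 : ∫ z, ρ z = 1) (hΨ : ∀ z, lap Ψ z = 2 ^ n * ρ ((2:ℝ) • z) - ρ z)
    (hV : Continuous V) (hs : HasCompactSupport V) (x : EE n) :
    Tendsto (fun N : ℕ => dv 1 ρ V x + ∑ k ∈ Finset.range N, dv ((1/2) ^ k) (lap Ψ) V x) atTop (nhds (V x)) := by
  have : ∀ N : ℕ, dv 1 ρ V x + ∑ k ∈ Finset.range N, dv ((1/2) ^ k) (lap Ψ) V x = dv ((1/2) ^ N) ρ V x := by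
    intro N
    induction N with
    | zero => simp
    | succ N ih =>
      rw [Finset.sum_range_succ, ← add_assoc, ih, ← dv_tele hρ hΨ hV, pow_succ, mul_one_div]; ring
  simp_rw [this]
  exact dv_lim hρ h1 hV hs x

end dvs

end partP1


section partP2
open Filter MeasureTheory Set
open scoped Pointwise

section reg
variable {n : ℕ}

lemma pd_sum {ι : Type*} (s : Finset ι) {f : ι → EE n → ℝ} {x : EE n} (i : Fin n) (hf : ∀ a ∈ s, DifferentiableAt ℝ (f a) x) :
    pd i (fun y => ∑ a ∈ s, f a y) x = ∑ a ∈ s, pd i (f a) x := by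
  unfold pd; rw [fderiv_fun_sum hf]; simp

lemma pd_lap_comm {K : EE n → ℝ} {x : EE n} (hK : ContDiffAt ℝ 3 K x) (i : Fin n) : pd i (lap K) x = lap (pd i K) x := by
  have h1 : ∀ j, ContDiffAt ℝ 2 (pd j K) x := fun j => pd_contDiffAt (k := 2) j hK
  have h2 : ∀ j, ContDiffAt ℝ 1 (pd j (pd j K)) x := fun j => pd_contDiffAt (k := 1) j (h1 j)
  unfold lap
  rw [pd_sum _ i fun j _ => (h2 j).differentiableAt (by norm_num)]
  refine Finset.sum_congr rfl fun j _ => ?_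
  rw [pd_comm i j (h1 j)]
  refine (pd_congr j ?_).eq_of_nhds
  have : ∀ᶠ y in nhds x, ContDiffAt ℝ 2 K y := ev_contDiffAt (k := 2) (hK.of_le (by norm_num))
  filter_upwards [this] with y hy
  exact pd_comm i j hy

lemma TK.pd_lap {K : EE n → ℝ} (hK : TK K) (i : Fin n) : _root_.pd i (_root_.lap K) = _root_.lap (_root_.pd i K) :=
  funext fun _ => pd_lap_comm (hK.1 3).contDiffAt i

lemma geo_half (N : ℕ) : ∑ k ∈ Finset.range N, (1/2:ℝ)^k ≤ 2 := by
  have := (summable_geometric_of_lt_one (by norm_num : (0:ℝ) ≤ 1/2) (by norm_num)).sum_le_tsum (Finset.range N) (fun _ _ => by positivity)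
  rw [tsum_geometric_of_lt_one (by norm_num) (by norm_num)] at this
  linarith

lemma hpow (k : ℕ) : (1/2:ℝ)^k ≠ 0 := by positivity
lemma hpow0 (k : ℕ) : 0 < (1/2:ℝ)^k := by positivity
lemma hpow1 (k : ℕ) : (1/2:ℝ)^k ≤ 1 := pow_le_one₀ (by norm_num) (by norm_num)

theorem grad_est0 (hn : 3 ≤ n) : ∃ C, 0 < C ∧ ∀ V : EE n → ℝ, ContDiff ℝ 2 V → HasCompactSupport V → ∀ (x : EE n) (M F : ℝ),
    (∀ y, ‖y - x‖ ≤ 1 → |V y| ≤ M) → (∀ y, ‖y - x‖ ≤ 1 → |lap V y| ≤ F) → ∀ i, |pd i V x| ≤ C * (M + F) := by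
  obtain ⟨ρ, Ψ, hρ, hΨ, h1, hl⟩ := exists_kernel hn
  let Cs := ∑ i, (l1 (pd i ρ) + 2 * l1 (pd i Ψ))
  have hle : ∀ i, l1 (pd i ρ) + 2 * l1 (pd i Ψ) ≤ Cs := fun i =>
    Finset.single_le_sum (f := fun i => l1 (pd i ρ) + 2 * l1 (pd i Ψ)) (fun i _ => by have := l1_nonneg (pd i ρ); have := l1_nonneg (pd i Ψ); positivity) (Finset.mem_univ i)
  have hCs : 0 ≤ Cs := Finset.sum_nonneg fun i _ => by have := l1_nonneg (pd i ρ); have := l1_nonneg (pd i Ψ); positivity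
  refine ⟨Cs + 1, by positivity, fun V hV hs x M F hM hF i => ?_⟩
  have hM0 : 0 ≤ M := (abs_nonneg _).trans (hM x (by simp))
  have hF0 : 0 ≤ F := (abs_nonneg _).trans (hF x (by simp))
  have c1 : ContDiff ℝ 1 V := hV.of_le (by norm_num)
  have L := dv_rep hρ h1 hl (pd_cont c1 i) (pd_supp hs i) x
  refine le_of_tendsto L.abs (Eventually.of_forall fun N => ?_)
  have a1 : |dv 1 ρ (pd i V) x| ≤ l1 (pd i ρ) * M := by
    have := dv_ibp hρ c1 one_ne_zero x i
    rw [one_mul] at this; rw [← this]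
    exact dv_bound (hρ.pd i) zero_le_one hM
  have a2 : ∀ k : ℕ, |dv ((1/2)^k) (lap Ψ) (pd i V) x| ≤ (1/2)^k * (l1 (pd i Ψ) * F) := by
    intro k
    have e1 := dv_ibp hΨ.lap c1 (hpow k) x i
    rw [hΨ.pd_lap, dv_lap (hΨ.pd i) hV (hpow k)] at e1
    have e2 : dv ((1/2)^k) (lap Ψ) (pd i V) x = (1/2)^k * dv ((1/2)^k) (pd i Ψ) (lap V) x := by
      apply mul_left_cancel₀ (hpow k); rw [← e1]; ring
    rw [e2, abs_mul, abs_of_pos (hpow0 k)]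
    exact mul_le_mul_of_nonneg_left (dv_bound (hΨ.pd i) (hpow0 k).le fun y hy => hF y (hy.trans (hpow1 k))) (hpow0 k).le
  calc _ ≤ |dv 1 ρ (pd i V) x| + ∑ k ∈ Finset.range N, |dv ((1/2)^k) (lap Ψ) (pd i V) x| :=
        (abs_add_le _ _).trans (add_le_add le_rfl (Finset.abs_sum_le_sum_abs _ _))
    _ ≤ l1 (pd i ρ) * M + ∑ k ∈ Finset.range N, (1/2)^k * (l1 (pd i Ψ) * F) := add_le_add a1 (Finset.sum_le_sum fun k _ => a2 k)
    _ ≤ l1 (pd i ρ) * M + 2 * (l1 (pd i Ψ) * F) := by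
        rw [← Finset.sum_mul]
        exact add_le_add le_rfl (mul_le_mul_of_nonneg_right (geo_half N) (mul_nonneg (l1_nonneg _) hF0))
    _ ≤ (Cs + 1) * (M + F) := by
        have := hle i; have := l1_nonneg (pd i ρ); have := l1_nonneg (pd i Ψ)
        nlinarith [mul_nonneg (l1_nonneg (pd i ρ)) hF0, mul_nonneg (l1_nonneg (pd i Ψ)) hM0, mul_le_mul_of_nonneg_right (hle i) hM0, mul_le_mul_of_nonneg_right (hle i) hF0]

def Hol (f : EE n → ℝ) : Prop := ∃ C, 0 ≤ C ∧ ∀ x y, |f x - f y| ≤ C * √‖x - y‖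

lemma min_sqrt {a b t s : ℝ} (ha : 0 ≤ a) (ht : 0 ≤ t) (h1 : s ≤ a * b) (h2 : s ≤ a * t) (hb : 0 ≤ b) : s ≤ a * (√b * √t) := by
  rcases le_total b t with h | h
  · refine h1.trans (mul_le_mul_of_nonneg_left ?_ ha)
    calc b = √b * √b := (Real.mul_self_sqrt hb).symm
      _ ≤ √b * √t := by gcongr
  · refine h2.trans (mul_le_mul_of_nonneg_left ?_ ha)
    calc t = √t * √t := (Real.mul_self_sqrt ht).symm
      _ ≤ √b * √t := by gcongr

lemma fderiv_norm_le {f : EE n → ℝ} {x : EE n} {M : ℝ} (hM : 0 ≤ M) (h : ∀ i, |pd i f x| ≤ M) : ‖fderiv ℝ f x‖ ≤ n * M := by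
  refine ContinuousLinearMap.opNorm_le_bound _ (by positivity) fun v => ?_
  rw [fderiv_eq_sum_pd, Real.norm_eq_abs]
  calc _ ≤ ∑ i : Fin n, |v i * pd i f x| := Finset.abs_sum_le_sum_abs _ _
    _ ≤ ∑ i : Fin n, ‖v‖ * M := Finset.sum_le_sum fun i _ => by
        rw [abs_mul]; exact mul_le_mul (PiLp.norm_apply_le v i) (h i) (abs_nonneg _) (norm_nonneg _)
    _ = _ := by simp; ring

lemma lip_of_pd {f : EE n → ℝ} {M : ℝ} (hM : 0 ≤ M) (hd : Differentiable ℝ f) (h : ∀ x i, |pd i f x| ≤ M) (x y : EE n) :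
    |f x - f y| ≤ n * M * ‖x - y‖ := by
  have := Convex.norm_image_sub_le_of_norm_fderiv_le (f := f) (s := univ) (C := n * M) (𝕜 := ℝ) (fun x _ => hd x) (fun x _ => fderiv_norm_le hM (h x)) convex_univ (mem_univ y) (mem_univ x)
  simpa using this

lemma sq_half_summable : Summable fun k : ℕ => √((1/2:ℝ)^k) := by
  have : ∀ k : ℕ, √((1/2:ℝ)^k) = (√(1/2)) ^ k := fun k => by
    rw [Real.sqrt_eq_iff_mul_self_eq (by positivity) (by positivity), ← pow_add, ← two_mul, pow_mul, Real.sq_sqrt (by norm_num)]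
  simp_rw [this]
  refine summable_geometric_of_lt_one (by positivity) ?_
  rw [Real.sqrt_lt' one_pos]; norm_num

lemma lap_supp' {V : EE n → ℝ} (hs : HasCompactSupport V) : HasCompactSupport (lap V) := lap_supp hs

lemma ek_eq {Ψ V : EE n → ℝ} (hΨ : TK Ψ) (hV : ContDiff ℝ 2 V) (hg : ContDiff ℝ 1 (lap V)) (i j : Fin n) (k : ℕ) (x : EE n) :
    dv ((1/2)^k) (lap Ψ) (pd j (pd i V)) x = dv ((1/2)^k) (pd i (pd j Ψ)) (lap V) x := by
  have c1 : ContDiff ℝ 1 V := hV.of_le (by norm_num)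
  have c2 : ContDiff ℝ 1 (pd i V) := pd_contDiff (k := 1) i hV
  have e1 := dv_ibp hΨ.lap c2 (hpow k) x j
  have e2 := dv_ibp (hΨ.lap.pd j) c1 (hpow k) x i
  rw [hΨ.pd_lap, (hΨ.pd j).pd_lap, dv_lap ((hΨ.pd j).pd i) hV (hpow k)] at e2
  rw [hΨ.pd_lap] at e1
  rw [e1] at e2
  have h2 : ((1/2:ℝ)^k)^2 ≠ 0 := pow_ne_zero 2 (hpow k)
  apply mul_left_cancel₀ h2
  rw [e2]; ring

lemma ek_eq' {Ψ V : EE n → ℝ} (hΨ : TK Ψ) (hg : ContDiff ℝ 1 (lap V)) (i j : Fin n) (k : ℕ) (x : EE n) :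
    dv ((1/2)^k) (pd i (pd j Ψ)) (lap V) x = (1/2)^k * dv ((1/2)^k) (pd j Ψ) (pd i (lap V)) x := 
  dv_ibp (hΨ.pd j) hg (hpow k) x i

theorem R1g (hn : 3 ≤ n) {V : EE n → ℝ} (hV : ContDiff ℝ 2 V) (hs : HasCompactSupport V) (hg : ContDiff ℝ 1 (lap V)) (i j : Fin n) :
    Hol (pd j (pd i V)) := by
  obtain ⟨ρ, Ψ, hρ, hΨ, h1, hl⟩ := exists_kernel hn
  have c2 : ContDiff ℝ 1 (pd i V) := pd_contDiff (k := 1) i hV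
  have gs := lap_supp hs
  choose M hM0 hM using fun l => bdd_of_cs (pd_cont hg l) (pd_supp gs l)
  obtain ⟨Mf, hMf0, hMf⟩ := bdd_of_cs (pd_cont c2 j) (pd_supp (pd_supp hs i) j)
  choose M2 hM20 hM2 using fun l => bdd_of_cs (pd_cont c2 l) (pd_supp (pd_supp hs i) l)
  set B := ∑ l, M l with hB
  have hBl : ∀ l, M l ≤ B := fun l => Finset.single_le_sum (fun l _ => hM0 l) (Finset.mem_univ l)
  have hB0 : 0 ≤ B := Finset.sum_nonneg fun l _ => hM0 l
  set B2 := ∑ l, M2 l with hB2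
  have hB2l : ∀ l, M2 l ≤ B2 := fun l => Finset.single_le_sum (fun l _ => hM20 l) (Finset.mem_univ l)
  have hB20 : 0 ≤ B2 := Finset.sum_nonneg fun l _ => hM20 l
  -- a common constant
  set a := 2 * l1 (pd j Ψ) * B + n * (l1 (pd i (pd j Ψ)) * B) with ha
  have p1 := l1_nonneg (pd j Ψ); have p2 := l1_nonneg (pd i (pd j Ψ)); have p3 := l1_nonneg (pd j ρ)
  have ha0 : 0 ≤ a := by positivity
  set S := ∑' k : ℕ, √((1/2:ℝ)^k) with hS
  set a1 := n * (l1 (pd j ρ) * B2) + 2 * (l1 ρ * Mf) with ha1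
  have p4 := l1_nonneg ρ
  have ha10 : 0 ≤ a1 := by positivity
  have hS0 : 0 ≤ S := tsum_nonneg fun _ => by positivity
  refine ⟨a1 + a * S, by positivity, fun x y => ?_⟩
  set t := ‖x - y‖ with ht
  have ht0 : 0 ≤ t := norm_nonneg _
  -- main term
  have main : |dv 1 ρ (pd j (pd i V)) x - dv 1 ρ (pd j (pd i V)) y| ≤ a1 * √t := by
    have b1 : |dv 1 ρ (pd j (pd i V)) x - dv 1 ρ (pd j (pd i V)) y| ≤ a1 * 1 := by
      have u1 := dv_bound hρ zero_le_one (x := x) (V := pd j (pd i V)) fun y _ => hMf y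
      have u2 := dv_bound hρ zero_le_one (x := y) (V := pd j (pd i V)) fun y _ => hMf y
      have := abs_sub (dv 1 ρ (pd j (pd i V)) x) (dv 1 ρ (pd j (pd i V)) y)
      have : 0 ≤ n * (l1 (pd j ρ) * B2) := by positivity
      rw [ha1]; linarith
    have b2 : |dv 1 ρ (pd j (pd i V)) x - dv 1 ρ (pd j (pd i V)) y| ≤ a1 * t := by
      have e : ∀ z, dv 1 ρ (pd j (pd i V)) z = dv 1 (pd j ρ) (pd i V) z := fun z => by
        rw [dv_ibp hρ c2 one_ne_zero z j, one_mul]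
      rw [e, e]
      have := lip_of_pd (f := dv 1 (pd j ρ) (pd i V)) (M := l1 (pd j ρ) * B2) (by positivity)
        ((dv_c1 (hρ.pd j) c2 (pd_supp hs i) 1).differentiable (by norm_num)) (fun z l => by
          rw [(dv_hasFDeriv (hρ.pd j) c2 (pd_supp hs i) 1 z).2 l]
          exact dv_bound (hρ.pd j) zero_le_one fun y _ => (hM2 l y).trans (hB2l l)) x y
      refine this.trans (mul_le_mul_of_nonneg_right ?_ ht0)
      have : 0 ≤ 2 * (l1 ρ * Mf) := by positivity
      rw [ha1]; linarith
    have := min_sqrt ha10 ht0 b1 b2 zero_le_one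
    simpa using this
  have ek : ∀ k : ℕ, |dv ((1/2)^k) (lap Ψ) (pd j (pd i V)) x - dv ((1/2)^k) (lap Ψ) (pd j (pd i V)) y| ≤ a * (√((1/2:ℝ)^k) * √t) := by
    intro k
    rw [ek_eq hΨ hV hg, ek_eq hΨ hV hg]
    refine min_sqrt ha0 ht0 ?_ ?_ (hpow0 k).le
    · rw [ek_eq' hΨ hg, ek_eq' hΨ hg]
      have u1 := dv_bound (hΨ.pd j) (hpow0 k).le (x := x) (V := pd i (lap V)) fun y _ => (hM i y).trans (hBl i)
      have u2 := dv_bound (hΨ.pd j) (hpow0 k).le (x := y) (V := pd i (lap V)) fun y _ => (hM i y).trans (hBl i)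
      rw [← mul_sub, abs_mul, abs_of_pos (hpow0 k), mul_comm]
      refine mul_le_mul_of_nonneg_right ?_ (hpow0 k).le
      have := abs_sub (dv ((1/2)^k) (pd j Ψ) (pd i (lap V)) x) (dv ((1/2)^k) (pd j Ψ) (pd i (lap V)) y)
      have : 0 ≤ n * (l1 (pd i (pd j Ψ)) * B) := by positivity
      rw [ha]; linarith
    · have := lip_of_pd (f := dv ((1/2)^k) (pd i (pd j Ψ)) (lap V)) (M := l1 (pd i (pd j Ψ)) * B) (by positivity)
        ((dv_c1 ((hΨ.pd j).pd i) hg gs _).differentiable (by norm_num)) (fun z l => by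
          rw [(dv_hasFDeriv ((hΨ.pd j).pd i) hg gs _ z).2 l]
          exact dv_bound ((hΨ.pd j).pd i) (hpow0 k).le fun y _ => (hM l y).trans (hBl l)) x y
      refine this.trans (mul_le_mul_of_nonneg_right ?_ ht0)
      have : 0 ≤ 2 * l1 (pd j Ψ) * B := by positivity
      rw [ha]; linarith
  have L := (dv_rep hρ h1 hl (pd_cont c2 j) (pd_supp (pd_supp hs i) j) x).sub
    (dv_rep hρ h1 hl (pd_cont c2 j) (pd_supp (pd_supp hs i) j) y)
  refine le_of_tendsto L.abs (Eventually.of_forall fun N => ?_)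
  rw [add_sub_add_comm, ← Finset.sum_sub_distrib]
  calc _ ≤ a1 * √t + ∑ k ∈ Finset.range N, a * (√((1/2:ℝ)^k) * √t) :=
        (abs_add_le _ _).trans (add_le_add main ((Finset.abs_sum_le_sum_abs _ _).trans (Finset.sum_le_sum fun k _ => ek k)))
    _ = a1 * √t + a * (∑ k ∈ Finset.range N, √((1/2:ℝ)^k)) * √t := by
        rw [← Finset.mul_sum, ← Finset.sum_mul]; ring
    _ ≤ a1 * √t + a * S * √t := by
        have := sq_half_summable.sum_le_tsum (Finset.range N) (fun _ _ => by positivity)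
        gcongr
    _ = _ := by ring

theorem R2g (hn : 3 ≤ n) {V : EE n → ℝ} (hV : ContDiff ℝ 2 V) (hs : HasCompactSupport V) (hg : ContDiff ℝ 1 (lap V))
    (hh : ∀ l, Hol (pd l (lap V))) (i j : Fin n) : ContDiff ℝ 1 (pd j (pd i V)) := by
  obtain ⟨ρ, Ψ, hρ, hΨ, h1, hl⟩ := exists_kernel hn
  have c2 : ContDiff ℝ 1 (pd i V) := pd_contDiff (k := 1) i hV
  have gs := lap_supp hs
  choose H hH0 hH using hh
  set B := ∑ l, H l with hB
  have hBl : ∀ l, H l ≤ B := fun l => Finset.single_le_sum (fun l _ => hH0 l) (Finset.mem_univ l)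
  have hB0 : 0 ≤ B := Finset.sum_nonneg fun l _ => hH0 l
  obtain ⟨M, hM0, hM⟩ := bdd_of_cs (pd_cont hg i) (pd_supp gs i)
  set e : ℕ → EE n → ℝ := fun k => dv ((1/2)^k) (pd i (pd j Ψ)) (lap V) with he
  have TKK := (hΨ.pd j).pd i
  have K0 : ∫ z, pd i (pd j Ψ) z = 0 := by
    have := ibp (f := fun _ : EE n => (1:ℝ)) contDiff_const (hΨ.pd j).c1 (hΨ.pd j).hs i
    simpa [pd_const] using this
  have e0 : ∀ k x, |e k x| ≤ l1 (pd j Ψ) * M * (1/2)^k := fun k x => by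
    simp only [he]; rw [ek_eq' hΨ hg, abs_mul, abs_of_pos (hpow0 k), mul_comm]
    exact mul_le_mul_of_nonneg_right (dv_bound (hΨ.pd j) (hpow0 k).le fun y _ => hM y) (hpow0 k).le
  have e1 : ∀ k x l, |pd l (e k) x| ≤ l1 (pd i (pd j Ψ)) * B * √((1/2)^k) := fun k x l => by
    simp only [he]; rw [(dv_hasFDeriv TKK hg gs _ x).2 l, mul_assoc]
    refine dv_osc TKK K0 (pd_cont hg l) (hpow0 k).le fun y hy => (hH l y x).trans ?_
    exact mul_le_mul (hBl l) (Real.sqrt_le_sqrt hy) (by positivity) hB0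
  have sum0 : Summable fun k : ℕ => l1 (pd j Ψ) * M * (1/2:ℝ)^k := (summable_geometric_of_lt_one (by norm_num) (by norm_num)).mul_left _
  have hrep : pd j (pd i V) = fun x => dv 1 (pd j ρ) (pd i V) x + ∑' k, e k x := by
    funext x
    refine tendsto_nhds_unique (dv_rep hρ h1 hl (pd_cont c2 j) (pd_supp (pd_supp hs i) j) x) ?_
    have e : dv 1 ρ (pd j (pd i V)) x = dv 1 (pd j ρ) (pd i V) x := by
      rw [dv_ibp hρ c2 one_ne_zero x j, one_mul]
    rw [e]
    simp_rw [ek_eq hΨ hV hg]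
    refine tendsto_const_nhds.add ?_
    refine (Summable.hasSum ?_).tendsto_sum_nat
    exact Summable.of_norm_bounded sum0 fun k => e0 k x
  rw [hrep]
  refine (dv_c1 (hρ.pd j) c2 (pd_supp hs i) 1).add ?_
  refine contDiff_tsum (v := fun m k => if m = 0 then l1 (pd j Ψ) * M * (1/2:ℝ)^k else n * (l1 (pd i (pd j Ψ)) * B * √((1/2)^k))) (N := 1) (fun k => dv_c1 TKK hg gs _) (fun m _ => ?_) (fun m k x hm => ?_)
  · by_cases h : m = 0
    · simp only [h, if_true]; exact sum0
    · simp only [h, if_false]; exact (sq_half_summable.mul_left _).mul_left _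
  · have : m = 0 ∨ m = 1 := by
      have : m ≤ 1 := by exact_mod_cast hm
      omega
    have q2 := l1_nonneg (pd i (pd j Ψ))
    rcases this with h | h
    · subst h; rw [norm_iteratedFDeriv_zero]; simpa using e0 k x
    · subst h; rw [norm_iteratedFDeriv_one]
      simpa using fderiv_norm_le (by positivity) (e1 k x)

end reg

end partP2


section partP3
open Filter MeasureTheory Set
open scoped Pointwise

section loc
variable {n : ℕ}

lemma exists_cutoff {p : EE n} {Q : EE n → Prop} (hQ : ∀ᶠ x in nhds p, Q x) :
    ∃ χ : EE n → ℝ, (∀ k : ℕ, ContDiff ℝ k χ) ∧ HasCompactSupport χ ∧ χ =ᶠ[nhds p] (fun _ => 1) ∧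
      ∀ x, χ =ᶠ[nhds x] (fun _ => 0) ∨ Q x := by
  obtain ⟨r, hr, h⟩ := Metric.eventually_nhds_iff_ball.1 hQ
  let b : ContDiffBump p := ⟨r/4, r/2, by positivity, by linarith⟩
  refine ⟨fun x => b x, fun k => b.contDiff, b.hasCompactSupport, b.eventuallyEq_one, fun x => ?_⟩
  by_cases hx : x ∈ Metric.ball p r
  · exact Or.inr (h x hx)
  · left
    rw [Metric.mem_ball, not_lt] at hx
    have : ∀ᶠ y in nhds x, r/2 < dist y p := (isOpen_lt continuous_const (continuous_id.dist continuous_const)).mem_nhds (show r/2 < dist x p by linarith)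
    filter_upwards [this] with y hy
    exact b.zero_of_le_dist hy.le

def HolAt (f : EE n → ℝ) (p : EE n) : Prop :=
  ∃ C, 0 ≤ C ∧ ∃ r, 0 < r ∧ ∀ x ∈ Metric.ball p r, ∀ y ∈ Metric.ball p r, |f x - f y| ≤ C * √‖x - y‖

lemma HolAt.ev {f : EE n → ℝ} {p : EE n} (h : HolAt f p) : ∀ᶠ x in nhds p, HolAt f x := by
  obtain ⟨C, hC, r, hr, h⟩ := h
  filter_upwards [Metric.ball_mem_nhds p (half_pos hr)] with x hx
  have : Metric.ball x (r/2) ⊆ Metric.ball p r := fun y hy => by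
    rw [Metric.mem_ball] at *; linarith [dist_triangle y x p]
  exact ⟨C, hC, r/2, half_pos hr, fun y hy z hz => h y (this hy) z (this hz)⟩

lemma HolAt.congr {f g : EE n → ℝ} {p : EE n} (h : HolAt f p) (e : g =ᶠ[nhds p] f) : HolAt g p := by
  obtain ⟨C, hC, r, hr, h⟩ := h
  obtain ⟨r', hr', h'⟩ := Metric.eventually_nhds_iff_ball.1 e
  refine ⟨C, hC, min r r', lt_min hr hr', fun x hx y hy => ?_⟩
  rw [h' x (Metric.ball_subset_ball (min_le_right _ _) hx), h' y (Metric.ball_subset_ball (min_le_right _ _) hy)]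
  exact h x (Metric.ball_subset_ball (min_le_left _ _) hx) y (Metric.ball_subset_ball (min_le_left _ _) hy)

lemma Hol.at {f : EE n → ℝ} (h : Hol f) (p : EE n) : HolAt f p := by
  obtain ⟨C, hC, h⟩ := h
  exact ⟨C, hC, 1, one_pos, fun x _ y _ => h x y⟩

lemma HolAt.add {f g : EE n → ℝ} {p : EE n} (hf : HolAt f p) (hg : HolAt g p) : HolAt (fun x => f x + g x) p := by
  obtain ⟨C, hC, r, hr, h⟩ := hf
  obtain ⟨C', hC', r', hr', h'⟩ := hg
  refine ⟨C + C', by positivity, min r r', lt_min hr hr', fun x hx y hy => ?_⟩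
  have a := h x (Metric.ball_subset_ball (min_le_left _ _) hx) y (Metric.ball_subset_ball (min_le_left _ _) hy)
  have b := h' x (Metric.ball_subset_ball (min_le_right _ _) hx) y (Metric.ball_subset_ball (min_le_right _ _) hy)
  calc _ = |(f x - f y) + (g x - g y)| := by congr 1; ring
    _ ≤ _ := (abs_add_le _ _).trans (by linarith)

lemma HolAt.const (c : ℝ) (p : EE n) : HolAt (fun _ => c) p := ⟨0, le_rfl, 1, one_pos, by simp⟩

lemma HolAt.sum {ι : Type*} (s : Finset ι) {f : ι → EE n → ℝ} {p : EE n} (hf : ∀ a, HolAt (f a) p) :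
    HolAt (fun x => ∑ a ∈ s, f a x) p := by
  classical
  induction s using Finset.induction_on with
  | empty => simpa using HolAt.const 0 p
  | insert a s ha ih => simp_rw [Finset.sum_insert ha]; exact (hf a).add ih

lemma HolAt.bdd {f : EE n → ℝ} {p : EE n} (hf : HolAt f p) : ∃ M, 0 ≤ M ∧ ∀ᶠ x in nhds p, |f x| ≤ M := by
  obtain ⟨C, hC, r, hr, h⟩ := hf
  refine ⟨|f p| + C * √r, by positivity, ?_⟩
  filter_upwards [Metric.ball_mem_nhds p hr] with x hx
  have := h x hx p (Metric.mem_ball_self hr)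
  have h2 : √‖x - p‖ ≤ √r := Real.sqrt_le_sqrt (by rw [← dist_eq_norm]; exact (Metric.mem_ball.1 hx).le)
  have := abs_sub_abs_le_abs_sub (f x) (f p)
  nlinarith

lemma HolAt.mul {f g : EE n → ℝ} {p : EE n} (hf : HolAt f p) (hg : HolAt g p) : HolAt (fun x => f x * g x) p := by
  obtain ⟨M, hM, h1⟩ := hf.bdd
  obtain ⟨M', hM', h1'⟩ := hg.bdd
  obtain ⟨C, hC, r, hr, h⟩ := hf
  obtain ⟨C', hC', r', hr', h'⟩ := hg
  obtain ⟨s, hs, h2⟩ := Metric.eventually_nhds_iff_ball.1 (h1.and h1')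
  refine ⟨C * M' + M * C', by positivity, min s (min r r'), by positivity, fun x hx y hy => ?_⟩
  have s1 : Metric.ball p (min s (min r r')) ⊆ Metric.ball p s := Metric.ball_subset_ball (min_le_left _ _)
  have s2 : Metric.ball p (min s (min r r')) ⊆ Metric.ball p r := Metric.ball_subset_ball ((min_le_right _ _).trans (min_le_left _ _))
  have s3 : Metric.ball p (min s (min r r')) ⊆ Metric.ball p r' := Metric.ball_subset_ball ((min_le_right _ _).trans (min_le_right _ _))
  have a := h x (s2 hx) y (s2 hy)
  have b := h' x (s3 hx) y (s3 hy)
  have c := (h2 x (s1 hx)).2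
  have d := (h2 y (s1 hy)).1
  calc |f x * g x - f y * g y| = |(f x - f y) * g x + f y * (g x - g y)| := by congr 1; ring
    _ ≤ |f x - f y| * |g x| + |f y| * |g x - g y| := (abs_add_le _ _).trans (by rw [abs_mul, abs_mul])
    _ ≤ (C * √‖x - y‖) * M' + M * (C' * √‖x - y‖) := add_le_add (mul_le_mul a c (abs_nonneg _) (by positivity)) (mul_le_mul d b (abs_nonneg _) hM)
    _ = _ := by ring

lemma HolAt.of_c1 {f : EE n → ℝ} {p : EE n} (hf : ContDiffAt ℝ 1 f p) : HolAt f p := by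
  obtain ⟨K, t, ht, hl⟩ := hf.exists_lipschitzOnWith
  obtain ⟨r, hr, h⟩ := Metric.mem_nhds_iff.1 ht
  refine ⟨2 * K, by positivity, min r 1, by positivity, fun x hx y hy => ?_⟩
  have := hl.dist_le_mul x (h (Metric.ball_subset_ball (min_le_left _ _) hx)) y (h (Metric.ball_subset_ball (min_le_left _ _) hy))
  rw [Real.dist_eq, dist_eq_norm] at this
  refine this.trans ?_
  have h4 : ‖x - y‖ ≤ 4 := by
    have a := Metric.mem_ball.1 (Metric.ball_subset_ball (min_le_right _ _) hx)
    have b := Metric.mem_ball.1 (Metric.ball_subset_ball (min_le_right _ _) hy)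
    rw [← dist_eq_norm]; linarith [dist_triangle_right x y p]
  have h5 : √‖x - y‖ ≤ 2 := by rw [show (2:ℝ) = √4 by rw [show (4:ℝ) = 2^2 by norm_num]; simp]; exact Real.sqrt_le_sqrt h4
  have h6 : ‖x - y‖ ≤ 2 * √‖x - y‖ := by
    calc ‖x - y‖ = √‖x - y‖ * √‖x - y‖ := (Real.mul_self_sqrt (norm_nonneg _)).symm
      _ ≤ _ := mul_le_mul_of_nonneg_right h5 (by positivity)
  calc (K:ℝ) * ‖x - y‖ ≤ K * (2 * √‖x - y‖) := mul_le_mul_of_nonneg_left h6 K.2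
    _ = _ := by ring

lemma Hol_of_at {f : EE n → ℝ} (hc : Continuous f) (hs : HasCompactSupport f) (h : ∀ x, HolAt f x) : Hol f := by
  have key : ∃ C, 0 ≤ C ∧ ∃ δ, 0 < δ ∧ ∀ x ∈ tsupport f, ∀ y, ‖x - y‖ < δ → |f x - f y| ≤ C * √‖x - y‖ := by
    refine IsCompact.induction_on (p := fun s => ∃ C, 0 ≤ C ∧ ∃ δ, 0 < δ ∧ ∀ x ∈ s, ∀ y, ‖x - y‖ < δ → |f x - f y| ≤ C * √‖x - y‖) hs ?_ ?_ ?_ ?_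
    · exact ⟨0, le_rfl, 1, one_pos, by simp⟩
    · rintro s t hst ⟨C, hC, δ, hδ, hh⟩
      exact ⟨C, hC, δ, hδ, fun x hx => hh x (hst hx)⟩
    · rintro s t ⟨C, hC, δ, hδ, hh⟩ ⟨C', hC', δ', hδ', hh'⟩
      refine ⟨C + C', by positivity, min δ δ', by positivity, fun x hx y hy => ?_⟩
      have : 0 ≤ √‖x - y‖ := by positivity
      rcases hx with hx | hx
      · nlinarith [hh x hx y (hy.trans_le (min_le_left _ _)), mul_nonneg hC' this]
      · nlinarith [hh' x hx y (hy.trans_le (min_le_right _ _)), mul_nonneg hC this]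
    · intro x _
      obtain ⟨C, hC, r, hr, hh⟩ := h x
      refine ⟨Metric.ball x (r/2), mem_nhdsWithin_of_mem_nhds (Metric.ball_mem_nhds _ (half_pos hr)), C, hC, r/2, half_pos hr, fun y hy z hz => ?_⟩
      refine hh y (Metric.ball_subset_ball (by linarith) hy) z ?_
      rw [Metric.mem_ball] at *
      rw [← dist_eq_norm, dist_comm] at hz
      linarith [dist_triangle z y x]
  obtain ⟨C, hC, δ, hδ, hh⟩ := key
  obtain ⟨M, hM0, hM⟩ := bdd_of_cs hc hs
  have sym : ∀ x ∈ tsupport f, ∀ y, |f x - f y| ≤ (C + 2 * M / √δ) * √‖x - y‖ := by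
    intro x hx y
    have p0 : 0 < √δ := Real.sqrt_pos.2 hδ
    have p1 : 0 ≤ √‖x - y‖ := by positivity
    rcases lt_or_ge ‖x - y‖ δ with h1 | h1
    · have := hh x hx y h1
      have : 0 ≤ 2 * M / √δ * √‖x - y‖ := by positivity
      linarith
    · have h2 : √δ ≤ √‖x - y‖ := Real.sqrt_le_sqrt h1
      have h3 : 2 * M ≤ 2 * M / √δ * √‖x - y‖ := by
        rw [div_mul_eq_mul_div, le_div_iff₀ p0]; exact mul_le_mul_of_nonneg_left h2 (by positivity)
      have := abs_sub (f x) (f y)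
      have := hM x; have := hM y; have := mul_nonneg hC p1
      linarith
  refine ⟨C + 2 * M / √δ, by positivity, fun x y => ?_⟩
  by_cases hx : x ∈ tsupport f
  · exact sym x hx y
  · by_cases hy : y ∈ tsupport f
    · rw [abs_sub_comm, norm_sub_rev]; exact sym y hy x
    · rw [image_eq_zero_of_notMem_tsupport hx, image_eq_zero_of_notMem_tsupport hy]; simp; positivity

def C1H (f : EE n → ℝ) (p : EE n) : Prop := ContDiffAt ℝ 1 f p ∧ ∀ l, HolAt (pd l f) p

lemma C1H.ev {f : EE n → ℝ} {p : EE n} (h : C1H f p) : ∀ᶠ x in nhds p, C1H f x := by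
  have : ∀ᶠ x in nhds p, ∀ l, HolAt (pd l f) x := eventually_all.2 fun l => (h.2 l).ev
  filter_upwards [this, ev_contDiffAt (k := 1) h.1] with x h1 h2 using ⟨h2, h1⟩

lemma C1H.congr {f g : EE n → ℝ} {p : EE n} (h : C1H f p) (e : g =ᶠ[nhds p] f) : C1H g p :=
  ⟨h.1.congr_of_eventuallyEq e, fun l => (h.2 l).congr (pd_congr l e)⟩

lemma ev_diff1 {f : EE n → ℝ} {x : EE n} (hf : ContDiffAt ℝ 1 f x) : ∀ᶠ y in nhds x, DifferentiableAt ℝ f y := by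
  filter_upwards [ev_contDiffAt (k := 1) hf] with y hy using hy.differentiableAt (by norm_num)

lemma C1H.add {f g : EE n → ℝ} {p : EE n} (hf : C1H f p) (hg : C1H g p) : C1H (fun x => f x + g x) p := by
  refine ⟨hf.1.add hg.1, fun l => ((hf.2 l).add (hg.2 l)).congr ?_⟩
  filter_upwards [ev_diff1 hf.1, ev_diff1 hg.1] with x h1 h2 using pd_add l h1 h2

lemma C1H.mul {f g : EE n → ℝ} {p : EE n} (hf : C1H f p) (hg : C1H g p) : C1H (fun x => f x * g x) p := by
  refine ⟨hf.1.mul hg.1, fun l => (((HolAt.of_c1 hf.1).mul (hg.2 l)).add ((hf.2 l).mul (HolAt.of_c1 hg.1))).congr ?_⟩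
  filter_upwards [ev_diff1 hf.1, ev_diff1 hg.1] with x h1 h2 using pd_mul l h1 h2

lemma C1H.of_c2 {f : EE n → ℝ} {p : EE n} (hf : ContDiffAt ℝ 2 f p) : C1H f p :=
  ⟨hf.of_le (by norm_num), fun l => HolAt.of_c1 (pd_contDiffAt (k := 1) l hf)⟩

lemma C1H.sum {ι : Type*} (s : Finset ι) {f : ι → EE n → ℝ} {p : EE n} (hf : ∀ a, C1H (f a) p) :
    C1H (fun x => ∑ a ∈ s, f a x) p := by
  classical
  induction s using Finset.induction_on with
  | empty => simpa using C1H.of_c2 contDiffAt_const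
  | insert a s ha ih => simp_rw [Finset.sum_insert ha]; exact (hf a).add ih

lemma contDiffAt_succ_of_pd {f : EE n → ℝ} {x : EE n} {k : ℕ} (hd : ∀ᶠ y in nhds x, DifferentiableAt ℝ f y)
    (h : ∀ i, ContDiffAt ℝ k (pd i f) x) : ContDiffAt ℝ (k+1 : ℕ) f x := by
  have : ((k+1:ℕ) : WithTop ℕ∞) = (k : WithTop ℕ∞) + 1 := by push_cast; rfl
  rw [this, contDiffAt_succ_iff_hasFDerivAt]
  refine ⟨fderiv ℝ f, ⟨_, hd, fun y hy => hy.hasFDerivAt⟩, ?_⟩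
  have : fderiv ℝ f = fun x => ∑ i, pd i f x • (EuclideanSpace.proj i : EE n →L[ℝ] ℝ) := by
    funext x; ext v
    rw [fderiv_eq_sum_pd]; simp [mul_comm]
  rw [this]
  exact ContDiffAt.sum fun i _ => (h i).smul contDiffAt_const

lemma lap_cut {χ w : EE n → ℝ} (hχ : ∀ k : ℕ, ContDiff ℝ k χ) {x : EE n} (hw : ContDiffAt ℝ 2 w x) :
    lap (fun y => χ y * w y) =ᶠ[nhds x] fun y => χ y * lap w y + (2 * ∑ i, pd i χ y * pd i w y) + lap χ y * w y := by
  filter_upwards [ev_contDiffAt (k := 2) hw] with y hy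
  exact lap_mul (hχ 2).contDiffAt hy

lemma cut_zero {χ w : EE n → ℝ} {x : EE n} (h : χ =ᶠ[nhds x] fun _ => 0) : (fun y => χ y * w y) =ᶠ[nhds x] fun _ => 0 := by
  filter_upwards [h] with y hy; rw [hy, zero_mul]

lemma lap_zero_ev {f : EE n → ℝ} {x : EE n} (h : f =ᶠ[nhds x] fun _ => 0) : lap f =ᶠ[nhds x] fun _ => 0 := by
  filter_upwards [h.eventuallyEq_nhds] with y hy
  rw [lap_congr hy, lap_const]

lemma cut_c2 {χ w : EE n → ℝ} (hχ : ∀ k : ℕ, ContDiff ℝ k χ) (h : ∀ x, χ =ᶠ[nhds x] (fun _ => 0) ∨ ContDiffAt ℝ 2 w x) :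
    ContDiff ℝ 2 (fun y => χ y * w y) :=
  contDiff_iff_contDiffAt.2 fun x => by
    rcases h x with h | h
    · exact contDiffAt_const.congr_of_eventuallyEq (cut_zero h)
    · exact (hχ 2).contDiffAt.mul h

theorem R1 (hn : 3 ≤ n) {w : EE n → ℝ} {p : EE n} (hw : ContDiffAt ℝ 2 w p) (hh : ContDiffAt ℝ 1 (lap w) p) (i : Fin n) :
    C1H (pd i w) p := by
  obtain ⟨χ, hχ, hχs, hχ1, hQ⟩ := exists_cutoff ((ev_contDiffAt (k := 2) hw).and (ev_contDiffAt (k := 1) hh))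
  have hV : ContDiff ℝ 2 (fun y => χ y * w y) := cut_c2 hχ fun x => (hQ x).imp_right And.left
  have hs : HasCompactSupport (fun y => χ y * w y) := hχs.mul_right
  have hg : ContDiff ℝ 1 (lap (fun y => χ y * w y)) := by
    refine contDiff_iff_contDiffAt.2 fun x => ?_
    rcases hQ x with h | ⟨h1, h2⟩
    · exact contDiffAt_const.congr_of_eventuallyEq (lap_zero_ev (cut_zero h))
    · refine ContDiffAt.congr_of_eventuallyEq ?_ (lap_cut hχ h1)
      refine (((hχ 1).contDiffAt.mul h2).add (contDiffAt_const.mul (ContDiffAt.sum fun i _ => ?_))).add ((lap_contDiffAt (k := 1) (hχ 3).contDiffAt).mul (h1.of_le (by norm_num)))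
      exact (pd_contDiffAt (k := 1) i (hχ 2).contDiffAt).mul (pd_contDiffAt (k := 1) i h1)
  have e : w =ᶠ[nhds p] fun y => χ y * w y := by
    filter_upwards [hχ1] with y hy; rw [hy, one_mul]
  refine ⟨pd_contDiffAt (k := 1) i hw, fun l => ?_⟩
  exact ((R1g hn hV hs hg i l).at p).congr (pd_congr l (pd_congr i e))

theorem R2 (hn : 3 ≤ n) {w : EE n → ℝ} {p : EE n} (hw : ContDiffAt ℝ 2 w p) (hh : C1H (lap w) p) :
    ContDiffAt ℝ 3 w p := by
  obtain ⟨χ, hχ, hχs, hχ1, hQ⟩ := exists_cutoff ((ev_contDiffAt (k := 2) hw).and hh.ev)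
  have hV : ContDiff ℝ 2 (fun y => χ y * w y) := cut_c2 hχ fun x => (hQ x).imp_right And.left
  have hs : HasCompactSupport (fun y => χ y * w y) := hχs.mul_right
  have hg : ∀ x, C1H (lap (fun y => χ y * w y)) x := by
    intro x
    rcases hQ x with h | ⟨h1, h2⟩
    · exact (C1H.of_c2 contDiffAt_const).congr (lap_zero_ev (cut_zero h))
    · refine C1H.congr ?_ (lap_cut hχ h1)
      refine (((C1H.of_c2 (hχ 2).contDiffAt).mul h2).add ((C1H.of_c2 contDiffAt_const).mul (C1H.sum _ fun i => ?_))).add ((C1H.of_c2 (lap_contDiffAt (k := 2) (hχ 4).contDiffAt)).mul (C1H.of_c2 h1))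
      exact (C1H.of_c2 (pd_contDiffAt (k := 2) i (hχ 3).contDiffAt)).mul (R1 hn h1 h2.1 i)
  have hg1 : ContDiff ℝ 1 (lap (fun y => χ y * w y)) := contDiff_iff_contDiffAt.2 fun x => (hg x).1
  have e : w =ᶠ[nhds p] fun y => χ y * w y := by
    filter_upwards [hχ1] with y hy; rw [hy, one_mul]
  have hl : ∀ l, Hol (pd l (lap (fun y => χ y * w y))) := fun l =>
    Hol_of_at (pd_cont hg1 l) (pd_supp (lap_supp hs) l) fun x => (hg x).2 l
  refine contDiffAt_succ_of_pd (k := 2) (ev_diff hw) fun i => ?_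
  refine contDiffAt_succ_of_pd (k := 1) (ev_diff1 (pd_contDiffAt (k := 1) i hw)) fun j => ?_
  exact (R2g hn hV hs hg1 hl i j).contDiffAt.congr_of_eventuallyEq (pd_congr j (pd_congr i e))

theorem grad_est (hn : 3 ≤ n) : ∃ C, 0 < C ∧ ∀ (w : EE n → ℝ) (x : EE n) (d M F : ℝ), 0 < d →
    (∀ y, ‖y - x‖ ≤ d → ContDiffAt ℝ 2 w y) → (∀ y, ‖y - x‖ ≤ d → |w y| ≤ M) → (∀ y, ‖y - x‖ ≤ d → |lap w y| ≤ F) →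
    ∀ i, |pd i w x| ≤ C * (M / d + d * F) := by
  obtain ⟨C, hC, h⟩ := grad_est0 hn
  refine ⟨2 * C, by positivity, fun w x d M F hd hw hM hF i => ?_⟩
  let b : ContDiffBump (0 : EE n) := ⟨3/2, 2, by norm_num, by norm_num⟩
  let W : EE n → ℝ := fun y => w (x + (d/2) • y)
  have hWn : ∀ y : EE n, ‖y‖ ≤ 2 → ‖x + (d/2) • y - x‖ ≤ d := fun y hy => by
    rw [add_sub_cancel_left, norm_smul, Real.norm_of_nonneg (by positivity)]; nlinarith
  have hW : ∀ y : EE n, ‖y‖ ≤ 2 → ContDiffAt ℝ 2 W y := fun y hy =>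
    (hw _ (hWn y hy)).comp y (by fun_prop)
  have bsm : ∀ k : ℕ, ContDiff ℝ k (fun y => b y) := fun k => b.contDiff
  have hV : ContDiff ℝ 2 (fun y => b y * W y) := by
    refine cut_c2 bsm fun y => ?_
    by_cases hy : ‖y‖ ≤ 2
    · exact Or.inr (hW y hy)
    · left
      filter_upwards [(isOpen_lt continuous_const continuous_norm).mem_nhds (not_le.1 hy)] with z hz
      exact b.zero_of_le_dist (by simpa using le_of_lt hz)
  have e : ∀ y : EE n, ‖y‖ ≤ 1 → (fun y => b y * W y) =ᶠ[nhds y] W := fun y hy => by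
    filter_upwards [Metric.isOpen_ball.mem_nhds (show y ∈ Metric.ball 0 (3/2) by simp; linarith)] with z hz
    rw [b.one_of_mem_closedBall (Metric.ball_subset_closedBall hz), one_mul]
  have pdW : ∀ (g : EE n → ℝ) (y : EE n) (i : Fin n), pd i (fun y => g (x + (d/2) • y)) y = d/2 * pd i g (x + (d/2) • y) := fun g y i => by
    rw [pd_comp_smul (fun z => g (x + z))]
    congr 1; unfold pd; rw [fderiv_comp_add_left]
  have lapW : ∀ y, lap W y = (d/2)^2 * lap w (x + (d/2) • y) := fun y => by
    refine (lap_comp_smul (fun z => w (x + z)) (d/2) y).trans ?_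
    congr 1; unfold lap
    refine Finset.sum_congr rfl fun i _ => ?_
    have : pd i (fun z => w (x + z)) = fun z => pd i w (x + z) := by
      funext z; unfold pd; rw [fderiv_comp_add_left]
    rw [this]
    show fderiv ℝ (fun z => pd i w (x + z)) _ _ = fderiv ℝ (pd i w) _ _
    rw [fderiv_comp_add_left]
  have := h (fun y => b y * W y) hV b.hasCompactSupport.mul_right 0 M ((d/2)^2 * F) (fun y hy => by
      rw [sub_zero] at hy
      rw [(e y hy).eq_of_nhds]; exact hM _ (hWn y (by linarith)))
    (fun y hy => by
      rw [sub_zero] at hy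
      rw [lap_congr (e y hy), lapW, abs_mul, abs_of_nonneg (by positivity)]
      exact mul_le_mul_of_nonneg_left (hF _ (hWn y (by linarith))) (by positivity)) i
  rw [(pd_congr i (e 0 (by simp))).eq_of_nhds, pdW, smul_zero, add_zero, abs_mul, abs_of_pos (half_pos hd)] at this
  have hM0 : 0 ≤ M := (abs_nonneg _).trans (hM x (by simp; exact hd.le))
  have hF0 : 0 ≤ F := (abs_nonneg _).trans (hF x (by simp; exact hd.le))
  have h3 : |pd i w x| ≤ C * (M + (d/2)^2 * F) / (d/2) := by
    rw [le_div_iff₀ (by positivity)]; linarith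
  refine h3.trans ?_
  rw [div_le_iff₀ (by positivity)]
  have : 2 * C * (M / d + d * F) * (d/2) = C * (M + d^2 * F) := by field_simp
  rw [this]
  have : (d/2)^2 * F ≤ d^2 * F := mul_le_mul_of_nonneg_right (by nlinarith) hF0
  nlinarith

end loc

end partP3


section partQ0
open Filter MeasureTheory Set
open scoped Pointwise

section regsys
variable {n : ℕ}

noncomputable def jc {ι : Type} (v : ι → EE n → ℝ) (q : Option (Fin n) × ι) : EE n → ℝ :=
  q.1.elim (v q.2) (fun i => pd i (v q.2))

lemma pd_comp_pi {κ : Type} [Fintype κ] [DecidableEq κ] {J : κ → EE n → ℝ} {G : (κ → ℝ) → ℝ} {x : EE n}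
    (hG : DifferentiableAt ℝ G (fun q => J q x)) (hJ : ∀ q, DifferentiableAt ℝ (J q) x) (l : Fin n) :
    pd l (fun y => G (fun q => J q y)) x = ∑ q, fderiv ℝ G (fun q => J q x) (Pi.single q 1) * pd l (J q) x := by
  have h1 : HasFDerivAt (fun y => (fun q => J q y)) (ContinuousLinearMap.pi fun q => fderiv ℝ (J q) x) x :=
    hasFDerivAt_pi.2 fun q => (hJ q).hasFDerivAt
  have h2 := hG.hasFDerivAt.comp x h1
  show fderiv ℝ (G ∘ fun y => (fun q => J q y)) x (ee l) = _
  rw [h2.fderiv]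
  simp only [ContinuousLinearMap.comp_apply]
  have : (ContinuousLinearMap.pi fun q => fderiv ℝ (J q) x) (ee l) = ∑ q, (pd l (J q) x) • (Pi.single q (1:ℝ) : κ → ℝ) := by
    funext q
    simp [Finset.sum_apply, Pi.single_apply, pd]
  rw [this, map_sum]
  refine Finset.sum_congr rfl fun q _ => ?_
  rw [map_smul, smul_eq_mul, mul_comm]

theorem reg_system (hn : 3 ≤ n) (k : ℕ) : ∀ (ι : Type) [Fintype ι] (v : ι → EE n → ℝ)
    (G : ι → (Option (Fin n) × ι → ℝ) → ℝ) (p : EE n), (∀ a, ContDiffAt ℝ 2 (v a) p) →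
    (∀ a, ∀ᶠ x in nhds p, lap (v a) x = G a (fun q => jc v q x)) →
    (∀ a, ContDiffAt ℝ (k+1:ℕ) (G a) (fun q => jc v q p)) → ∀ a, ContDiffAt ℝ (k+2:ℕ) (v a) p := by
  induction k with
  | zero => intro ι _ v G p hv _ _ a; exact_mod_cast hv a
  | succ k ih =>
    intro ι _ v G p hv hl hG
    classical
    have J1 : ∀ q, ContDiffAt ℝ (1:ℕ) (jc v q) p := by
      rintro ⟨_ | i, a⟩
      · exact (hv a).of_le (by norm_num)
      · exact pd_contDiffAt i (by exact_mod_cast hv a)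
    have Jp : ContDiffAt ℝ (1:ℕ) (fun x => (fun q => jc v q x)) p := contDiffAt_pi.2 J1
    have G2 : ∀ a, ContDiffAt ℝ (1+1:ℕ) (G a) (fun q => jc v q p) := fun a => (hG a).of_le (by exact_mod_cast (by omega))
    have L1 : ∀ a, ContDiffAt ℝ (1:ℕ) (lap (v a)) p := fun a =>
      (((G2 a).of_le (by norm_num)).comp p Jp).congr_of_eventuallyEq (hl a)
    have JH : ∀ q, C1H (jc v q) p := by
      rintro ⟨_ | i, a⟩
      · exact C1H.of_c2 (hv a)
      · exact R1 hn (hv a) (by exact_mod_cast L1 a) i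
    have dG : ∀ a q, ContDiffAt ℝ (1:ℕ) (fun x => fderiv ℝ (G a) (fun q => jc v q x) (Pi.single q 1)) p := fun a q =>
      (((G2 a).fderiv_right (m := (1:ℕ)) (by norm_num)).comp p Jp).clm_apply contDiffAt_const
    have dJe : ∀ᶠ x in nhds p, ∀ q, DifferentiableAt ℝ (jc v q) x :=
      eventually_all.2 fun q => ev_diff1 (by exact_mod_cast J1 q)
    have dGe : ∀ a, ∀ᶠ x in nhds p, DifferentiableAt ℝ (G a) (fun q => jc v q x) := fun a => by
      refine Jp.continuousAt.eventually ?_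
      filter_upwards [(G2 a).eventually (by simp)] with y hy
      exact hy.differentiableAt (by norm_num)
    have pdl : ∀ a l, pd l (lap (v a)) =ᶠ[nhds p] fun x => ∑ q, fderiv ℝ (G a) (fun q => jc v q x) (Pi.single q 1) * pd l (jc v q) x := by
      intro a l
      filter_upwards [dJe, dGe a, (hl a).eventually_nhds] with x h1 h2 h3
      rw [(pd_congr l h3).eq_of_nhds, pd_comp_pi h2 h1]
    have LH : ∀ a, C1H (lap (v a)) p := fun a => by
      refine ⟨by exact_mod_cast L1 a, fun l => HolAt.congr ?_ (pdl a l)⟩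
      exact HolAt.sum _ fun q => (HolAt.of_c1 (by exact_mod_cast dG a q)).mul ((JH q).2 l)
    have v3 : ∀ a, ContDiffAt ℝ (2+1:ℕ) (v a) p := fun a => by exact_mod_cast R2 hn (hv a) (LH a)
    have J2 : ∀ q, ContDiffAt ℝ (2:ℕ) (jc v q) p := by
      rintro ⟨_ | i, a⟩
      · exact_mod_cast hv a
      · exact pd_contDiffAt i (v3 a)
    have key := ih (Option (Fin n) × ι) (jc v) (fun q Y => match q with
        | (none, a) => G a (fun q' => Y (none, q'))
        | (some l, a) => ∑ q', fderiv ℝ (G a) (fun q'' => Y (none, q'')) (Pi.single q' 1) * Y (some l, q')) p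
      (fun q => by exact_mod_cast J2 q) ?_ ?_
    · intro a
      have : ContDiffAt ℝ ((k+2)+1:ℕ) (v a) p := by
        refine contDiffAt_succ_of_pd (ev_diff (hv a)) fun i => key (some i, a)
      exact this
    · rintro ⟨_ | l, a⟩
      · exact hl a
      · filter_upwards [pdl a l, (v3 a).eventually (by simp)] with x h1 h2
        show lap (pd l (v a)) x = _
        rw [← pd_lap_comm (by exact_mod_cast h2), h1]
        rfl
    · have P : ∀ c : Option (Fin n), ContDiffAt ℝ (k+1:ℕ) (fun Y : Option (Fin n) × (Option (Fin n) × ι) → ℝ => (fun q' => Y (c, q'))) (fun q => jc (jc v) q p) :=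
        fun c => by fun_prop
      rintro ⟨_ | l, a⟩
      · exact ((hG a).of_le (by exact_mod_cast (by omega))).comp _ (P none)
      · refine ContDiffAt.sum fun q' _ => ContDiffAt.mul ?_ (by fun_prop)
        exact (((hG a).fderiv_right (m := (k+1:ℕ)) (by norm_num)).comp (fun q => jc (jc v) q p) (P none)).clm_apply contDiffAt_const

end regsys

end partQ0


section partG0
open Filter MeasureTheory Set
open scoped Pointwise

section legendre
variable {n : ℕ}

noncomputable def HM (v : EE n → ℝ) (x : EE n) : Matrix (Fin n) (Fin n) ℝ :=
  Matrix.of fun i j => pd j (pd i v) x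

lemma contDiffAt_eucl {E : Type*} [NormedAddCommGroup E] [NormedSpace ℝ E] {k : WithTop ℕ∞} {T : E → EE n} {x : E}
    (h : ∀ i, ContDiffAt ℝ k (fun y => T y i) x) : ContDiffAt ℝ k T x := contDiffAt_euclidean.2 h

lemma pd_comp_vec {g : EE n → ℝ} {ψ : EE n → EE n} {p : EE n} (hg : DifferentiableAt ℝ g (ψ p))
    (hψ : DifferentiableAt ℝ ψ p) (j : Fin n) :
    pd j (fun y => g (ψ y)) p = ∑ i, pd j (fun y => ψ y i) p * pd i g (ψ p) := by
  show fderiv ℝ (g ∘ ψ) p (ee j) = _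
  rw [fderiv_comp p hg hψ, ContinuousLinearMap.comp_apply, fderiv_eq_sum_pd]
  refine Finset.sum_congr rfl fun i _ => ?_
  congr 1
  have : HasFDerivAt (fun y => ψ y i) ((EuclideanSpace.proj i : EE n →L[ℝ] ℝ).comp (fderiv ℝ ψ p)) p :=
    (EuclideanSpace.proj i : EE n →L[ℝ] ℝ).hasFDerivAt.comp p hψ.hasFDerivAt
  unfold pd; rw [this.fderiv]; rfl

theorem legendre_reg (hn : 3 ≤ n) (k : ℕ) {v g : EE n → ℝ} {x₀ : EE n} (hv : ContDiff ℝ 2 v)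
    (hdet : (HM v x₀).det ≠ 0) (hg : ContDiffAt ℝ (k+1:ℕ) g x₀)
    (heq : ∀ᶠ x in nhds x₀, ((HM v x)⁻¹).trace = g x) : ContDiffAt ℝ (k+2:ℕ) v x₀ := by
  classical
  set T : EE n → EE n := fun x => WithLp.toLp 2 fun i => pd i v x with hT
  have hpd : ∀ i, ContDiff ℝ (1:ℕ) (pd i v) := fun i => pd_contDiff i (by exact_mod_cast hv)
  have T1 : ContDiff ℝ (1:ℕ) T := contDiff_euclidean.2 hpd
  have Td : ∀ x w i, (fderiv ℝ T x w) i = (HM v x).mulVec (fun j => w j) i := fun x w i => by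
    have h0 : HasFDerivAt (pd i v) ((EuclideanSpace.proj i : EE n →L[ℝ] ℝ).comp (fderiv ℝ T x)) x :=
      (EuclideanSpace.proj i : EE n →L[ℝ] ℝ).hasFDerivAt.comp x (T1.differentiable (by norm_num) x).hasFDerivAt
    have : (fderiv ℝ T x w) i = fderiv ℝ (pd i v) x w := by rw [h0.fderiv]; rfl
    rw [this, fderiv_eq_sum_pd]
    simp [Matrix.mulVec, dotProduct, HM, mul_comm]
  have inj : Function.Injective (fderiv ℝ T x₀ : EE n →ₗ[ℝ] EE n) := by
    rw [← LinearMap.ker_eq_bot, LinearMap.ker_eq_bot']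
    intro w hw
    have h1 : (HM v x₀).mulVec (fun j => w j) = 0 := by
      funext i; rw [← Td]; rw [show fderiv ℝ T x₀ w = 0 from hw]; rfl
    have := Matrix.eq_zero_of_mulVec_eq_zero hdet h1
    ext j; exact congrFun this j
  set L : EE n ≃L[ℝ] EE n := (LinearEquiv.ofInjectiveEndo _ inj).toContinuousLinearEquiv with hL
  have hLd : HasFDerivAt T (L : EE n →L[ℝ] EE n) x₀ := by
    have h0 := (T1.differentiable (by norm_num) x₀).hasFDerivAt
    have e : (L : EE n →L[ℝ] EE n) = fderiv ℝ T x₀ := by ext w i; rfl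
    rw [e]; exact h0
  have hT1 : ContDiffAt ℝ (1:ℕ) T x₀ := T1.contDiffAt
  set h := hT1.toOpenPartialHomeomorph T hLd (by norm_num) with hh
  have hhT : ∀ x, h x = T x := fun x => rfl
  have hx0 : x₀ ∈ h.source := hT1.mem_toOpenPartialHomeomorph_source hLd (by norm_num)
  set ψ : EE n → EE n := ⇑h.symm with hψ
  set p₀ := T x₀ with hp0
  have hpt : p₀ ∈ h.target := hT1.image_mem_toOpenPartialHomeomorph_target hLd (by norm_num)
  have ψ0 : ψ p₀ = x₀ := h.left_inv hx0
  have ψ1 : ContDiffAt ℝ (1:ℕ) ψ p₀ := h.contDiffAt_symm hpt (f₀' := L) (by rw [← hψ, ψ0]; exact hLd) T1.contDiffAt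
  have Tψ : ∀ᶠ p in nhds p₀, T (ψ p) = p := h.eventually_right_inverse hpt
  have ψd : ∀ᶠ p in nhds p₀, DifferentiableAt ℝ ψ p := by
    filter_upwards [ψ1.eventually (by simp)] with y hy using hy.differentiableAt (by norm_num)
  have ψi1 : ∀ i, ContDiffAt ℝ (1:ℕ) (fun p => ψ p i) p₀ := fun i => contDiffAt_euclidean.1 ψ1 i
  have ψid : ∀ᶠ p in nhds p₀, ∀ i, DifferentiableAt ℝ (fun p => ψ p i) p := by
    filter_upwards [ψd] with p hp i using (EuclideanSpace.proj i : EE n →L[ℝ] ℝ).differentiableAt.comp p hp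
  set w : EE n → ℝ := fun p => (∑ i, p i * ψ p i) - v (ψ p) with hw
  have vd : Differentiable ℝ v := hv.differentiable (by norm_num)
  have wd : ∀ᶠ p in nhds p₀, DifferentiableAt ℝ w p := by
    filter_upwards [ψd, ψid] with p h1 h2
    exact (DifferentiableAt.fun_sum fun i _ => (by fun_prop : DifferentiableAt ℝ (fun p : EE n => p i) p).mul (h2 i)).sub ((vd _).comp p h1)
  have wpd : ∀ j, pd j w =ᶠ[nhds p₀] fun p => ψ p j := fun j => by
    filter_upwards [ψd, ψid, Tψ] with p h1 h2 h3
    have e1 : pd j w p = pd j (fun p => ∑ i, p i * ψ p i) p - pd j (fun p => v (ψ p)) p := by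
      have q1 : DifferentiableAt ℝ (fun p : EE n => ∑ i, p i * ψ p i) p := DifferentiableAt.fun_sum fun i _ => (by fun_prop : DifferentiableAt ℝ (fun p : EE n => p i) p).mul (h2 i)
      have q2 : DifferentiableAt ℝ (fun p : EE n => v (ψ p)) p := (vd _).comp p h1
      unfold pd; rw [hw, fderiv_fun_sub q1 q2]; rfl
    rw [e1, pd_sum, pd_comp_vec (vd _) h1]
    · have e2 : ∀ i, pd j (fun p : EE n => p i * ψ p i) p = p i * pd j (fun p => ψ p i) p + (if i = j then ψ p i else 0) := fun i => by
        rw [pd_mul j (by fun_prop) (h2 i), pd_coord]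
        by_cases hij : i = j
        · subst hij; simp
        · simp [hij, Ne.symm hij]
      have e3 : ∀ i, pd i v (ψ p) = p i := fun i => congrArg (fun q : EE n => q i) h3
      simp_rw [e2, e3]
      rw [Finset.sum_add_distrib]
      simp [mul_comm]
    · intro i _; exact (by fun_prop : DifferentiableAt ℝ (fun p : EE n => p i) p).mul (h2 i)
  have w2 : ContDiffAt ℝ (1+1:ℕ) w p₀ := contDiffAt_succ_of_pd wd fun i => (ψi1 i).congr_of_eventuallyEq (wpd i)
  have wlap : ∀ᶠ p in nhds p₀, lap w p = g (ψ p) := by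
    have e0 := ψ1.continuousAt
    rw [ContinuousAt, ψ0] at e0
    filter_upwards [ψd, ψid, Tψ.eventually_nhds, eventually_all.2 fun j => (wpd j).eventually_nhds, e0.eventually heq] with p h1 h2 h3 h4 h5
    have M1 : HM v (ψ p) * (Matrix.of fun a j => pd j (fun p => ψ p a) p) = 1 := by
      ext i j
      rw [Matrix.mul_apply]
      have := pd_comp_vec (g := pd i v) ((hpd i).differentiable (by norm_num) _) h1 j
      have e5 : (fun y => pd i v (ψ y)) =ᶠ[nhds p] fun y => y i := by
        filter_upwards [h3] with y hy using congrArg (fun q : EE n => q i) hy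
      rw [(pd_congr j e5).eq_of_nhds, pd_coord] at this
      simp only [HM, Matrix.of_apply]
      rw [Matrix.one_apply]
      simp_rw [mul_comm (pd _ (pd i v) _)]
      rw [← this]
      simp [eq_comm]
    rw [← h5, Matrix.inv_eq_right_inv M1]
    unfold lap
    simp only [Matrix.trace, Matrix.diag, Matrix.of_apply]
    exact Finset.sum_congr rfl fun j _ => (pd_congr j (h4 j)).eq_of_nhds
  have wreg : ContDiffAt ℝ (k+2:ℕ) w p₀ := by
    refine reg_system hn k Unit (fun _ => w) (fun _ Y => g (WithLp.toLp 2 fun i => Y (some i, ()))) p₀ (fun _ => by exact_mod_cast w2) (fun _ => ?_) (fun _ => ?_) ()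
    · filter_upwards [wlap, eventually_all.2 wpd] with p h1 h2
      rw [h1]; congr 1; ext i; exact (h2 i).symm
    · have e : (WithLp.toLp 2 fun i => jc (fun _ : Unit => w) (some i, ()) p₀ : EE n) = x₀ := by
        rw [← ψ0]; ext i; exact (wpd i).eq_of_nhds
      refine ContDiffAt.comp (g := g) (f := fun Y : Option (Fin n) × Unit → ℝ => (WithLp.toLp 2 fun i => Y (some i, ()) : EE n)) _ (by rw [e]; exact hg) ?_
      exact contDiffAt_euclidean.2 fun i => by simp only; fun_prop
  have ψk : ContDiffAt ℝ (k+1:ℕ) ψ p₀ := contDiffAt_euclidean.2 fun i =>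
    (pd_contDiffAt i wreg).congr_of_eventuallyEq (wpd i).symm
  have ψD : HasFDerivAt ψ (L.symm : EE n →L[ℝ] EE n) p₀ := h.hasFDerivAt_symm hpt (by rw [← hψ, ψ0]; exact hLd)
  have Tk : ContDiffAt ℝ (k+1:ℕ) T x₀ := h.symm.contDiffAt_symm (f₀' := L.symm) (by simpa using hx0) ψD ψk
  exact contDiffAt_succ_of_pd (k := k+1) (Eventually.of_forall vd) fun i => contDiffAt_euclidean.1 Tk i

end legendre

end partG0


section partH0
open Filter MeasureTheory Set
open scoped Pointwise

section oclass
variable {n : ℕ}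
open Asymptotics

noncomputable def LI (n : ℕ) : Filter (EE n) := comap norm atTop

lemma ev_LI {P : EE n → Prop} : (∀ᶠ x in LI n, P x) ↔ ∃ R, ∀ x, R ≤ ‖x‖ → P x := by
  unfold LI
  rw [(atTop_basis.comap norm).eventually_iff]
  simp

lemma ev_gt (R : ℝ) : ∀ᶠ x in LI n, R < ‖x‖ := ev_LI.2 ⟨R + 1, fun x hx => by linarith⟩

lemma ev_nh {P : EE n → Prop} (h : ∀ᶠ x in LI n, P x) : ∀ᶠ x in LI n, ∀ᶠ y in nhds x, P y := by
  obtain ⟨R, hR⟩ := ev_LI.1 h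
  filter_upwards [ev_gt R] with x hx
  filter_upwards [(isOpen_lt continuous_const continuous_norm).mem_nhds hx] with y hy using hR y (le_of_lt hy)

noncomputable def wt (s : ℝ) (e : ℕ) (x : EE n) : ℝ := ‖x‖ ^ (-s) * Real.log ‖x‖ ^ e

lemma wt_nonneg (s : ℝ) (e : ℕ) {x : EE n} (hx : 1 ≤ ‖x‖) : 0 ≤ wt s e x :=
  mul_nonneg (by positivity) (pow_nonneg (Real.log_nonneg hx) _)

lemma wt_cmp (s : ℝ) (e : ℕ) {q : ℝ} (hq : 1 ≤ q) : ∀ x y : EE n, q ≤ ‖x‖ → 1 ≤ ‖x‖ → 1 ≤ ‖y‖ →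
    ‖x‖ ≤ q * ‖y‖ → ‖y‖ ≤ q * ‖x‖ → wt s e y ≤ (q ^ |s| * 2 ^ e) * wt s e x := by
  intro x y h1 h2 h3 h4 h5
  have q0 : 0 < q := by linarith
  have x0 : 0 < ‖x‖ := by linarith
  have y0 : 0 < ‖y‖ := by linarith
  have a1 : ‖y‖ ^ (-s) ≤ q ^ |s| * ‖x‖ ^ (-s) := by
    rcases le_total 0 s with hs | hs
    · rw [abs_of_nonneg hs, Real.rpow_neg y0.le, Real.rpow_neg x0.le, ← div_eq_mul_inv, inv_eq_one_div, div_le_div_iff₀ (by positivity) (by positivity), one_mul, ← Real.mul_rpow q0.le y0.le]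
      exact Real.rpow_le_rpow x0.le h4 hs
    · rw [abs_of_nonpos hs, ← Real.mul_rpow q0.le x0.le]
      exact Real.rpow_le_rpow y0.le h5 (by linarith)
  have a2 : Real.log ‖y‖ ≤ 2 * Real.log ‖x‖ := by
    have := Real.log_le_log y0 h5
    rw [Real.log_mul q0.ne' x0.ne'] at this
    have := Real.log_le_log q0 h1
    linarith
  have a3 : Real.log ‖y‖ ^ e ≤ 2 ^ e * Real.log ‖x‖ ^ e := by
    rw [← mul_pow]; exact pow_le_pow_left₀ (Real.log_nonneg h3) a2 e
  unfold wt
  calc _ ≤ (q ^ |s| * ‖x‖ ^ (-s)) * (2 ^ e * Real.log ‖x‖ ^ e) :=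
        mul_le_mul a1 a3 (pow_nonneg (Real.log_nonneg h3) _) (by positivity)
    _ = _ := by ring

lemma wt_mul (s t : ℝ) {x : EE n} (hx : 0 < ‖x‖) : wt s 0 x * wt t 0 x = wt (s+t) 0 x := by
  simp only [wt, pow_zero, mul_one]
  rw [← Real.rpow_add hx]; congr 1; ring

lemma isO_iff {f : EE n → ℝ} {s : ℝ} {e : ℕ} : f =O[LI n] wt s e ↔ ∃ C R, 0 < C ∧ 1 ≤ R ∧ ∀ x, R ≤ ‖x‖ → |f x| ≤ C * wt s e x := by
  constructor
  · intro h
    obtain ⟨C, hC, h⟩ := h.exists_pos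
    obtain ⟨R, hR⟩ := ev_LI.1 h.bound
    refine ⟨C, max R 1, hC, le_max_right _ _, fun x hx => ?_⟩
    have := hR x ((le_max_left _ _).trans hx)
    rwa [Real.norm_eq_abs, Real.norm_of_nonneg (wt_nonneg s e ((le_max_right _ _).trans hx))] at this
  · rintro ⟨C, R, _, h1, h⟩
    refine IsBigO.of_bound C (ev_LI.2 ⟨R, fun x hx => ?_⟩)
    rw [Real.norm_eq_abs, Real.norm_of_nonneg (wt_nonneg s e (h1.trans hx))]
    exact h x hx

lemma wt_le {s t : ℝ} (h : t ≤ s) (e : ℕ) : (wt s 0 : EE n → ℝ) =O[LI n] wt t e := by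
  refine isO_iff.2 ⟨1, Real.exp 1, one_pos, by simp, fun x hx => ?_⟩
  have h1 : 1 ≤ ‖x‖ := le_trans (by simp) hx
  have h2 : 1 ≤ Real.log ‖x‖ := by rwa [Real.le_log_iff_exp_le (by linarith)]
  rw [abs_of_nonneg (wt_nonneg _ _ h1), one_mul]
  unfold wt
  exact mul_le_mul (Real.rpow_le_rpow_of_exponent_le h1 (by linarith)) (by rw [pow_zero]; exact one_le_pow₀ h2) (by simp) (by positivity)

def OC : ℕ → ℝ → ℕ → (EE n → ℝ) → Prop
  | 0, s, e, f => f =O[LI n] wt s e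
  | k+1, s, e, f => f =O[LI n] wt s e ∧ (∀ᶠ x in LI n, DifferentiableAt ℝ f x) ∧ ∀ i, OC k (s+1) e (pd i f)

lemma OC.bd {k : ℕ} {s : ℝ} {e : ℕ} {f : EE n → ℝ} (h : OC k s e f) : f =O[LI n] wt s e := by
  cases k with
  | zero => exact h
  | succ k => exact h.1

lemma OC.pred {k : ℕ} : ∀ {s : ℝ} {e : ℕ} {f : EE n → ℝ} (_ : OC (k+1) s e f), OC k s e f := by
  induction k with
  | zero => intro s e f h; exact h.1
  | succ k ih => intro s e f h; exact ⟨h.1, h.2.1, fun i => ih (h.2.2 i)⟩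

lemma OC.le {k j : ℕ} {s : ℝ} {e : ℕ} {f : EE n → ℝ} (h : OC k s e f) (hj : j ≤ k) : OC j s e f := by
  induction hj using Nat.decreasingInduction with
  | self => exact h
  | of_succ _ _ ih => exact ih.pred

lemma OC.congr {k : ℕ} : ∀ {s : ℝ} {e : ℕ} {f g : EE n → ℝ} (_ : OC k s e f) (_ : g =ᶠ[LI n] f), OC k s e g := by
  induction k with
  | zero => intro s e f g h hg; exact IsBigO.congr' h hg.symm EventuallyEq.rfl
  | succ k ih =>
    intro s e f g h hg
    refine ⟨h.1.congr' hg.symm EventuallyEq.rfl, ?_, fun i => ih (h.2.2 i) ?_⟩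
    · filter_upwards [h.2.1, ev_nh hg] with x h1 h2 using h1.congr_of_eventuallyEq h2
    · filter_upwards [ev_nh hg] with x h2 using (pd_congr i h2).eq_of_nhds

lemma OC.weaken {k : ℕ} (e : ℕ) : ∀ {s t : ℝ} {f : EE n → ℝ} (_ : OC k s 0 f) (_ : t ≤ s), OC k t e f := by
  induction k with
  | zero => intro s t f h hg; exact IsBigO.trans h (wt_le hg e)
  | succ k ih => intro s t f h hg; exact ⟨h.1.trans (wt_le hg e), h.2.1, fun i => ih (h.2.2 i) (by linarith)⟩

lemma OC.add {k : ℕ} : ∀ {s : ℝ} {e : ℕ} {f g : EE n → ℝ} (_ : OC k s e f) (_ : OC k s e g), OC k s e (fun x => f x + g x) := by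
  induction k with
  | zero => intro s e f g hf hg; exact IsBigO.add hf hg
  | succ k ih =>
    intro s e f g hf hg
    refine ⟨hf.1.add hg.1, ?_, fun i => (ih (hf.2.2 i) (hg.2.2 i)).congr ?_⟩
    · filter_upwards [hf.2.1, hg.2.1] with x h1 h2 using h1.add h2
    · filter_upwards [hf.2.1, hg.2.1] with x h1 h2 using pd_add i h1 h2

lemma OC.cmul (c : ℝ) {k : ℕ} : ∀ {s : ℝ} {e : ℕ} {f : EE n → ℝ} (_ : OC k s e f), OC k s e (fun x => c * f x) := by
  induction k with
  | zero => intro s e f hf; exact IsBigO.const_mul_left hf c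
  | succ k ih =>
    intro s e f hf
    refine ⟨hf.1.const_mul_left c, ?_, fun i => (ih (hf.2.2 i)).congr ?_⟩
    · filter_upwards [hf.2.1] with x h1 using h1.const_mul c
    · filter_upwards [hf.2.1] with x h1 using pd_const_mul i c h1

lemma OC.zero (k : ℕ) : ∀ (s : ℝ) (e : ℕ), OC k s e (fun _ : EE n => (0:ℝ)) := by
  induction k with
  | zero => intro s e; exact isBigO_zero _ _
  | succ k ih =>
    intro s e
    refine ⟨isBigO_zero _ _, by simp, fun i => (ih (s+1) e).congr (Eventually.of_forall fun x => ?_)⟩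
    simp [pd]

lemma OC.const (k : ℕ) (c : ℝ) : OC k 0 0 (fun _ : EE n => c) := by
  have h0 : (fun _ : EE n => c) =O[LI n] wt 0 0 := isO_iff.2 ⟨|c| + 1, 1, by positivity, le_rfl, fun x _ => by simp [wt]⟩
  cases k with
  | zero => exact h0
  | succ k => exact ⟨h0, by simp, fun i => (OC.zero k _ _).congr (Eventually.of_forall fun x => by simp [pd])⟩

lemma OC.sum {ι : Type*} (t : Finset ι) {k : ℕ} {s : ℝ} {e : ℕ} {f : ι → EE n → ℝ} (h : ∀ a, OC k s e (f a)) :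
    OC k s e (fun x => ∑ a ∈ t, f a x) := by
  classical
  induction t using Finset.induction_on with
  | empty => simpa using OC.zero k s e
  | insert a t ha ih => simp_rw [Finset.sum_insert ha]; exact (h a).add ih

lemma wt_mul_eq (s t : ℝ) : (fun x : EE n => wt s 0 x * wt t 0 x) =ᶠ[LI n] wt (s+t) 0 := by
  filter_upwards [ev_gt 0] with x hx using wt_mul s t hx

lemma OC.mul {k : ℕ} : ∀ {s t : ℝ} {f g : EE n → ℝ} (_ : OC k s 0 f) (_ : OC k t 0 g), OC k (s+t) 0 (fun x => f x * g x) := by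
  induction k with
  | zero => intro s t f g hf hg; exact (IsBigO.mul hf hg).congr' EventuallyEq.rfl (wt_mul_eq s t)
  | succ k ih =>
    intro s t f g hf hg
    refine ⟨(hf.1.mul hg.1).congr' EventuallyEq.rfl (wt_mul_eq s t), ?_, fun i => ?_⟩
    · filter_upwards [hf.2.1, hg.2.1] with x h1 h2 using h1.mul h2
    · have h1 := ih hf.pred (hg.2.2 i)
      have h2 := ih (hf.2.2 i) hg.pred
      rw [show s + (t+1) = s+t+1 by ring] at h1
      rw [show s + 1 + t = s+t+1 by ring] at h2
      refine (h2.add h1).congr ?_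
      filter_upwards [hf.2.1, hg.2.1] with x h3 h4
      rw [pd_mul i h3 h4]; ring

lemma OC.prod {ι : Type*} (t : Finset ι) {k : ℕ} {f : ι → EE n → ℝ} (h : ∀ a, OC k 0 0 (f a)) :
    OC k 0 0 (fun x => ∏ a ∈ t, f a x) := by
  classical
  induction t using Finset.induction_on with
  | empty => simpa using OC.const k 1
  | insert a t ha ih => simp_rw [Finset.prod_insert ha]; simpa using (h a).mul ih

lemma OC.inv {f : EE n → ℝ} {k : ℕ} (hf : OC k 0 0 f) {c : ℝ} (hc : 0 < c) (h : ∀ᶠ x in LI n, c ≤ f x) :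
    OC k 0 0 (fun x => (f x)⁻¹) := by
  have h0 : (fun x => (f x)⁻¹) =O[LI n] wt 0 0 := by
    refine IsBigO.of_bound c⁻¹ ?_
    filter_upwards [h] with x hx
    have : 0 < f x := by linarith
    rw [Real.norm_of_nonneg (by positivity)]
    simp [wt]; exact inv_anti₀ hc hx
  induction k with
  | zero => exact h0
  | succ k ih =>
    refine ⟨h0, ?_, fun i => ?_⟩
    · filter_upwards [h, hf.2.1] with x h1 h2
      exact h2.inv (by linarith)
    · have := ((ih hf.pred).mul (ih hf.pred)).mul (hf.2.2 i)
      rw [zero_add, zero_add] at this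
      refine (this.cmul (-1)).congr ?_
      filter_upwards [h, hf.2.1] with x h1 h2
      have hne : f x ≠ 0 := by linarith
      have q := ((hasDerivAt_inv hne).comp_hasFDerivAt x h2.hasFDerivAt).fderiv
      show fderiv ℝ (Inv.inv ∘ f) x (ee i) = _
      rw [q]
      unfold pd
      simp
      field_simp
      exact Or.inl trivial

lemma OC.det {m k : ℕ} {M : EE n → Matrix (Fin m) (Fin m) ℝ} (h : ∀ i j, OC k 0 0 (fun x => M x i j)) :
    OC k 0 0 (fun x => (M x).det) := by
  simp_rw [Matrix.det_apply']
  exact OC.sum _ fun σ => (OC.prod _ fun i => h _ _).cmul _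

lemma OC.adj {m k : ℕ} {M : EE n → Matrix (Fin m) (Fin m) ℝ} (h : ∀ i j, OC k 0 0 (fun x => M x i j)) (i j : Fin m) :
    OC k 0 0 (fun x => (M x).adjugate i j) := by
  simp_rw [Matrix.adjugate_apply]
  refine OC.det fun a b => ?_
  simp_rw [Matrix.updateRow_apply]
  split_ifs
  · exact OC.const k _
  · exact h a b

lemma OC.minv {m k : ℕ} {M : EE n → Matrix (Fin m) (Fin m) ℝ} (h : ∀ i j, OC k 0 0 (fun x => M x i j)) {c : ℝ} (hc : 0 < c)
    (hd : ∀ᶠ x in LI n, c ≤ (M x).det) (i j : Fin m) : OC k 0 0 (fun x => (M x)⁻¹ i j) := by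
  have := ((OC.det h).inv hc hd).mul (OC.adj h i j)
  rw [zero_add] at this
  refine this.congr (Eventually.of_forall fun x => ?_)
  simp only [Matrix.inv_def, Ring.inverse_eq_inv', Matrix.smul_apply, smul_eq_mul]

end oclass

end partH0


section partH1
open Filter MeasureTheory Set
open scoped Pointwise

section oiter
variable {n : ℕ}
open Asymptotics

lemma norm_cmp {x y : EE n} (h : ‖y - x‖ ≤ ‖x‖ / 2) : ‖x‖ ≤ 2 * ‖y‖ ∧ ‖y‖ ≤ 2 * ‖x‖ := by
  have h1 := norm_sub_norm_le x y
  have h2 := norm_sub_norm_le y x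
  rw [norm_sub_rev] at h1
  constructor <;> linarith [norm_nonneg x]

lemma grad_decay (hn : 3 ≤ n) {w : EE n → ℝ} {s : ℝ} {e : ℕ} (h2 : ∀ᶠ x in LI n, ContDiffAt ℝ 2 w x)
    (hw : w =O[LI n] wt s e) (hl : lap w =O[LI n] wt (s+2) e) (i : Fin n) : pd i w =O[LI n] wt (s+1) e := by
  obtain ⟨C, hC, hG⟩ := grad_est hn
  obtain ⟨R0, hR0⟩ := ev_LI.1 h2
  obtain ⟨C1, R1, c1, r1, hR1⟩ := isO_iff.1 hw
  obtain ⟨C2, R2, c2, r2, hR2⟩ := isO_iff.1 hl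
  set K1 : ℝ := 2 ^ |s| * 2 ^ e
  set K2 : ℝ := 2 ^ |s+2| * 2 ^ e
  refine isO_iff.2 ⟨C * (2 * C1 * K1 + C2 * K2), 2 * (|R0| + R1 + R2), by positivity, by linarith [abs_nonneg R0], fun x hx => ?_⟩
  have a0 := le_abs_self R0
  have a1 := abs_nonneg R0
  have hx2 : 2 ≤ ‖x‖ := by linarith
  have x0 : 0 < ‖x‖ := by linarith
  have hy : ∀ y, ‖y - x‖ ≤ ‖x‖/2 → R0 ≤ ‖y‖ ∧ R1 ≤ ‖y‖ ∧ R2 ≤ ‖y‖ ∧ 1 ≤ ‖y‖ ∧ ‖x‖ ≤ 2 * ‖y‖ ∧ ‖y‖ ≤ 2 * ‖x‖ := fun y h => by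
    obtain ⟨b1, b2⟩ := norm_cmp h
    refine ⟨?_, ?_, ?_, ?_, b1, b2⟩ <;> linarith
  have := hG w x (‖x‖/2) (C1 * (K1 * wt s e x)) (C2 * (K2 * wt (s+2) e x)) (by positivity)
    (fun y h => hR0 y (hy y h).1)
    (fun y h => by
      obtain ⟨_, q1, _, q3, q4, q5⟩ := hy y h
      exact (hR1 y q1).trans (mul_le_mul_of_nonneg_left (wt_cmp s e one_le_two x y hx2 (by linarith) q3 q4 q5) c1.le))
    (fun y h => by
      obtain ⟨_, _, q1, q3, q4, q5⟩ := hy y h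
      exact (hR2 y q1).trans (mul_le_mul_of_nonneg_left (wt_cmp (s+2) e one_le_two x y hx2 (by linarith) q3 q4 q5) c2.le)) i
  refine this.trans ?_
  have e1 : wt s e x = ‖x‖ * wt (s+1) e x := by
    unfold wt; rw [show -s = 1 + -(s+1) by ring, Real.rpow_add x0, Real.rpow_one]; ring
  have e2 : ‖x‖ * wt (s+2) e x = wt (s+1) e x := by
    unfold wt; rw [show -(s+1) = 1 + -(s+2) by ring, Real.rpow_add x0, Real.rpow_one]; ring
  have p := wt_nonneg (s+1) e (x := x) (by linarith)
  have : C1 * (K1 * wt s e x) / (‖x‖/2) + ‖x‖/2 * (C2 * (K2 * wt (s+2) e x)) = (2 * C1 * K1 + C2 * K2 / 2) * wt (s+1) e x := by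
    have e3 : ‖x‖/2 * (C2 * (K2 * wt (s+2) e x)) = C2 * K2 / 2 * wt (s+1) e x := by rw [← e2]; ring
    rw [e3, e1]; field_simp
  rw [this, mul_assoc C]
  refine mul_le_mul_of_nonneg_left (mul_le_mul_of_nonneg_right ?_ p) hC.le
  have : 0 ≤ C2 * K2 := by positivity
  linarith

theorem OC.iter (hn : 3 ≤ n) (e : ℕ) (k : ℕ) : ∀ (s : ℝ) (w : EE n → ℝ), (∀ᶠ x in LI n, ContDiffAt ℝ (k+1:ℕ) w x) →
    w =O[LI n] wt s e → (k = 0 ∨ OC (k-1) (s+2) e (lap w)) → OC k s e w := by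
  induction k with
  | zero => intro s w _ h _; exact h
  | succ k ih =>
    intro s w hw hb hl
    have hl : OC k (s+2) e (lap w) := hl.resolve_left (by simp)
    have w2 : ∀ᶠ x in LI n, ContDiffAt ℝ 2 w x := hw.mono fun x hx => hx.of_le (by exact_mod_cast (by omega : 2 ≤ k+1+1))
    refine ⟨hb, w2.mono fun x hx => hx.differentiableAt (by norm_num), fun i => ih (s+1) (pd i w) ?_ (grad_decay hn w2 hb hl.bd i) ?_⟩
    · exact hw.mono fun x hx => pd_contDiffAt i hx
    · rcases k with _ | k
      · exact Or.inl rfl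
      · right
        have := hl.2.2 i
        rw [show s + 1 + 2 = s + 2 + 1 by ring]
        refine this.congr ?_
        filter_upwards [hw] with x hx
        exact (pd_lap_comm (hx.of_le (by exact_mod_cast (by omega : 3 ≤ k+1+1+1))) i).symm

lemma OC.of_io (k : ℕ) : ∀ (s : ℝ) (f : EE n → ℝ), (∀ᶠ x in LI n, ContDiffAt ℝ (k:ℕ) f x) →
    (∀ j ≤ k, (fun x => ‖iteratedFDeriv ℝ j f x‖) =O[LI n] wt (s+j) 0) → OC k s 0 f := by
  induction k with
  | zero =>
    intro s f _ h
    have := h 0 le_rfl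
    simp only [norm_iteratedFDeriv_zero, Nat.cast_zero, add_zero] at this
    exact this.of_norm_left
  | succ k ih =>
    intro s f hf h
    refine ⟨?_, hf.mono fun x hx => hx.differentiableAt (by simp), fun i => ih (s+1) _ (hf.mono fun x hx => pd_contDiffAt i hx) fun j hj => ?_⟩
    · have := h 0 (Nat.zero_le _)
      simp only [norm_iteratedFDeriv_zero, Nat.cast_zero, add_zero] at this
      exact this.of_norm_left
    · have := h (j+1) (by omega)
      rw [show s + 1 + (j:ℝ) = s + ((j+1:ℕ):ℝ) by push_cast; ring]
      refine IsBigO.trans ?_ this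
      refine IsBigO.of_bound ‖ContinuousLinearMap.apply ℝ ℝ (ee i : EE n)‖ ?_
      filter_upwards [hf] with x hx
      rw [norm_norm, norm_norm, ← norm_iteratedFDeriv_fderiv]
      exact ContinuousLinearMap.norm_iteratedFDeriv_comp_left (ContinuousLinearMap.apply ℝ ℝ (ee i : EE n))
        ((hx.fderiv_right (m := (k:ℕ)) (by push_cast; rfl)).of_le (by exact_mod_cast hj)) le_rfl

lemma OC.to_io (e : ℕ) (k : ℕ) : ∀ (s : ℝ) (f : EE n → ℝ), (∀ᶠ x in LI n, ContDiffAt ℝ (k:ℕ) f x) → OC k s e f →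
    ∀ j ≤ k, (fun x => ‖iteratedFDeriv ℝ j f x‖) =O[LI n] wt (s+j) e := by
  induction k with
  | zero =>
    intro s f _ h j hj
    obtain rfl : j = 0 := by omega
    simp only [norm_iteratedFDeriv_zero, Nat.cast_zero, add_zero]
    exact IsBigO.norm_left h
  | succ k ih =>
    intro s f hf h j hj
    rcases j with _ | j
    · simp only [norm_iteratedFDeriv_zero, Nat.cast_zero, add_zero]
      exact h.1.norm_left
    · rw [show s + ((j+1:ℕ):ℝ) = s + 1 + (j:ℝ) by push_cast; ring]
      let L : Fin n → (ℝ →L[ℝ] (EE n →L[ℝ] ℝ)) := fun i => ContinuousLinearMap.toSpanSingleton ℝ (EuclideanSpace.proj i : EE n →L[ℝ] ℝ)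
      have e0 : fderiv ℝ f = fun x => ∑ i, L i (pd i f x) := by
        funext x; ext v
        rw [fderiv_eq_sum_pd]; simp [L, mul_comm, ContinuousLinearMap.sum_apply]
      have hi : ∀ i, (fun x => ‖L i‖ * ‖iteratedFDeriv ℝ j (pd i f) x‖) =O[LI n] wt (s+1+j) e := fun i =>
        (ih (s+1) (pd i f) (hf.mono fun x hx => pd_contDiffAt i hx) (h.2.2 i) j (by omega)).const_mul_left _
      refine IsBigO.trans (IsBigO.of_bound 1 ?_) (IsBigO.sum fun i (_ : i ∈ Finset.univ) => hi i)
      filter_upwards [hf] with x hx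
      have cd : ∀ i, ContDiffAt ℝ (j:ℕ) (pd i f) x := fun i => (pd_contDiffAt i hx).of_le (by exact_mod_cast (by omega : j ≤ k))
      rw [norm_norm, one_mul, ← norm_iteratedFDeriv_fderiv, e0, iteratedFDeriv_fun_sum_apply]
      · refine ((norm_sum_le _ _).trans (Finset.sum_le_sum (g := fun i => ‖L i‖ * ‖iteratedFDeriv ℝ j (pd i f) x‖) fun i _ => ?_)).trans (le_of_eq_of_le ?_ (Real.le_norm_self _))
        · exact (L i).norm_iteratedFDeriv_comp_left (cd i) le_rfl
        · rw [Finset.sum_apply]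
      · intro i _; exact (L i).contDiff.contDiffAt.comp x (cd i)

end oiter

end partH1


section partI0
open Filter MeasureTheory Set
open scoped Pointwise

section core
variable {n : ℕ}
open Asymptotics

lemma glob_bd {h : EE n → ℝ} (hc : Continuous h) (h0 : ∀ y, ‖y‖ < 1 → h y = 0) {p : ℝ} (hp : 0 ≤ p)
    (hO : h =O[LI n] wt p 0) : ∃ C, 0 ≤ C ∧ ∀ y, |h y| ≤ C * ‖y‖ ^ (-p) := by
  obtain ⟨C, R, hC, hR, hb⟩ := isO_iff.1 hO
  obtain ⟨D, hD⟩ := (isCompact_closedBall (0 : EE n) R).exists_bound_of_continuousOn hc.continuousOn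
  have R0 : 0 < R := by linarith
  refine ⟨max C (|D| * R ^ p), le_max_of_le_left hC.le, fun y => ?_⟩
  rcases lt_or_ge ‖y‖ 1 with hy | hy
  · rw [h0 y hy, abs_zero]
    exact mul_nonneg (le_max_of_le_left hC.le) (by positivity)
  · have y0 : 0 < ‖y‖ := by linarith
    rcases le_total R ‖y‖ with hy2 | hy2
    · have := hb y hy2
      rw [wt, pow_zero, mul_one] at this
      exact this.trans (mul_le_mul_of_nonneg_right (le_max_left _ _) (by positivity))
    · have h1 : |h y| ≤ |D| := (hD y (by simpa using hy2)).trans (le_abs_self D)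
      refine h1.trans (le_trans ?_ (mul_le_mul_of_nonneg_right (le_max_right _ _) (by positivity)))
      rw [mul_assoc]
      refine le_mul_of_one_le_right (abs_nonneg _) ?_
      rw [Real.rpow_neg y0.le, ← div_eq_mul_inv, one_le_div (by positivity)]
      exact Real.rpow_le_rpow y0.le hy2 hp

theorem core (hn : 3 ≤ n) {m : ℕ} (hm : 2 ≤ m) {φ : EE n → ℝ} (hφ : ContDiff ℝ 2 φ)
    (hφm : ∀ᶠ x in LI n, ContDiffAt ℝ (m+1:ℕ) φ x) (hO : OC 1 ((n:ℝ)-2) 0 φ) {β : ℝ} (hβ : (n:ℝ) < β)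
    (hl : OC (m-1) β 0 (lap φ)) (N : ℕ) (hN : (N:ℝ) < β - n) (hN' : β - n ≤ N + 1) :
    ∃ (c₀ : ℝ) (P : ℕ → MvPolynomial (Fin n) ℝ), (∀ k, (P k).IsHomogeneous k ∧ plap (P k) = 0) ∧
      P 0 = MvPolynomial.C c₀ ∧
      (∀ᶠ x in LI n, ContDiffAt ℝ (m+1:ℕ) (fun y => φ y - ∑ k ∈ Finset.range (N+1), evP (P k) y * ‖y‖ ^ ((2:ℝ) - n - 2 * k)) x) ∧
      OC m (β - 2) (if β - n = N + 1 then 1 else 0) (fun y => φ y - ∑ k ∈ Finset.range (N+1), evP (P k) y * ‖y‖ ^ ((2:ℝ) - n - 2 * k)) := by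
  classical
  have hn3 : (3:ℝ) ≤ n := by exact_mod_cast hn
  let b : ContDiffBump (0 : EE n) := ⟨1, 2, one_pos, by norm_num⟩
  set ψ : EE n → ℝ := fun y => (1 - b y) * φ y with hψ
  have bc : ContDiff ℝ 2 (fun y => b y) := b.contDiff
  have ψ2 : ContDiff ℝ 2 ψ := (contDiff_const.sub bc).mul hφ
  have ψ0 : ∀ y, ‖y‖ < 1 → ψ y = 0 := fun y hy => by
    simp only [hψ]
    rw [b.one_of_mem_closedBall (by simpa using hy.le)]; simp
  have ψ0e : ∀ y, ‖y‖ < 1 → ψ =ᶠ[nhds y] fun _ => 0 := fun y hy => by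
    filter_upwards [(isOpen_lt continuous_norm continuous_const).mem_nhds hy] with z hz using ψ0 z hz
  have ψe : ψ =ᶠ[LI n] φ := by
    filter_upwards [ev_gt 2] with y hy
    simp only [hψ]
    rw [b.zero_of_le_dist (by simpa using hy.le)]; simp
  have ψen := ev_nh ψe
  obtain ⟨C0, c0, B0⟩ := glob_bd ψ2.continuous ψ0 (p := (n:ℝ)-2) (by linarith) (hO.bd.congr' ψe.symm EventuallyEq.rfl)
  have B1 : ∀ i, ∃ C, 0 ≤ C ∧ ∀ y, |pd i ψ y| ≤ C * ‖y‖ ^ (-((n:ℝ)-2+1)) := fun i => by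
    refine glob_bd (pd_cont (ψ2.of_le (by norm_num)) i) (fun y hy => ?_) (by linarith) ((hO.2.2 i).bd.congr' ?_ EventuallyEq.rfl)
    · rw [(pd_congr i (ψ0e y hy)).eq_of_nhds, pd_const]
    · filter_upwards [ψen] with y hy using ((pd_congr i hy).eq_of_nhds).symm
  choose C1 c1 B1 using B1
  obtain ⟨C2, c2, B2⟩ := glob_bd (lap_cont ψ2) (fun y hy => by rw [lap_congr (ψ0e y hy), lap_const]) (p := β) (by linarith)
    (hl.bd.congr' (by filter_upwards [ψen] with y hy using (lap_congr hy).symm) EventuallyEq.rfl)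
  have sC : 0 ≤ ∑ i, C1 i := Finset.sum_nonneg fun i _ => c1 i
  obtain ⟨a, C', hC', hfar⟩ := far_expand hn ψ2 hβ (C := C0 + (∑ i, C1 i) + C2) (by positivity) ψ0
    (fun y => by
      refine (B0 y).trans ?_
      rw [show -((n:ℝ)-2) = 2 - n by ring]
      exact mul_le_mul_of_nonneg_right (by linarith) (by positivity))
    (fun i y => by
      refine (B1 i y).trans ?_
      rw [show -((n:ℝ)-2+1) = 1 - n by ring]
      have := Finset.single_le_sum (fun i _ => c1 i) (Finset.mem_univ i)
      exact mul_le_mul_of_nonneg_right (by linarith) (by positivity))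
    (fun y => (B2 y).trans (mul_le_mul_of_nonneg_right (by linarith) (by positivity))) N hN hN'
  let P : ℕ → MvPolynomial (Fin n) ℝ := fun k => ∑ w, MvPolynomial.C (a k w) * KP k w
  have hP : ∀ k, (P k).IsHomogeneous k ∧ plap (P k) = 0 := fun k => by
    constructor
    · refine MvPolynomial.IsHomogeneous.sum _ _ _ fun w _ => ?_
      simpa using (MvPolynomial.isHomogeneous_C (Fin n) (a k w)).mul (KP_hom k w)
    · have : plap (P k) = ∑ w, plap (MvPolynomial.C (a k w) * KP k w) := by
        simp only [P, plap, map_sum]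
        rw [Finset.sum_comm]
      rw [this]
      exact Finset.sum_eq_zero fun w _ => by rw [plap_C_mul, KP_harm, mul_zero]
  have hsum : ∀ k y, evP (P k) y * ‖y‖ ^ ((2:ℝ) - n - 2 * k) = ∑ w, a k w * KF k w y := fun k y => by
    simp only [P, evP, KF, map_sum, map_mul, MvPolynomial.eval_C, Finset.sum_mul]
    exact Finset.sum_congr rfl fun w _ => by ring
  set E : EE n → ℝ := fun y => ∑ k ∈ Finset.range (N+1), evP (P k) y * ‖y‖ ^ ((2:ℝ) - n - 2 * k) with hE
  have Ec : ∀ k {x : EE n}, x ≠ 0 → ∀ q : WithTop ℕ∞, ContDiffAt ℝ q (fun y => evP (P k) y * ‖y‖ ^ ((2:ℝ) - n - 2 * k)) x :=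
    fun k x hx q => (evP_contDiff _).contDiffAt.mul (contDiffAt_norm_rpow hx _)
  have ne : ∀ᶠ x in LI n, x ≠ 0 := (ev_gt 0).mono fun x hx => norm_pos_iff.1 hx
  have wc : ∀ᶠ x in LI n, ContDiffAt ℝ (m+1:ℕ) (fun y => φ y - E y) x := by
    filter_upwards [hφm, ne] with x h1 h2
    exact h1.sub (ContDiffAt.sum fun k _ => Ec k h2 _)
  have El : ∀ x : EE n, x ≠ 0 → lap E x = 0 := fun x hx => by
    have : ∀ s : Finset ℕ, ContDiffAt ℝ 2 (fun y : EE n => ∑ k ∈ s, evP (P k) y * ‖y‖ ^ ((2:ℝ) - n - 2 * k)) x ∧ lap (fun y : EE n => ∑ k ∈ s, evP (P k) y * ‖y‖ ^ ((2:ℝ) - n - 2 * k)) x = 0 := by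
      intro s
      induction s using Finset.induction_on with
      | empty => simp only [Finset.sum_empty]; exact ⟨contDiffAt_const, lap_const _ _⟩
      | insert k s hk ih =>
        simp_rw [Finset.sum_insert hk]
        refine ⟨(Ec k hx 2).add ih.1, ?_⟩
        rw [lap_add (Ec k hx 2) ih.1, ih.2, PF_harm (hP k).1 (hP k).2 hx, add_zero]
    exact (this _).2
  have Ed : ∀ x : EE n, x ≠ 0 → ContDiffAt ℝ 2 E x := fun x hx => ContDiffAt.sum fun k _ => Ec k hx _
  refine ⟨a 0 default, P, hP, ?_, wc, ?_⟩
  · simp only [P, KP, mul_one]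
    rw [Fintype.sum_unique]
  · refine OC.iter hn _ m _ _ wc ?_ (Or.inr ?_)
    · obtain ⟨R, hR⟩ := ev_LI.1 ψe
      refine isO_iff.2 ⟨C' + 1, max R 2, by linarith, by linarith [le_max_right R 2], fun x hx => ?_⟩
      have x2 : 2 ≤ ‖x‖ := (le_max_right _ _).trans hx
      have h1 := hfar x x2
      rw [hR x ((le_max_left _ _).trans hx)] at h1
      have h2 : E x = ∑ k ∈ Finset.range (N+1), ∑ w, a k w * KF k w x := Finset.sum_congr rfl fun k _ => hsum k x
      show |φ x - E x| ≤ _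
      rw [h2]
      refine h1.trans ?_
      rw [mul_assoc]
      have e : ‖x‖ ^ ((2:ℝ) - β) * (if β - n = N + 1 then Real.log ‖x‖ else 1) = wt (β-2) (if β - n = N + 1 then 1 else 0) x := by
        unfold wt; rw [neg_sub]; split_ifs <;> simp
      rw [e]
      exact mul_le_mul_of_nonneg_right (by linarith) (wt_nonneg _ _ (by linarith))
    · have h3 : OC (m-1) β 0 (lap (fun y => φ y - E y)) := by
        refine hl.congr ?_
        filter_upwards [ne] with x hx
        have : (fun y => φ y - E y) = fun y => φ y + (-1) * E y := by funext y; ring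
        rw [this, lap_add hφ.contDiffAt (contDiffAt_const.mul (Ed x hx)), lap_const_mul _ (Ed x hx), El x hx]; simp
      exact h3.weaken _ (by linarith)

end core

end partI0


section partI1
open Filter MeasureTheory Set
open scoped Pointwise

section lin
variable {n : ℕ}
open Asymptotics

lemma tr_inv {H : Matrix (Fin n) (Fin n) ℝ} (hH : H.IsHermitian) (hd : (1 + H).det ≠ 0) :
    ∑ i, 1 / (1 + hH.eigenvalues i) = ((1 + H)⁻¹).trace := by
  have hs := hH.spectral_theorem
  set U : Matrix (Fin n) (Fin n) ℝ := (hH.eigenvectorUnitary : Matrix (Fin n) (Fin n) ℝ) with hU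
  set D : Matrix (Fin n) (Fin n) ℝ := Matrix.diagonal hH.eigenvalues with hD
  have u1 : U * star U = 1 := Unitary.mul_star_self_of_mem hH.eigenvectorUnitary.2
  have u2 : star U * U = 1 := Unitary.star_mul_self_of_mem hH.eigenvectorUnitary.2
  have hs2 : H = U * D * star U := by
    rw [Unitary.conjStarAlgAut_apply] at hs
    exact hs
  have h1 : 1 + H = U * (1 + D) * star U := by
    rw [mul_add, add_mul, mul_one, u1, ← hs2]
  have D1 : 1 + D = Matrix.diagonal (fun i => 1 + hH.eigenvalues i) := by
    rw [hD, ← Matrix.diagonal_one, Matrix.diagonal_add]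
  have d1 : ∀ i, 1 + hH.eigenvalues i ≠ 0 := by
    rw [h1, Matrix.det_mul, Matrix.det_mul, D1, Matrix.det_diagonal] at hd
    intro i hi
    apply hd
    rw [Finset.prod_eq_zero (Finset.mem_univ i) hi]; simp
  set D' : Matrix (Fin n) (Fin n) ℝ := Matrix.diagonal (fun i => 1 / (1 + hH.eigenvalues i)) with hD'
  have DD : (1 + D) * D' = 1 := by
    rw [D1, hD', Matrix.diagonal_mul_diagonal, ← Matrix.diagonal_one]
    congr 1; funext i; exact mul_one_div_cancel (d1 i)
  have h2 : (1 + H) * (U * D' * star U) = 1 := by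
    rw [h1]
    calc U * (1 + D) * star U * (U * D' * star U) = U * (1 + D) * (star U * U) * D' * star U := by simp only [mul_assoc]
      _ = U * ((1 + D) * D') * star U := by rw [u2]; simp only [mul_assoc, one_mul]
      _ = 1 := by rw [DD, mul_one, u1]
  rw [Matrix.inv_eq_right_inv h2, Matrix.trace_mul_comm, ← mul_assoc, u2, one_mul, hD', Matrix.trace_diagonal]

lemma tr_expand {M Xh : Matrix (Fin n) (Fin n) ℝ} {r q : ℝ} (hr : r * r = q) (hM : M.det ≠ 0)
    (hK : (1 + q • (Xh * M)).det ≠ 0) :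
    ((M + (r • M) * Xh * (r • M))⁻¹).trace = (M⁻¹).trace - q * Xh.trace
      + ((q • (Xh * M)) * (q • (Xh * M)) * (1 + q • (Xh * M))⁻¹ * M⁻¹).trace := by
  set K := q • (Xh * M) with hKd
  have e1 : M + (r • M) * Xh * (r • M) = M * (1 + K) := by
    rw [mul_add, mul_one, hKd, ← hr]
    simp only [Matrix.smul_mul, Matrix.mul_smul, smul_smul, mul_assoc]
  have i1 : (1 + K) * (1 + K)⁻¹ = 1 := Matrix.mul_nonsing_inv _ (isUnit_iff_ne_zero.2 hK)
  have i2 : M * M⁻¹ = 1 := Matrix.mul_nonsing_inv _ (isUnit_iff_ne_zero.2 hM)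
  have e2 : (1 + K)⁻¹ = 1 - K + K * K * (1 + K)⁻¹ := by
    have : (1 - K) * ((1 + K) * (1 + K)⁻¹) = (1 - K) := by rw [i1, mul_one]
    calc (1 + K)⁻¹ = (1 - K) * ((1 + K) * (1 + K)⁻¹) + K * K * (1 + K)⁻¹ := by noncomm_ring
      _ = _ := by rw [this]
  rw [e1, Matrix.mul_inv_rev]
  conv_lhs => rw [e2]
  rw [add_mul, sub_mul, one_mul, Matrix.trace_add, Matrix.trace_sub]
  congr 2
  rw [hKd, Matrix.smul_mul, mul_assoc, i2, mul_one, Matrix.trace_smul, smul_eq_mul]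

lemma OC.mmul {m k : ℕ} {s t : ℝ} {M1 M2 : EE n → Matrix (Fin m) (Fin m) ℝ} (h1 : ∀ i j, OC k s 0 (fun x => M1 x i j))
    (h2 : ∀ i j, OC k t 0 (fun x => M2 x i j)) (i j : Fin m) : OC k (s+t) 0 (fun x => (M1 x * M2 x) i j) := by
  simp_rw [Matrix.mul_apply]
  exact OC.sum _ fun l => (h1 i l).mul (h2 l j)

lemma OC.tend {k : ℕ} {s : ℝ} (hs : 0 < s) {f : EE n → ℝ} (h : OC k s 0 f) : Tendsto f (LI n) (nhds 0) := by
  refine h.bd.trans_tendsto ?_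
  have := (tendsto_rpow_neg_atTop hs).comp (tendsto_comap (f := (norm : EE n → ℝ)))
  refine this.congr fun x => ?_
  simp [wt]

lemma OC.trK {k : ℕ} {s q : ℝ} (hs : 0 < s) (M : Matrix (Fin n) (Fin n) ℝ) {Xh : EE n → Matrix (Fin n) (Fin n) ℝ}
    (h : ∀ i j, OC k s 0 (fun x => Xh x i j)) :
    (∀ᶠ x in LI n, (1 + q • (Xh x * M)).det ≠ 0) ∧
    OC k (s+s) 0 (fun x => ((q • (Xh x * M)) * (q • (Xh x * M)) * (1 + q • (Xh x * M))⁻¹ * M⁻¹).trace) := by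
  have cst : ∀ (M : Matrix (Fin n) (Fin n) ℝ) i j, OC k 0 0 (fun _ : EE n => M i j) := fun M i j => OC.const k _
  have hK : ∀ i j, OC k s 0 (fun x => (q • (Xh x * M)) i j) := fun i j => by
    have := OC.mmul h (cst M) i j
    rw [add_zero] at this
    exact this.cmul q
  have hK1 : ∀ i j, OC k 0 0 (fun x => (1 + q • (Xh x * M)) i j) := fun i j =>
    (cst 1 i j).add ((hK i j).weaken 0 hs.le)
  have td : Tendsto (fun x => (1 + q • (Xh x * M)).det) (LI n) (nhds 1) := by
    have t1 : Tendsto (fun x => 1 + q • (Xh x * M)) (LI n) (nhds (1 + 0)) := by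
      refine Tendsto.add tendsto_const_nhds ?_
      refine tendsto_pi_nhds.2 fun i => tendsto_pi_nhds.2 fun j => ?_
      exact (hK i j).tend hs
    have c : Continuous (fun Y : Matrix (Fin n) (Fin n) ℝ => Y.det) := continuous_id.matrix_det
    have := (c.tendsto _).comp t1
    simp only [add_zero, Matrix.det_one] at this
    exact this
  have hd : ∀ᶠ x in LI n, (1/2 : ℝ) ≤ (1 + q • (Xh x * M)).det :=
    (td.eventually (lt_mem_nhds (show (1/2:ℝ) < 1 by norm_num))).mono fun x hx => hx.le
  refine ⟨hd.mono fun x hx => by linarith, ?_⟩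
  have hI := OC.minv hK1 (by norm_num : (0:ℝ) < 1/2) hd
  have := OC.mmul (OC.mmul (OC.mmul hK hK) hI) (cst M⁻¹)
  simp only [add_zero] at this
  simp_rw [Matrix.trace, Matrix.diag]
  exact OC.sum _ fun i => this i i

noncomputable def mE (S : Matrix (Fin n) (Fin n) ℝ) (hS : S.det ≠ 0) : EE n ≃L[ℝ] EE n :=
  ContinuousLinearEquiv.equivOfInverse (Matrix.toEuclideanCLM (𝕜 := ℝ) S) (Matrix.toEuclideanCLM (𝕜 := ℝ) S⁻¹)
    (fun x => by
      rw [← ContinuousLinearMap.mul_apply, ← map_mul, Matrix.nonsing_inv_mul _ (isUnit_iff_ne_zero.2 hS)]; simp)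
    (fun x => by
      rw [← ContinuousLinearMap.mul_apply, ← map_mul, Matrix.mul_nonsing_inv _ (isUnit_iff_ne_zero.2 hS)]; simp)

lemma mE_apply (S : Matrix (Fin n) (Fin n) ℝ) (hS : S.det ≠ 0) (x : EE n) (i : Fin n) : mE S hS x i = ∑ j, S i j * x j := rfl

lemma equiv_cmp (T : EE n ≃L[ℝ] EE n) : ∃ q, 1 ≤ q ∧ ∀ x, ‖T x‖ ≤ q * ‖x‖ ∧ ‖x‖ ≤ q * ‖T x‖ := by
  refine ⟨max 1 (max ‖(T : EE n →L[ℝ] EE n)‖ ‖(T.symm : EE n →L[ℝ] EE n)‖), le_max_left _ _, fun x => ⟨?_, ?_⟩⟩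
  · refine ((T : EE n →L[ℝ] EE n).le_opNorm x).trans (mul_le_mul_of_nonneg_right ?_ (norm_nonneg _))
    exact (le_max_left _ _).trans (le_max_right _ _)
  · have := (T.symm : EE n →L[ℝ] EE n).le_opNorm (T x)
    simp only [ContinuousLinearEquiv.coe_coe, ContinuousLinearEquiv.symm_apply_apply] at this
    refine this.trans (mul_le_mul_of_nonneg_right ?_ (norm_nonneg _))
    exact (le_max_right _ _).trans (le_max_right _ _)

lemma tend_equiv (T : EE n ≃L[ℝ] EE n) : Tendsto T (LI n) (LI n) := by
  obtain ⟨q, hq, h⟩ := equiv_cmp T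
  intro s hs
  obtain ⟨R, hR⟩ := ev_LI.1 (show ∀ᶠ x in LI n, x ∈ s from hs)
  refine ev_LI.2 ⟨q * R, fun x hx => hR _ ?_⟩
  have := (hx.trans (h x).2)
  exact le_of_mul_le_mul_left this (by linarith)

lemma io_comp (T : EE n ≃L[ℝ] EE n) {f : EE n → ℝ} {s : ℝ} {e j : ℕ} (h : (fun x => ‖iteratedFDeriv ℝ j f x‖) =O[LI n] wt s e) :
    (fun x => ‖iteratedFDeriv ℝ j (fun y => f (T y)) x‖) =O[LI n] wt s e := by
  obtain ⟨q, hq, hT⟩ := equiv_cmp T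
  have h1 : (fun x => ‖iteratedFDeriv ℝ j f (T x)‖) =O[LI n] (fun x => wt s e (T x)) := h.comp_tendsto (tend_equiv T)
  have h2 : (fun x => wt s e (T x)) =O[LI n] wt s e := by
    refine isO_iff.2 ⟨q ^ |s| * 2 ^ e, q, by positivity, hq, fun x hx => ?_⟩
    have x1 : 1 ≤ ‖T x‖ := by
      have := hx.trans (hT x).2
      nlinarith
    rw [abs_of_nonneg (wt_nonneg _ _ x1)]
    exact wt_cmp s e hq x (T x) hx (hq.trans hx) x1 (hT x).2 (hT x).1
  refine (IsBigO.of_bound (‖(T : EE n →L[ℝ] EE n)‖ ^ j) (Eventually.of_forall fun x => ?_)).trans (h1.trans h2)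
  rw [norm_norm, norm_norm]
  have := T.iteratedFDerivWithin_comp_right f uniqueDiffOn_univ (x := x) (mem_univ _) j
  rw [preimage_univ, iteratedFDerivWithin_univ, iteratedFDerivWithin_univ] at this
  rw [show (fun y => f (T y)) = f ∘ T from rfl, this, mul_comm]
  refine (ContinuousMultilinearMap.norm_compContinuousLinearMap_le _ _).trans ?_
  simp

lemma HM_comp {S : Matrix (Fin n) (Fin n) ℝ} (hS : S.det ≠ 0) {φ : EE n → ℝ} (hφ : ContDiff ℝ 2 φ) (x : EE n) :
    HM (fun y => φ (mE S hS y)) x = S.transpose * HM φ (mE S hS x) * S := by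
  have d1 : Differentiable ℝ φ := hφ.differentiable (by norm_num)
  have d2 : ∀ k, Differentiable ℝ (pd k φ) := fun k => (pd_contDiff (k := 1) k (by exact_mod_cast hφ)).differentiable (by norm_num)
  have c : ∀ (k i : Fin n) (y : EE n), pd i (fun y => mE S hS y k) y = S k i := fun k i y => by
    have : (fun y => mE S hS y k) = fun y => ∑ j, S k j * y j := funext fun y => mE_apply S hS y k
    rw [this, pd_sum]
    · have : ∀ j, pd i (fun y : EE n => S k j * y j) y = S k j * if i = j then 1 else 0 := fun j => by
        rw [pd_const_mul i _ (by fun_prop), pd_coord]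
      simp_rw [this]; simp
    · intro j _; fun_prop
  have p1 : ∀ (f : EE n → ℝ) (_ : Differentiable ℝ f) i y, pd i (fun y => f (mE S hS y)) y = ∑ k, S k i * pd k f (mE S hS y) := fun f hf i y => by
    rw [pd_comp_vec (hf _) (mE S hS).differentiableAt]
    simp_rw [c]
  ext i j
  have e1 : pd i (fun y => φ (mE S hS y)) = fun y => ∑ k, S k i * pd k φ (mE S hS y) := funext fun y => p1 φ d1 i y
  show pd j (pd i (fun y => φ (mE S hS y))) x = _
  have dd : ∀ k, DifferentiableAt ℝ (fun y => pd k φ (mE S hS y)) x := fun k => (d2 k _).comp x (mE S hS).differentiableAt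
  rw [e1, pd_sum _ _ fun k _ => (dd k).const_mul _]
  simp_rw [pd_const_mul j _ (dd _), p1 _ (d2 _)]
  rw [Matrix.mul_assoc, Matrix.mul_apply]
  refine Finset.sum_congr rfl fun k _ => ?_
  rw [Matrix.mul_apply, Matrix.transpose_apply]
  congr 1
  exact Finset.sum_congr rfl fun l _ => mul_comm _ _

end lin

end partI1


section partJ0
section fin
open Filter MeasureTheory Set Asymptotics
variable {n : ℕ}

lemma hess_eq {u : EE n → ℝ} (hu : ContDiff ℝ 2 u) (x : EE n) : hess u x = HM u x := by
  ext i j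
  have hd : DifferentiableAt ℝ (fderiv ℝ u) x :=
    (hu.contDiffAt.fderiv_right (m := 1) (by norm_num)).differentiableAt (by simp)
  show iteratedFDeriv ℝ 2 u x ![ee i, ee j] = pd j (pd i u) x
  rw [pd_comm j i hu.contDiffAt, iteratedFDeriv_two_apply]
  unfold pd
  rw [fderiv_clm_apply hd (differentiableAt_const _)]
  simp

noncomputable def qd (A : Matrix (Fin n) (Fin n) ℝ) (b : Fin n → ℝ) (c : ℝ) (y : EE n) : ℝ :=
  (1/2) * ∑ i, ∑ j, A i j * y i * y j + ∑ i, b i * y i + c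

lemma qd_contDiff (A : Matrix (Fin n) (Fin n) ℝ) (b : Fin n → ℝ) (c : ℝ) {k : WithTop ℕ∞} : ContDiff ℝ k (qd A b c) := by
  unfold qd
  have : ∀ i, ContDiff ℝ k (fun y : EE n => y i) := fun i => contDiff_euclidean.1 contDiff_id i
  refine ContDiff.add (ContDiff.add (contDiff_const.mul (ContDiff.sum fun i _ => ContDiff.sum fun j _ => ?_)) (ContDiff.sum fun i _ => ?_)) contDiff_const
  · exact (contDiff_const.mul (this i)).mul (this j)
  · exact contDiff_const.mul (this i)

lemma pd_lin (a : Fin n → ℝ) (k : Fin n) (x : EE n) : pd k (fun y : EE n => ∑ j, a j * y j) x = a k := by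
  rw [pd_sum]
  · have : ∀ j, pd k (fun y : EE n => a j * y j) x = a j * if k = j then 1 else 0 := fun j => by
      rw [pd_const_mul k _ (by fun_prop), pd_coord]
    simp_rw [this]; simp
  · intro j _; fun_prop

lemma HM_qd {A : Matrix (Fin n) (Fin n) ℝ} (hA : A.transpose = A) (b : Fin n → ℝ) (c : ℝ) (x : EE n) : HM (qd A b c) x = A := by
  have p1 : ∀ k, pd k (qd A b c) = fun y => (∑ j, A k j * y j) + b k := by
    intro k
    funext y
    unfold qd
    rw [pd_add k (by fun_prop) (by fun_prop), pd_add k (by fun_prop) (by fun_prop), pd_lin, pd_const_mul k _ (by fun_prop), pd_sum _ _ (by intros; fun_prop)]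
    have : ∀ i, pd k (fun y : EE n => ∑ j, A i j * y i * y j) y = A i k * y i + if k = i then ∑ j, A k j * y j else 0 := by
      intro i
      have e : (fun y : EE n => ∑ j, A i j * y i * y j) = fun y : EE n => y i * ∑ j, A i j * y j := by
        funext y
        rw [Finset.mul_sum]
        exact Finset.sum_congr rfl fun j _ => by ring
      rw [e, pd_mul k (by fun_prop) (by fun_prop), pd_lin, pd_coord]
      by_cases h : k = i
      · subst h; simp; ring
      · simp [h]; ring
    simp_rw [this]
    rw [Finset.sum_add_distrib]
    have s : ∀ i, A i k = A k i := fun i => by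
      have := congrFun (congrFun hA k) i
      exact this
    simp_rw [s]
    simp [pd]
    ring
  ext i j
  show pd j (pd i (qd A b c)) x = _
  rw [p1, pd_add j (by fun_prop) (by fun_prop), pd_lin]
  simp [pd]

lemma HM_add {f g : EE n → ℝ} (hf : ContDiff ℝ 2 f) (hg : ContDiff ℝ 2 g) (x : EE n) : HM (fun y => f y + g y) x = HM f x + HM g x := by
  ext i j
  have e : pd i (fun y => f y + g y) = fun y => pd i f y + pd i g y := funext fun y =>
    pd_add i (hf.differentiable (by norm_num) y) (hg.differentiable (by norm_num) y)
  show pd j (pd i (fun y => f y + g y)) x = pd j (pd i f) x + pd j (pd i g) x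
  rw [e, pd_add j (pd_diff i hf.contDiffAt) (pd_diff i hg.contDiffAt)]

lemma qd_neg (A : Matrix (Fin n) (Fin n) ℝ) (b : Fin n → ℝ) (c : ℝ) (y : EE n) : qd (-A) (-b) (-c) y = - qd A b c y := by
  simp [qd, Finset.sum_neg_distrib]
  ring

lemma HM_sub_qd {f : EE n → ℝ} (hf : ContDiff ℝ 2 f) {A : Matrix (Fin n) (Fin n) ℝ} (hA : A.transpose = A) (b : Fin n → ℝ) (c : ℝ) (x : EE n) :
    HM (fun y => f y - qd A b c y) x = HM f x - A := by
  have := HM_add hf (qd_contDiff (-A) (-b) (-c)) x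
  rw [HM_qd (by rw [Matrix.transpose_neg, hA])] at this
  simp_rw [qd_neg] at this
  simp_rw [sub_eq_add_neg]
  exact this

lemma ut_reg (hn : 3 ≤ n) {m : ℕ} (hm : 2 ≤ m) {f u : EE n → ℝ}
    (hf_Cm : ∀ᶠ x in LI n, ContDiffAt ℝ m f x) (hu : ContDiff ℝ 2 u)
    (hsym : ∀ x, (hess u x).IsHermitian)
    (heq : ∀ x, -Real.sqrt 2 * ∑ i, 1 / (1 + (hsym x).eigenvalues i) = f x)
    (hpos : ∀ x, (hess u x + 1).PosDef) :
    (∀ x, ((1 + HM u x)⁻¹).trace = (-(Real.sqrt 2)⁻¹) * f x) ∧ ∀ᶠ x in LI n, ContDiffAt ℝ (m+1:ℕ) u x := by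
  have s2 : Real.sqrt 2 ≠ 0 := by positivity
  have hd : ∀ x, (1 + hess u x).det ≠ 0 := fun x => by rw [add_comm]; exact (hpos x).det_pos.ne'
  have tr : ∀ x, ((1 + HM u x)⁻¹).trace = (-(Real.sqrt 2)⁻¹) * f x := fun x => by
    rw [← hess_eq hu, ← tr_inv (hsym x) (hd x), ← heq x]
    field_simp
  refine ⟨tr, hf_Cm.mono fun x hx => ?_⟩
  obtain ⟨k, rfl⟩ : ∃ k, m = k + 1 := ⟨m - 1, by omega⟩
  have hq := HM_qd (n := n) (A := 1) Matrix.transpose_one 0 0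
  have hv := HM_add hu (qd_contDiff (1 : Matrix (Fin n) (Fin n) ℝ) 0 0)
  simp_rw [hq] at hv
  have := legendre_reg hn k (v := fun y => u y + qd 1 0 0 y) (g := fun x => (-(Real.sqrt 2)⁻¹) * f x) (x₀ := x)
    (hu.add (qd_contDiff _ _ _)) (by rw [hv, add_comm, ← hess_eq hu]; exact hd x) (contDiffAt_const.mul hx)
    (Eventually.of_forall fun y => by rw [hv, add_comm, tr])
  have := this.sub (qd_contDiff (1 : Matrix (Fin n) (Fin n) ℝ) 0 0).contDiffAt
  refine this.congr_of_eventuallyEq (Eventually.of_forall fun y => ?_)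
  simp

end fin

end partJ0


section partJ1
section fin2
open Filter MeasureTheory Set Asymptotics
variable {n : ℕ}

lemma hat_reg {k : ℕ} (T : EE n ≃L[ℝ] EE n) {g : EE n → ℝ} {s : ℝ} (hg : ∀ᶠ x in LI n, ContDiffAt ℝ k g x)
    (h : ∀ j ≤ k, (fun x => ‖iteratedFDeriv ℝ j g x‖) =O[LI n] wt (s+j) 0) :
    (∀ᶠ x in LI n, ContDiffAt ℝ k (fun y => g (T y)) x) ∧ OC k s 0 (fun y => g (T y)) := by
  have c : ∀ᶠ x in LI n, ContDiffAt ℝ k (fun y => g (T y)) x := by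
    filter_upwards [(tend_equiv T).eventually hg] with x hx
    exact hx.comp x T.contDiff.contDiffAt
  exact ⟨c, OC.of_io k s _ c fun j hj => io_comp T (h j hj)⟩

lemma S_facts {A : Matrix (Fin n) (Fin n) ℝ} (hApos : (A + 1).PosDef) {r : ℝ} (hr : 0 < r) :
    (1 + A).det ≠ 0 ∧ (r • (1 + A)).PosDef ∧ (r • (1 + A)).det ≠ 0 ∧ (r • (1+A)).transpose = r • (1+A) := by
  rw [add_comm] at hApos
  have h2 : (r • (1 + A)).PosDef := hApos.smul hr
  refine ⟨hApos.det_pos.ne', h2, h2.det_pos.ne', ?_⟩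
  have := h2.isHermitian
  rwa [Matrix.IsHermitian, Matrix.conjTranspose_eq_transpose_of_trivial] at this

theorem main_core (hn : 3 ≤ n) {m : ℕ} (hm : 2 ≤ m) {f u : EE n → ℝ} {finf ζ β : ℝ} (hβn : (n:ℝ) < β) (hβζ : β ≤ ζ) (hβ2 : β ≤ 2 * n)
    (hf_Cm : ∀ᶠ x in LI n, ContDiffAt ℝ m f x)
    (hfd : ∀ j ≤ m, (fun x => ‖iteratedFDeriv ℝ j (fun y => f y - finf) x‖) =O[LI n] wt (ζ+j) 0)
    (hu : ContDiff ℝ 2 u)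
    (hum : ∀ᶠ x in LI n, ContDiffAt ℝ (m+1:ℕ) u x)
    (htr : ∀ x, ((1 + HM u x)⁻¹).trace = (-(Real.sqrt 2)⁻¹) * f x)
    {A : Matrix (Fin n) (Fin n) ℝ} {b : Fin n → ℝ} {c : ℝ} (hAs : A.transpose = A)
    (htA : ((1 + A)⁻¹).trace = (-(Real.sqrt 2)⁻¹) * finf)
    (hfirst : ∀ k ≤ m+1, (fun x => ‖iteratedFDeriv ℝ k (fun y => u y - qd A b c y) x‖) =O[LI n] wt ((n:ℝ)-2+k) 0)
    {r : ℝ} (hr : r * r = (Real.sqrt 2)⁻¹) (hMd : (1 + A).det ≠ 0) (hS : (r • (1+A)).det ≠ 0)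
    (hSs : (r • (1+A)).transpose = r • (1+A)) (N : ℕ) (hN : (N:ℝ) < β - n) (hN' : β - n ≤ N + 1) :
    ∃ (c₀ : ℝ) (P : ℕ → MvPolynomial (Fin n) ℝ), (∀ k, (P k).IsHomogeneous k ∧ plap (P k) = 0) ∧ P 0 = MvPolynomial.C c₀ ∧
      ∀ j ≤ m, (fun x => ‖iteratedFDeriv ℝ j (fun y => (u y - qd A b c y) - ∑ k ∈ Finset.range (N+1), evP (P k) (mE _ hS y) * ‖mE _ hS y‖ ^ ((2:ℝ) - n - 2*k)) x‖)
        =O[LI n] wt (β - 2 + j) (if β - n = N + 1 then 1 else 0) := by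
  set T := mE _ hS with hT
  set φ : EE n → ℝ := fun y => u y - qd A b c y with hφ
  have φ2 : ContDiff ℝ 2 φ := hu.sub (qd_contDiff _ _ _)
  have φm : ∀ᶠ x in LI n, ContDiffAt ℝ (m+1:ℕ) φ x := hum.mono fun x hx => hx.sub (qd_contDiff _ _ _).contDiffAt
  obtain ⟨hc, hO⟩ := hat_reg T.symm φm (s := (n:ℝ)-2) hfirst
  set ψ : EE n → ℝ := fun y => φ (T.symm y) with hψ
  have ψ2 : ContDiff ℝ 2 ψ := φ2.comp T.symm.contDiff
  have φψ : φ = fun y => ψ (T y) := by funext y; simp [hψ]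
  obtain ⟨-, hF⟩ := hat_reg T.symm (hf_Cm.mono fun x hx => hx.sub contDiffAt_const) (s := ζ) hfd
  obtain ⟨l, rfl⟩ : ∃ l, m = l + 1 := ⟨m - 1, by omega⟩
  have hX : ∀ i j, OC l n 0 (fun x => HM ψ x i j) := fun i j => by
    have := (hO.2.2 i).2.2 j
    have e : (n:ℝ) - 2 + 1 + 1 = n := by ring
    rw [e] at this
    exact this
  have npos : (0:ℝ) < n := by exact_mod_cast (by omega)
  obtain ⟨hdet, hR⟩ := OC.trK (q := (Real.sqrt 2)⁻¹) npos (1 + A) hX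
  have s2 : Real.sqrt 2 ≠ 0 := by positivity
  have hlap : OC l β 0 (lap ψ) := by
    have h1 := ((hF.le (Nat.le_succ l)).weaken 0 hβζ).add ((hR.weaken 0 (by linarith : β ≤ (n:ℝ)+n)).cmul (Real.sqrt 2))
    refine h1.congr ?_
    filter_upwards [hdet] with y hy
    have e := tr_expand (M := 1 + A) (Xh := HM ψ y) hr hMd hy
    have e1 : HM u (T.symm y) - A = (r • (1 + A)) * HM ψ y * (r • (1 + A)) := by
      rw [← HM_sub_qd hu hAs b c, show (fun y => u y - qd A b c y) = fun y => ψ (T y) from φψ, HM_comp hS ψ2, hSs, ← hT]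
      simp
    rw [← e1, show 1 + A + (HM u (T.symm y) - A) = 1 + HM u (T.symm y) by abel, htr, htA] at e
    have : lap ψ y = (HM ψ y).trace := rfl
    rw [this]
    set t := (HM ψ y).trace
    set w := Matrix.trace ((Real.sqrt 2)⁻¹ • (HM ψ y * (1 + A)) * (Real.sqrt 2)⁻¹ • (HM ψ y * (1 + A)) * (1 + (Real.sqrt 2)⁻¹ • (HM ψ y * (1 + A)))⁻¹ * (1 + A)⁻¹)
    field_simp at e
    linarith
  obtain ⟨c₀, P, hP, hP0, hcd, hoc⟩ := core hn hm ψ2 hc (hO.le (by omega)) hβn hlap N hN hN'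
  refine ⟨c₀, P, hP, hP0, fun j hj => ?_⟩
  have := io_comp T (OC.to_io _ _ _ _ (hcd.mono fun x hx => hx.of_le (by exact_mod_cast (by omega))) hoc j hj)
  have e : ∀ y, u y - qd A b c y = ψ (T y) := fun y => congrFun φψ y
  simp only [e]
  exact this

end fin2

end partJ1


section fin3
open Filter MeasureTheory Set Asymptotics
variable {n : ℕ}

lemma quad_norm {S B : Matrix (Fin n) (Fin n) ℝ} (hd : S.det ≠ 0) (hs : S.transpose = S) (hB : S * S = B) (y : EE n) :
    ∑ i, ∑ j, B i j * y i * y j = ‖mE S hd y‖ ^ 2 := by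
  rw [norm_sq_sum, ← hB]
  simp_rw [mE_apply, sq, Finset.sum_mul_sum, Matrix.mul_apply, Finset.sum_mul]
  have s : ∀ i j, S i j = S j i := fun i j => congrFun (congrFun hs j) i
  rw [Finset.sum_congr rfl fun i _ => Finset.sum_comm, Finset.sum_comm]
  refine Finset.sum_congr rfl fun l _ => Finset.sum_congr rfl fun i _ => Finset.sum_congr rfl fun j _ => ?_
  rw [s i l]; ring

lemma term_eq {S B : Matrix (Fin n) (Fin n) ℝ} (hd : S.det ≠ 0) (hs : S.transpose = S) (hB : S * S = B) (y : EE n) (hy : 0 < ‖y‖)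
    {k : ℕ} {P : MvPolynomial (Fin n) ℝ} (hP : P.IsHomogeneous k) :
    MvPolynomial.eval (fun i => (∑ j, S i j * y j) / Real.sqrt (∑ i', ∑ j', B i' j' * y i' * y j')) P *
      (∑ i, ∑ j, B i j * y i * y j) ^ (((2 : ℝ) - n - k) / 2) = evP P (mE S hd y) * ‖mE S hd y‖ ^ ((2:ℝ) - n - 2*k) := by
  have hz : 0 < ‖mE S hd y‖ := by
    rw [norm_pos_iff] at hy ⊢
    simpa using hy
  rw [quad_norm hd hs hB, Real.sqrt_sq hz.le]
  set z := mE S hd y with hzd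
  have e1 : MvPolynomial.eval (fun i => (∑ j, S i j * y j) / ‖z‖) P = evP P (‖z‖⁻¹ • z) := by
    unfold evP
    congr 2
    funext i
    rw [PiLp.smul_apply, hzd, mE_apply, smul_eq_mul]
    ring
  rw [e1, evP_smul hP, ← Real.rpow_natCast ‖z‖ 2, ← Real.rpow_mul hz.le]
  rw [show ((2:ℕ):ℝ) * (((2 : ℝ) - n - k) / 2) = (2:ℝ) - n - 2*k + k by push_cast; ring, Real.rpow_add hz, Real.rpow_natCast]
  have : ‖z‖⁻¹ ^ k * ‖z‖ ^ k = 1 := by rw [← mul_pow, inv_mul_cancel₀ hz.ne', one_pow]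
  linear_combination (evP P z * ‖z‖ ^ ((2:ℝ) - n - 2*k)) * this

lemma full_eq {S B : Matrix (Fin n) (Fin n) ℝ} (hd : S.det ≠ 0) (hs : S.transpose = S) (hB : S * S = B) (y : EE n) (hy : 0 < ‖y‖)
    {P : ℕ → MvPolynomial (Fin n) ℝ} (hP : ∀ k, (P k).IsHomogeneous k) {c₀ : ℝ} (h0 : P 0 = MvPolynomial.C c₀) (N : ℕ) (w : ℝ) :
    w - c₀ * (∑ i, ∑ j, B i j * y i * y j) ^ (((2 : ℝ) - n) / 2)
                - ∑ k ∈ Finset.Icc 1 N,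
                    MvPolynomial.eval
                      (fun i => (∑ j, S i j * y j) /
                        Real.sqrt (∑ i', ∑ j', B i' j' * y i' * y j')) (P k) *
                    (∑ i, ∑ j, B i j * y i * y j) ^ (((2 : ℝ) - n - k) / 2)
      = w - ∑ k ∈ Finset.range (N+1), evP (P k) (mE _ hd y) * ‖mE _ hd y‖ ^ ((2:ℝ) - n - 2*k) := by
  have e : ∀ k, evP (P k) (mE _ hd y) * ‖mE _ hd y‖ ^ ((2:ℝ) - n - 2*k) = _ := fun k => (term_eq hd hs hB y hy (hP k)).symm
  simp_rw [e]
  rw [Finset.range_eq_Ico, Finset.sum_eq_sum_Ico_succ_bot (Nat.succ_pos N), h0, MvPolynomial.eval_C]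
  rw [show Finset.Ico (0+1) (N+1) = Finset.Icc 1 N by ext; simp]
  simp only [Nat.cast_zero, sub_zero]
  ring

lemma N_facts {N : ℕ} {ζ : ℝ} (hn : 3 ≤ n) (hζ : (n : ℝ) < ζ)
    (hN : N = if 2 * (n : ℝ) ≤ ζ then n - 1 else n - 1 - (⌊2 * (n : ℝ) - ζ⌋).toNat) :
    (N:ℝ) < min (2 * (n : ℝ)) ζ - n ∧ min (2 * (n : ℝ)) ζ - n ≤ N + 1 := by
  split_ifs at hN with h
  · rw [min_eq_left h, hN, Nat.cast_sub (by omega)]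
    constructor <;> (push_cast; linarith)
  · push Not at h
    rw [min_eq_right h.le]
    have f0 : 0 ≤ ⌊2 * (n : ℝ) - ζ⌋ := Int.floor_nonneg.2 (by linarith)
    have f1 := Int.floor_le (2 * (n : ℝ) - ζ)
    have f2 := Int.lt_floor_add_one (2 * (n : ℝ) - ζ)
    obtain ⟨j, hj⟩ := Int.eq_ofNat_of_zero_le f0
    rw [hj] at hN f1 f2
    simp only [Int.toNat_natCast] at hN
    push_cast at f1 f2
    have jn : j < n := by
      have : (j:ℝ) < n := by linarith
      exact_mod_cast this
    rw [hN, Nat.cast_sub (by omega), Nat.cast_sub (by omega)]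
    push_cast
    constructor <;> linarith

lemma int_iff {N : ℕ} {t : ℝ} (h1 : (N:ℝ) < t) (h2 : t ≤ N + 1) : (∃ z : ℤ, t = (z:ℝ)) ↔ t = N + 1 := by
  constructor
  · rintro ⟨z, rfl⟩
    have a : (N:ℤ) < z := by exact_mod_cast h1
    have b : z ≤ (N:ℤ) + 1 := by exact_mod_cast h2
    have : z = (N:ℤ) + 1 := by omega
    rw [this]; push_cast; ring
  · intro h
    exact ⟨N + 1, by rw [h]; push_cast; ring⟩

lemma of_isO {g : EE n → ℝ} {s : ℝ} {e : ℕ} (h : g =O[LI n] wt s e) :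
    ∃ C R : ℝ, 0 < C ∧ 1 < R ∧ ∀ x, R ≤ ‖x‖ → |g x| ≤ C * wt s e x := by
  obtain ⟨C, R, hC, hR, h⟩ := isO_iff.1 h
  exact ⟨C, R + 1, hC, by linarith, fun x hx => h x (by linarith)⟩

end fin3
/-- **Theorem 1.2, case τ = π/4, higher order expansion**: under the hypotheses of
Theorem 1.1 for the equation `-√2 Σᵢ 1/(1+λᵢ(D²u)) = f` with `ζ > n`, given the quadratic
polynomial `Q(x) = ½xᵀAx + b·x + c` with `u - Q = O_{m+1}(|x|^{2-n})` and setting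
`B = 2^{-1/2}(I+A)²`, there exist `c₀ ∈ ℝ` and homogeneous harmonic polynomials `P_k` of
degree `k`, `1 ≤ k ≤ N` with `N = n - 1 - ⌊2n-ζ⌋` (`= n-1` if `ζ ≥ 2n`), such that
`u - Q - c₀(xᵀBx)^{(2-n)/2} - Σ_k P_k(θ)(xᵀBx)^{(2-n-k)/2} = O_m(|x|^{2-min{2n,ζ}})`
(extra `ln|x|` factor when `min{2n,ζ} - n ∈ ℕ`), where `θ = B^{1/2}x/(xᵀBx)^{1/2}`,
`B^{1/2}` being the positive definite symmetric square root `S` of `B`. -/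
theorem higher_order_expansion_tau_pi_div_four
    (n m : ℕ) (hn : 3 ≤ n) (hm : 2 ≤ m) (ζ : ℝ) (hζ : (n : ℝ) < ζ)
    (f : EuclideanSpace ℝ (Fin n) → ℝ) (finf : ℝ)
    (hf_cont : Continuous f)
    (hf_Cm : ∃ K : Set (EuclideanSpace ℝ (Fin n)), IsCompact K ∧ ContDiffOn ℝ m f Kᶜ)
    (hf_lim : Tendsto f (cocompact _) (nhds finf))
    (hf_decay : ∀ k : ℕ, k ≤ m → ∃ C R : ℝ, 0 < C ∧ 0 < R ∧
      ∀ x : EuclideanSpace ℝ (Fin n), R ≤ ‖x‖ →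
        ‖x‖ ^ (ζ + k) * ‖iteratedFDeriv ℝ k (fun y => f y - finf) x‖ ≤ C)
    (u : EuclideanSpace ℝ (Fin n) → ℝ) (hu : ContDiff ℝ 2 u)
    (hsym : ∀ x, (hess u x).IsHermitian)
    (heq : ∀ x, -Real.sqrt 2 * ∑ i, 1 / (1 + (hsym x).eigenvalues i) = f x)
    (hgrow : ∃ C : ℝ, ∀ x : EuclideanSpace ℝ (Fin n), u x ≤ C * (1 + ‖x‖ ^ 2))
    (hsemiconv : ∀ x, (hess u x + 1).PosDef)
    (A : Matrix (Fin n) (Fin n) ℝ) (b : Fin n → ℝ) (c : ℝ) (hA : A.IsHermitian)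
    (hApos : (A + 1).PosDef)
    (hAeq : -Real.sqrt 2 * ∑ i, 1 / (1 + hA.eigenvalues i) = finf)
    (hfirst : ∀ k : ℕ, k ≤ m + 1 → ∃ C R : ℝ, 0 < C ∧ 1 < R ∧
      ∀ x : EuclideanSpace ℝ (Fin n), R ≤ ‖x‖ →
        ‖iteratedFDeriv ℝ k
            (fun y => u y - ((1/2) * ∑ i, ∑ j, A i j * y i * y j + ∑ i, b i * y i + c)) x‖
          ≤ C * ‖x‖ ^ ((2 : ℝ) - n - k))
    (B : Matrix (Fin n) (Fin n) ℝ)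
    (hB : B = (Real.sqrt 2)⁻¹ • ((1 + A) * (1 + A)))
    (N : ℕ) (hN : N = if 2 * (n : ℝ) ≤ ζ then n - 1 else n - 1 - (⌊2 * (n : ℝ) - ζ⌋).toNat) :
    ∃ (S : Matrix (Fin n) (Fin n) ℝ) (c₀ : ℝ) (P : ℕ → MvPolynomial (Fin n) ℝ),
      S.PosDef ∧ S * S = B ∧
      (∀ k : ℕ, 1 ≤ k → k ≤ N → (P k).IsHomogeneous k ∧
        ∑ i, MvPolynomial.pderiv i (MvPolynomial.pderiv i (P k)) = 0) ∧
      ((¬ (∃ z : ℤ, min (2 * (n : ℝ)) ζ - n = (z : ℝ)) →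
        ∀ k : ℕ, k ≤ m → ∃ C R : ℝ, 0 < C ∧ 1 < R ∧
          ∀ x : EuclideanSpace ℝ (Fin n), R ≤ ‖x‖ →
            ‖iteratedFDeriv ℝ k (fun y =>
                u y - ((1/2) * ∑ i, ∑ j, A i j * y i * y j + ∑ i, b i * y i + c)
                - c₀ * (∑ i, ∑ j, B i j * y i * y j) ^ (((2 : ℝ) - n) / 2)
                - ∑ k ∈ Finset.Icc 1 N,
                    MvPolynomial.eval
                      (fun i => (∑ j, S i j * y j) /
                        Real.sqrt (∑ i', ∑ j', B i' j' * y i' * y j')) (P k) *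
                    (∑ i, ∑ j, B i j * y i * y j) ^ (((2 : ℝ) - n - k) / 2)) x‖
              ≤ C * ‖x‖ ^ ((2 : ℝ) - min (2 * (n : ℝ)) ζ - k)) ∧
      ((∃ z : ℤ, min (2 * (n : ℝ)) ζ - n = (z : ℝ)) →
        ∀ k : ℕ, k ≤ m → ∃ C R : ℝ, 0 < C ∧ 1 < R ∧
          ∀ x : EuclideanSpace ℝ (Fin n), R ≤ ‖x‖ →
            ‖iteratedFDeriv ℝ k (fun y =>
                u y - ((1/2) * ∑ i, ∑ j, A i j * y i * y j + ∑ i, b i * y i + c)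
                - c₀ * (∑ i, ∑ j, B i j * y i * y j) ^ (((2 : ℝ) - n) / 2)
                - ∑ k ∈ Finset.Icc 1 N,
                    MvPolynomial.eval
                      (fun i => (∑ j, S i j * y j) /
                        Real.sqrt (∑ i', ∑ j', B i' j' * y i' * y j')) (P k) *
                    (∑ i, ∑ j, B i j * y i * y j) ^ (((2 : ℝ) - n - k) / 2)) x‖
              ≤ C * ‖x‖ ^ ((2 : ℝ) - min (2 * (n : ℝ)) ζ - k) * Real.log ‖x‖)) := by
  have s2 : 0 < Real.sqrt 2 := by positivity
  set r := Real.sqrt (Real.sqrt 2)⁻¹ with hrd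
  have hr0 : 0 < r := by positivity
  have hr : r * r = (Real.sqrt 2)⁻¹ := Real.mul_self_sqrt (by positivity)
  obtain ⟨hMd, hSp, hSd, hSs⟩ := S_facts hApos hr0
  have hSB : (r • (1 + A)) * (r • (1 + A)) = B := by
    rw [hB, Matrix.smul_mul, Matrix.mul_smul, smul_smul, hr]
  have hAs : A.transpose = A := by
    rwa [Matrix.IsHermitian, Matrix.conjTranspose_eq_transpose_of_trivial] at hA
  have htA : ((1 + A)⁻¹).trace = (-(Real.sqrt 2)⁻¹) * finf := by
    rw [← tr_inv hA hMd, ← hAeq]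
    field_simp
  have hfm : ∀ᶠ x in LI n, ContDiffAt ℝ m f x := by
    obtain ⟨K, hK, hfK⟩ := hf_Cm
    obtain ⟨R, hR⟩ := hK.isBounded.exists_norm_le
    filter_upwards [ev_gt R] with x hx
    refine hfK.contDiffAt (hK.isClosed.isOpen_compl.mem_nhds fun h => ?_)
    exact absurd (hR x h) (not_le.2 hx)
  obtain ⟨htr, hum⟩ := ut_reg hn hm hfm hu hsym heq hsemiconv
  have hfd : ∀ j ≤ m, Asymptotics.IsBigO (LI n) (fun x => ‖iteratedFDeriv ℝ j (fun y => f y - finf) x‖) (wt (ζ+j) 0) := by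
    intro j hj
    obtain ⟨C, R, hC, hR, h⟩ := hf_decay j hj
    refine isO_iff.2 ⟨C, max R 1, hC, le_max_right _ _, fun x hx => ?_⟩
    have x1 : 0 < ‖x‖ := by linarith [le_max_right R 1]
    have := h x ((le_max_left _ _).trans hx)
    rw [abs_norm, wt, pow_zero, mul_one, Real.rpow_neg x1.le, ← div_eq_mul_inv, le_div_iff₀ (by positivity), mul_comm]
    exact this
  have hfi : ∀ k ≤ m+1, Asymptotics.IsBigO (LI n) (fun x => ‖iteratedFDeriv ℝ k (fun y => u y - qd A b c y) x‖) (wt ((n:ℝ)-2+k) 0) := by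
    intro k hk
    obtain ⟨C, R, hC, hR, h⟩ := hfirst k hk
    refine isO_iff.2 ⟨C, R, hC, hR.le, fun x hx => ?_⟩
    rw [abs_norm, wt, pow_zero, mul_one, show -((n:ℝ)-2+k) = (2:ℝ) - n - k by ring]
    exact h x hx
  obtain ⟨hN1, hN2⟩ := N_facts hn hζ hN
  obtain ⟨c₀, P, hP, hP0, hmain⟩ := main_core hn hm (β := min (2 * (n:ℝ)) ζ) (by linarith [Nat.cast_nonneg (α := ℝ) N]) (min_le_right _ _)
    (min_le_left _ _) hfm hfd hu hum htr hAs htA hfi hr hMd hSd hSs N hN1 hN2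
  have key : ∀ j ≤ m, ∃ C R : ℝ, 0 < C ∧ 1 < R ∧
          ∀ x : EuclideanSpace ℝ (Fin n), R ≤ ‖x‖ →
            ‖iteratedFDeriv ℝ j (fun y =>
                u y - ((1/2) * ∑ i, ∑ j, A i j * y i * y j + ∑ i, b i * y i + c)
                - c₀ * (∑ i, ∑ j, B i j * y i * y j) ^ (((2 : ℝ) - n) / 2)
                - ∑ k ∈ Finset.Icc 1 N,
                    MvPolynomial.eval
                      (fun i => (∑ j, (r • (1 + A)) i j * y j) /
                        Real.sqrt (∑ i', ∑ j', B i' j' * y i' * y j')) (P k) *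
                    (∑ i, ∑ j, B i j * y i * y j) ^ (((2 : ℝ) - n - k) / 2)) x‖
              ≤ C * (‖x‖ ^ ((2 : ℝ) - min (2 * (n : ℝ)) ζ - j) * Real.log ‖x‖ ^ (if min (2 * (n : ℝ)) ζ - n = N + 1 then 1 else 0)) := by
    intro j hj
    obtain ⟨C, R, hC, hR, h⟩ := of_isO (hmain j hj)
    refine ⟨C, R, hC, hR, fun x hx => ?_⟩
    have h1 := h x hx
    have x0 : 0 < ‖x‖ := by linarith
    rw [abs_norm, wt, show -(min (2 * (n:ℝ)) ζ - 2 + j) = (2:ℝ) - min (2 * (n : ℝ)) ζ - j by ring] at h1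
    refine le_trans (le_of_eq ?_) h1
    congr 1
    refine Filter.EventuallyEq.eq_of_nhds (Filter.EventuallyEq.iteratedFDeriv (𝕜 := ℝ) ?_ j)
    filter_upwards [(isOpen_lt continuous_const continuous_norm).mem_nhds x0] with y hy
    exact full_eq hSd hSs hSB y hy (fun k => (hP k).1) hP0 N _
  refine ⟨r • (1 + A), c₀, P, hSp, hSB, fun k _ _ => hP k, fun hz k hk => ?_, fun hz k hk => ?_⟩
  · rw [int_iff hN1 hN2] at hz
    have := key k hk
    simp only [if_neg hz, pow_zero, mul_one] at this
    exact this
  · rw [int_iff hN1 hN2] at hz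
    have := key k hk
    simp only [if_pos hz, pow_one, ← mul_assoc] at this
    exact this
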